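/- For every two-dimensional centrally symmetric convex domain C, γ*(C) ≤ 2(2−√2). -/

import Mathlib

open Pointwise Set

noncomputable section

def IsPacking (C X : Set (ℝ × ℝ)) : Prop :=
  X.Pairwise fun x y => Disjoint (interior (C + {x})) (interior (C + {y}))

def IsCovering (D X : Set (ℝ × ℝ)) : Prop :=
  ⋃ x ∈ X, (D + {x}) = Set.univ

def IsLattice2 (Λ : Set (ℝ × ℝ)) : Prop :=
  ∃ v w : ℝ × ℝ, LinearIndependent ℝ ![v, w] ∧
    Λ = {p | ∃ z₁ z₂ : ℤ, p = (z₁ : ℝ) • v + (z₂ : ℝ) • w}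

/-- γ*(C): the smallest `r > 0` for which some lattice `Λ` makes `C + Λ` a packing
and `rC + Λ` a covering of the plane. -/
def gammaStar (C : Set (ℝ × ℝ)) : ℝ :=
  sInf {r : ℝ | 0 < r ∧ ∃ Λ : Set (ℝ × ℝ),
    IsLattice2 Λ ∧ IsPacking C Λ ∧ IsCovering (r • C) Λ}

/-- Three points of the unit ball of `N` at mutual distances at least `s`. -/
def HasTriple {E : Type*} [AddCommGroup E] [Module ℝ E] (N : Seminorm ℝ E) (s : ℝ) : Prop :=
  ∃ a b c : E, N a ≤ 1 ∧ N b ≤ 1 ∧ N c ≤ 1 ∧ s ≤ N (a - b) ∧ s ≤ N (b - c) ∧ s ≤ N (a - c)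

section Seminorm

variable {E : Type*} [AddCommGroup E] [Module ℝ E] (N : Seminorm ℝ E)

theorem Seminorm.map_smul_of_nonneg' {t : ℝ} (ht : 0 ≤ t) (x : E) : N (t • x) = t * N x := by
  rw [map_smul_eq_mul, Real.norm_of_nonneg ht]

theorem Seminorm.map_lincomb_le (s t : ℝ) (x y : E) :
    N (s • x + t • y) ≤ |s| * N x + |t| * N y := by
  refine (map_add_le_add N _ _).trans ?_
  rw [map_smul_eq_mul, map_smul_eq_mul, Real.norm_eq_abs, Real.norm_eq_abs]

/-- The monotonicity lemma of normed planes. -/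
theorem Seminorm.map_add_smul_anti {a r r' : E} {α β b : ℝ} (hr : N r = 1) (hr' : N r' = 1)
    (hα : 0 ≤ α) (hβ : 0 ≤ β) (hb : 0 ≤ b) (h : r' = α • r - β • a) :
    N (a + b • r') ≤ N (a + b • r) := by
  set F := N (a + b • r) with hF
  by_cases hc : 1 - b * β ≤ α
  · have hD : 0 < α + b * β := by linarith
    have h1 : α + b * β ≤ β * F + 1 := by
      have e : (α + b * β) • r = β • (a + b • r) + (1 : ℝ) • r' := by rw [h]; module
      have := N.map_lincomb_le β 1 (a + b • r) r'
      rw [← e, N.map_smul_of_nonneg' hD.le, hr, hr', abs_of_nonneg hβ, abs_one] at this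
      linarith
    have e : (α + b * β) • (a + b • r') = α • (a + b • r) + (b * (α - 1 + b * β)) • r' := by
      rw [h]; module
    have h2 := N.map_lincomb_le α (b * (α - 1 + b * β)) (a + b • r) r'
    rw [← e, N.map_smul_of_nonneg' hD.le, hr', abs_of_nonneg hα,
      abs_of_nonneg (mul_nonneg hb (by linarith)), ← hF] at h2
    have h3 : b * (α + b * β) ≤ b * (β * F + 1) := mul_le_mul_of_nonneg_left h1 hb
    refine le_of_mul_le_mul_left ?_ hD
    nlinarith
  · push Not at hc
    have h1 : N a - b ≤ F := by
      have e : a = (1 : ℝ) • (a + b • r) + (-b) • r := by module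
      have := N.map_lincomb_le 1 (-b) (a + b • r) r
      rw [← e, hr, abs_neg, abs_of_nonneg hb, abs_one] at this
      linarith
    have h2 : 1 ≤ α + β * N a := by
      have := N.map_lincomb_le α (-β) r a
      rw [show α • r + (-β) • a = r' by rw [h]; module, hr, hr', abs_neg, abs_of_nonneg hα,
        abs_of_nonneg hβ] at this
      linarith
    have e : a + b • r' = α • (a + b • r) + (1 - b * β - α) • a := by rw [h]; module
    have h3 := N.map_lincomb_le α (1 - b * β - α) (a + b • r) a
    rw [← e, abs_of_nonneg hα, abs_of_nonneg (by linarith), ← hF] at h3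
    have : 0 ≤ b * β := mul_nonneg hb hβ
    have h4 : 0 ≤ (1 - α) * (F - (N a - b)) := mul_nonneg (by linarith) (by linarith)
    nlinarith

theorem hasTriple_of_frame {s M : ℝ} {p r : E} (hs : 17 / 10 ≤ s) (hs' : 2 * (s - 1) ^ 2 ≤ 1)
    (hM : s ^ 2 - 1 ≤ M) (hp : N p = 1) (hr : N r = 1)
    (h1 : M ≤ N (s • p + r)) (h2 : M ≤ N (s • p - r))
    (h3 : N (p + s • r) ≤ M) (h4 : N (p - s • r) ≤ M) : HasTriple N s := by
  have hs2 : s < 2 := by nlinarith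
  have hM0 : 0 < M := by nlinarith
  have key : ∀ r' : E, N r' = 1 → M ≤ N (s • p + r') → N (p + s • r') ≤ M →
      ∀ x y : ℝ, 0 ≤ x → 0 ≤ y →
      (M ≤ 2 → x = 1 / M → y = s / M → s ≤ N (p + (x • p + y • r'))) ∧
      (2 < M → x = (1 - s / 2) / (M - s) → y = s / 2 →
        N (x • p + y • r') ≤ 1 ∧ s ≤ N (p + (x • p + y • r'))) := by
    intro r' hr' hA hB x y hx0 hy0
    constructor
    · intro hM2 hx hy
      have e : (s • p + r') = s • p + r' := rfl
      have e1 : s • p + r' = (s * M / (M + 1)) • (p + (x • p + y • r'))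
          + (1 - s ^ 2 / (M + 1)) • r' := by
        rw [hx, hy]
        have : (0:ℝ) < M + 1 := by linarith
        match_scalars <;> field_simp <;> ring
      have h := N.map_lincomb_le (s * M / (M + 1)) (1 - s ^ 2 / (M + 1))
        (p + (x • p + y • r')) r'
      have hc : 0 ≤ 1 - s ^ 2 / (M + 1) := by
        rw [sub_nonneg, div_le_one (by linarith)]; linarith
      rw [← e1, abs_of_nonneg (by positivity), abs_of_nonneg hc, hr'] at h
      have h5 : M ≤ s * M / (M + 1) * N (p + (x • p + y • r')) + (1 - s ^ 2 / (M + 1)) := by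
        linarith
      set X := N (p + (x • p + y • r'))
      have h6 : M * (M + 1) ≤ s * M * X + (M + 1 - s ^ 2) := by
        have := mul_le_mul_of_nonneg_right h5 (show 0 ≤ M + 1 by linarith)
        have e2 : (s * M / (M + 1) * X + (1 - s ^ 2 / (M + 1))) * (M + 1)
          = s * M * X + (M + 1 - s ^ 2) := by
          have : (0:ℝ) < M + 1 := by linarith
          field_simp
          try ring
        linarith
      have h7 : s * M * s ≤ s * M * X := by nlinarith
      exact le_of_mul_le_mul_left h7 (by positivity)
    · intro hM2 hx hy
      have hMs : 0 < M - s := by linarith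
      have hx' : x * (M - s) = 1 - s / 2 := by rw [hx]; field_simp
      have hxh : x ≤ 1 / 2 := by
        rw [hx, div_le_iff₀ hMs]; linarith
      constructor
      · have e : x • p + y • r' = x • (p + s • r') + (s / 2 - x * s) • r' := by
          rw [hy]; module
        rw [e]
        refine (N.map_lincomb_le _ _ _ _).trans ?_
        rw [abs_of_nonneg hx0, abs_of_nonneg (by nlinarith), hr']
        nlinarith
      · set X := N (p + (x • p + y • r')) with hX
        by_cases hc : s ^ 2 / 2 ≤ 1 + x
        · have e : (1 + x) • (s • p + r') = s • (p + (x • p + y • r'))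
              + (1 + x - s ^ 2 / 2) • r' := by rw [hy]; module
          have h := N.map_lincomb_le s (1 + x - s ^ 2 / 2) (p + (x • p + y • r')) r'
          rw [← e, N.map_smul_of_nonneg' (by linarith), abs_of_nonneg (by linarith : 0 ≤ s),
            abs_of_nonneg (by linarith), hr', ← hX] at h
          have h5 : (1 + x) * M ≤ (1 + x) * N (s • p + r') :=
            mul_le_mul_of_nonneg_left hA (by linarith)
          have : s * s ≤ s * X := by nlinarith
          exact le_of_mul_le_mul_left this (by linarith)
        · push Not at hc
          have e : s • (s • p + r') = (2 : ℝ) • (p + (x • p + y • r'))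
              + (s ^ 2 - 2 - 2 * x) • p := by rw [hy]; module
          have h := N.map_lincomb_le 2 (s ^ 2 - 2 - 2 * x) (p + (x • p + y • r')) p
          rw [← e, N.map_smul_of_nonneg' (by linarith), abs_of_nonneg (by linarith : (0:ℝ) ≤ 2),
            abs_of_nonneg (by linarith), hp, ← hX] at h
          have h5 : s * M ≤ s * N (s • p + r') := mul_le_mul_of_nonneg_left hA (by linarith)
          have h6 : 2 * (s - 1) ≤ s * (M - s) + 2 * x := by
            have : (2 * (s - 1)) ^ 2 ≤ (s * (M - s) + 2 * x) ^ 2 := by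
              nlinarith [sq_nonneg (s * (M - s) - 2 * x)]
            exact le_of_sq_le_sq this (by positivity)
          nlinarith
  by_cases hM2 : M ≤ 2
  · refine ⟨-p, (1 / M) • p + (s / M) • r, (1 / M) • p + (s / M) • (-r), ?_, ?_, ?_, ?_, ?_, ?_⟩
    · rw [map_neg_eq_map, hp]
    · rw [show (1 / M) • p + (s / M) • r = (1 / M) • (p + s • r) by module,
        N.map_smul_of_nonneg' (by positivity), one_div_mul_eq_div, div_le_one hM0]
      exact h3
    · rw [show (1 / M) • p + (s / M) • (-r) = (1 / M) • (p - s • r) by module,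
        N.map_smul_of_nonneg' (by positivity), one_div_mul_eq_div, div_le_one hM0]
      exact h4
    · rw [← neg_add', map_neg_eq_map]
      exact (key r hr h1 h3 _ _ (by positivity) (by positivity)).1 hM2 rfl rfl
    · rw [show (1 / M) • p + (s / M) • r - ((1 / M) • p + (s / M) • (-r)) = (2 * s / M) • r by
        module, N.map_smul_of_nonneg' (by positivity), hr, mul_one, le_div_iff₀ hM0]
      nlinarith
    · rw [← neg_add', map_neg_eq_map]
      exact (key (-r) (by rw [map_neg_eq_map, hr]) (by simpa [sub_eq_add_neg] using h2)
        (by simpa [sub_eq_add_neg] using h4) _ _ (by positivity) (by positivity)).1 hM2 rfl rfl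
  · push Not at hM2
    have hMs : 0 < M - s := by linarith
    have hx : 0 ≤ (1 - s / 2) / (M - s) := div_nonneg (by linarith) hMs.le
    have k1 := (key r hr h1 h3 _ _ hx (by positivity : (0:ℝ) ≤ s / 2)).2 hM2 rfl rfl
    have k2 := (key (-r) (by rw [map_neg_eq_map, hr]) (by simpa [sub_eq_add_neg] using h2)
        (by simpa [sub_eq_add_neg] using h4) _ _ hx
        (by positivity : (0:ℝ) ≤ s / 2)).2 hM2 rfl rfl
    set x := (1 - s / 2) / (M - s)
    refine ⟨-p, x • p + (s / 2) • r, x • p + (s / 2) • (-r), ?_, k1.1, k2.1, ?_, ?_, ?_⟩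
    · rw [map_neg_eq_map, hp]
    · rw [← neg_add', map_neg_eq_map]; exact k1.2
    · rw [show x • p + (s / 2) • r - (x • p + (s / 2) • (-r)) = s • r by module,
        N.map_smul_of_nonneg' (by positivity), hr, mul_one]
    · rw [← neg_add', map_neg_eq_map]; exact k2.2

end Seminorm

/-- The determinant of two plane vectors. -/
def cross (x y : ℝ × ℝ) : ℝ := x.1 * y.2 - x.2 * y.1

theorem cross_smul_eq (v w z : ℝ × ℝ) : cross v w • z = cross z w • v + cross v z • w := by
  ext <;> simp [cross] <;> ring

theorem exists_coords {v w : ℝ × ℝ} (h : cross v w ≠ 0) (z : ℝ × ℝ) :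
    ∃ x y : ℝ, z = x • v + y • w := by
  refine ⟨cross z w / cross v w, cross v z / cross v w, ?_⟩
  have := cross_smul_eq v w z
  rw [div_eq_inv_mul, div_eq_inv_mul, mul_smul, mul_smul, ← smul_add, ← this, smul_smul,
    inv_mul_cancel₀ h, one_smul]

theorem exists_smul_of_cross_eq_zero {v w : ℝ × ℝ} (hv : v ≠ 0) (h : cross v w = 0) :
    ∃ t : ℝ, w = t • v := by
  simp only [cross] at h
  by_cases h1 : v.1 = 0
  · have h2 : v.2 ≠ 0 := fun h2 => hv (Prod.ext h1 h2)
    refine ⟨w.2 / v.2, Prod.ext ?_ ?_⟩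
    · have : v.2 * w.1 = 0 := by rw [h1] at h; linarith
      simp [h1, (mul_eq_zero.1 this).resolve_left h2]
    · simp [h2]
  · refine ⟨w.1 / v.1, Prod.ext ?_ ?_⟩
    · simp [h1]
    · simp only [Prod.smul_snd, smul_eq_mul]
      field_simp
      linarith

theorem cross_ne_zero_of_unit {N : Seminorm ℝ (ℝ × ℝ)} {v w : ℝ × ℝ} (hv : N v = 1)
    (hw : N w = 1) (h1 : N (w - v) ≠ 0) (h2 : N (w + v) ≠ 0) : cross v w ≠ 0 := by
  intro h
  have hv0 : v ≠ 0 := by rintro rfl; simp at hv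
  obtain ⟨t, rfl⟩ := exists_smul_of_cross_eq_zero hv0 h
  rw [map_smul_eq_mul, hv, mul_one, Real.norm_eq_abs] at hw
  rcases eq_or_eq_neg_of_abs_eq hw with rfl | rfl
  · simp at h1
  · simp at h2

theorem Seminorm.continuous_prod (N : Seminorm ℝ (ℝ × ℝ)) : Continuous N := by
  have : ∀ x y : ℝ × ℝ, |N x - N y| ≤ (N (1, 0) + N (0, 1)) * ‖x - y‖ := by
    intro x y
    have h := abs_sub_map_le_sub N x y
    have e : x - y = (x - y).1 • ((1 : ℝ), (0 : ℝ)) + (x - y).2 • ((0 : ℝ), (1 : ℝ)) := by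
      ext <;> simp
    have h1 := N.map_lincomb_le (x - y).1 (x - y).2 (1, 0) (0, 1)
    rw [← e] at h1
    have h2 : |(x - y).1| ≤ ‖x - y‖ := norm_fst_le (x - y)
    have h3 : |(x - y).2| ≤ ‖x - y‖ := norm_snd_le (x - y)
    have := apply_nonneg N (1, 0)
    have := apply_nonneg N (0, 1)
    nlinarith
  refine (LipschitzWith.of_dist_le_mul (K := ⟨N (1, 0) + N (0, 1), by positivity⟩) ?_).continuous
  intro x y
  rw [Real.dist_eq, dist_eq_norm]
  exact this x y

section Lattice

variable {N : Seminorm ℝ (ℝ × ℝ)}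

theorem exists_min_ratio {z p : Fin 3 → ℝ} (hz : ∀ i, 0 ≤ z i) (hz1 : ∑ i, z i = 1)
    (hp1 : ∑ i, p i = 1) :
    ∃ τ : ℝ, 0 ≤ τ ∧ τ ≤ 1 ∧ (∃ i, z i = τ * p i) ∧ ∀ j, τ * p j ≤ z j := by
  have hne : (Finset.univ.filter fun i => 0 < p i).Nonempty := by
    by_contra h
    rw [Finset.not_nonempty_iff_eq_empty, Finset.filter_eq_empty_iff] at h
    have : ∑ i, p i ≤ 0 := Finset.sum_nonpos fun i hi => not_lt.1 (h hi)
    linarith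
  obtain ⟨i, hi, hmin⟩ := Finset.exists_min_image _ (fun i => z i / p i) hne
  have hi' : 0 < p i := (Finset.mem_filter.1 hi).2
  have hτ : 0 ≤ z i / p i := div_nonneg (hz i) hi'.le
  have hall : ∀ j, z i / p i * p j ≤ z j := by
    intro j
    by_cases hj : 0 < p j
    · have := hmin j (Finset.mem_filter.2 ⟨Finset.mem_univ _, hj⟩)
      exact (le_div_iff₀ hj).1 this
    · exact (mul_nonpos_of_nonneg_of_nonpos hτ (not_lt.1 hj)).trans (hz j)
  refine ⟨z i / p i, hτ, ?_, ⟨i, by field_simp⟩, hall⟩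
  have := Finset.sum_le_sum fun j (_ : j ∈ Finset.univ) => hall j
  rwa [← Finset.mul_sum, hp1, hz1, mul_one] at this

theorem dist_le_of_mem_triangle {p A B : ℝ × ℝ} {r τ α β : ℝ} (hr : 1 ≤ r) (hA : N (p - A) ≤ r)
    (hB : N (p - B) ≤ r) (hAB : N (A - B) = 2) (hτ : 0 ≤ τ) (hα : 0 ≤ α)
    (hβ : 0 ≤ β) (h1 : τ + α + β = 1) :
    N (τ • p + α • A + β • B - A) ≤ r ∨ N (τ • p + α • A + β • B - B) ≤ r := by
  rcases le_total β α with h | h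
  · left
    have e : τ • p + α • A + β • B - A = τ • (p - A) + (-β) • (A - B) := by
      rw [show α = 1 - τ - β by linarith]; module
    rw [e]
    refine (N.map_lincomb_le _ _ _ _).trans ?_
    rw [abs_of_nonneg hτ, abs_neg, abs_of_nonneg hβ, hAB]
    nlinarith
  · right
    have e : τ • p + α • A + β • B - B = τ • (p - B) + α • (A - B) := by
      rw [show β = 1 - τ - α by linarith]; module
    rw [e]
    refine (N.map_lincomb_le _ _ _ _).trans ?_
    rw [abs_of_nonneg hτ, abs_of_nonneg hα, hAB]
    nlinarith

theorem triangle_covered {v w q : ℝ × ℝ} {r : ℝ} (hv : N v = 1) (hw : N w = 1)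
    (hvw : N (w - v) = 1) (hc : cross v w ≠ 0) (h0 : N q ≤ r) (h1 : N (q - (2 : ℝ) • v) ≤ r)
    (h2 : N (q - (2 : ℝ) • w) ≤ r) {x y : ℝ} (hx : 0 ≤ x) (hy : 0 ≤ y) (hxy : x + y ≤ 1) :
    N (x • (2 : ℝ) • v + y • (2 : ℝ) • w) ≤ r ∨
    N (x • (2 : ℝ) • v + y • (2 : ℝ) • w - (2 : ℝ) • v) ≤ r ∨
    N (x • (2 : ℝ) • v + y • (2 : ℝ) • w - (2 : ℝ) • w) ≤ r := by
  have hr : 1 ≤ r := by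
    have := map_sub_le_add N q (q - (2 : ℝ) • v)
    rw [sub_sub_cancel, N.map_smul_of_nonneg' zero_le_two, hv] at this
    linarith
  have n1 : N (0 - (2 : ℝ) • v) = 2 := by
    rw [zero_sub, map_neg_eq_map, N.map_smul_of_nonneg' zero_le_two, hv, mul_one]
  have n2 : N (0 - (2 : ℝ) • w) = 2 := by
    rw [zero_sub, map_neg_eq_map, N.map_smul_of_nonneg' zero_le_two, hw, mul_one]
  have n3 : N ((2 : ℝ) • v - (2 : ℝ) • w) = 2 := by
    rw [← smul_sub, N.map_smul_of_nonneg' zero_le_two, map_sub_rev, hvw, mul_one]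
  obtain ⟨a, b, hq⟩ := exists_coords hc q
  obtain ⟨τ, hτ, hτ1, ⟨i, hi⟩, hall⟩ := exists_min_ratio (z := ![1 - x - y, x, y])
    (p := ![1 - a / 2 - b / 2, a / 2, b / 2])
    (by intro i; fin_cases i <;> simp <;> linarith)
    (by simp [Fin.sum_univ_three]; ring) (by simp [Fin.sum_univ_three]; ring)
  have t0 := hall 0
  have t1 := hall 1
  have t2 := hall 2
  simp at t0 t1 t2
  have h0' : N (q - 0) ≤ r := by rwa [sub_zero]
  fin_cases i <;> simp at hi
  · have := dist_le_of_mem_triangle hr h1 h2 n3 hτ (sub_nonneg.2 t1) (sub_nonneg.2 t2)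
      (by linarith)
    have e : τ • q + (x - τ * (a / 2)) • (2 : ℝ) • v + (y - τ * (b / 2)) • (2 : ℝ) • w
        = x • (2 : ℝ) • v + y • (2 : ℝ) • w := by rw [hq]; module
    rw [e] at this
    exact Or.inr this
  · have := dist_le_of_mem_triangle hr h0' h2 n2 hτ (sub_nonneg.2 t0) (sub_nonneg.2 t2)
      (by linarith)
    have e : τ • q + (1 - x - y - τ * (1 - a / 2 - b / 2)) • (0 : ℝ × ℝ)
        + (y - τ * (b / 2)) • (2 : ℝ) • w
        = x • (2 : ℝ) • v + y • (2 : ℝ) • w := by rw [hq, hi]; module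
    rw [e, sub_zero] at this
    exact this.imp id Or.inr
  · have := dist_le_of_mem_triangle hr h0' h1 n1 hτ (sub_nonneg.2 t0) (sub_nonneg.2 t1)
      (by linarith)
    have e : τ • q + (1 - x - y - τ * (1 - a / 2 - b / 2)) • (0 : ℝ × ℝ)
        + (x - τ * (a / 2)) • (2 : ℝ) • v
        = x • (2 : ℝ) • v + y • (2 : ℝ) • w := by rw [hq, hi]; module
    rw [e, sub_zero] at this
    exact this.imp id Or.inl

theorem plane_covered {v w q : ℝ × ℝ} {r : ℝ} (hv : N v = 1) (hw : N w = 1)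
    (hvw : N (w - v) = 1) (hc : cross v w ≠ 0) (h0 : N q ≤ r) (h1 : N (q - (2 : ℝ) • v) ≤ r)
    (h2 : N (q - (2 : ℝ) • w) ≤ r) (z : ℝ × ℝ) :
    ∃ m n : ℤ, N (z - ((m : ℝ) • (2 : ℝ) • v + (n : ℝ) • (2 : ℝ) • w)) ≤ r := by
  obtain ⟨a, b, hz⟩ := exists_coords hc z
  have hf1 := Int.fract_add_floor (a / 2)
  have hf2 := Int.fract_add_floor (b / 2)
  have p1 := Int.fract_nonneg (a / 2)
  have p2 := Int.fract_nonneg (b / 2)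
  have l1 := (Int.fract_lt_one (a / 2)).le
  have l2 := (Int.fract_lt_one (b / 2)).le
  set x := Int.fract (a / 2)
  set y := Int.fract (b / 2)
  set m := ⌊a / 2⌋
  set n := ⌊b / 2⌋
  have hz' : z = ((m : ℝ) + x) • (2 : ℝ) • v + ((n : ℝ) + y) • (2 : ℝ) • w := by
    rw [add_comm (m : ℝ), add_comm (n : ℝ), hf1, hf2, hz]; module
  rcases le_total (x + y) 1 with h | h
  · rcases triangle_covered hv hw hvw hc h0 h1 h2 p1 p2 h with k | k | k
    · refine ⟨m, n, le_of_eq_of_le (congrArg N ?_) k⟩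
      rw [hz']; module
    · refine ⟨m + 1, n, le_of_eq_of_le (congrArg N ?_) k⟩
      rw [hz']; push_cast; module
    · refine ⟨m, n + 1, le_of_eq_of_le (congrArg N ?_) k⟩
      rw [hz']; push_cast; module
  · rcases triangle_covered hv hw hvw hc h0 h1 h2 (sub_nonneg.2 l1) (sub_nonneg.2 l2)
      (by linarith) with k | k | k
    · refine ⟨m + 1, n + 1, le_of_eq_of_le ?_ k⟩
      rw [← map_neg_eq_map, hz']; push_cast; congr 1; module
    · refine ⟨m, n + 1, le_of_eq_of_le ?_ k⟩
      rw [← map_neg_eq_map, hz']; push_cast; congr 1; module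
    · refine ⟨m + 1, n, le_of_eq_of_le ?_ k⟩
      rw [← map_neg_eq_map, hz']; push_cast; congr 1; module

theorem one_le_lattice {v w : ℝ × ℝ} (hv : N v = 1) (hw : N w = 1)
    (hvw : N (w - v) = 1) {m n : ℤ} (h : m ≠ 0 ∨ n ≠ 0) :
    1 ≤ N ((m : ℝ) • v + (n : ℝ) • w) := by
  have key : ∀ (a b : ℝ × ℝ) (i j : ℝ), N a = 1 → N b = 1 → N (a - b) = 1 → 0 ≤ i → 0 ≤ j →
      i ≤ N (i • a + j • b) ∧ j ≤ N (i • a + j • b) := by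
    intro a b i j ha hb hab hi hj
    constructor
    · have e : (i + j) • a = (1 : ℝ) • (i • a + j • b) + j • (a - b) := by module
      have := N.map_lincomb_le 1 j (i • a + j • b) (a - b)
      rw [← e, N.map_smul_of_nonneg' (by linarith), ha, hab, abs_one, abs_of_nonneg hj] at this
      linarith
    · have e : (i + j) • b = (1 : ℝ) • (i • a + j • b) + (-i) • (a - b) := by module
      have := N.map_lincomb_le 1 (-i) (i • a + j • b) (a - b)
      rw [← e, N.map_smul_of_nonneg' (by linarith), hb, hab, abs_one, abs_neg,
        abs_of_nonneg hi] at this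
      linarith
  have hnv : N (-v) = 1 := by rwa [map_neg_eq_map]
  have cast1 : ∀ k : ℤ, 0 < k → (1 : ℝ) ≤ k := fun k hk => by exact_mod_cast hk
  have pos : ∀ m n : ℤ, 0 ≤ m → (m ≠ 0 ∨ n ≠ 0) → 1 ≤ N ((m : ℝ) • v + (n : ℝ) • w) := by
    intro m n hm h
    have hm' : (0 : ℝ) ≤ m := by exact_mod_cast hm
    rcases le_or_gt 0 n with hn | hn
    · have hn' : (0 : ℝ) ≤ n := by exact_mod_cast hn
      have k := key v w m n hv hw (by rwa [map_sub_rev]) hm' hn'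
      rcases h with h | h
      · exact (cast1 m (by omega)).trans k.1
      · exact (cast1 n (by omega)).trans k.2
    · have hn' : (n : ℝ) ≤ -1 := by exact_mod_cast (by omega : n ≤ -1)
      rcases le_total (m : ℝ) (-n) with hmn | hmn
      · have k := key w (w - v) (-n - m) m hw hvw (by rwa [sub_sub_cancel])
          (by linarith) hm'
        have e : (m : ℝ) • v + (n : ℝ) • w
            = -((-(n : ℝ) - m) • w + (m : ℝ) • (w - v)) := by module
        rw [e, map_neg_eq_map]
        rcases lt_or_ge m 1 with h1 | h1
        · have : m = 0 := by omega
          subst this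
          simp only [Int.cast_zero] at k ⊢
          linarith [k.1]
        · exact (cast1 m (by omega)).trans k.2
      · have k := key v (v - w) (m + n) (-n) hv (by rwa [map_sub_rev])
          (by rwa [sub_sub_cancel]) (by linarith) (by linarith)
        have e : (m : ℝ) • v + (n : ℝ) • w
            = ((m : ℝ) + n) • v + (-(n : ℝ)) • (v - w) := by module
        rw [e]
        linarith [k.2]
  rcases le_or_gt 0 m with hm | hm
  · exact pos m n hm h
  · have := pos (-m) (-n) (by omega) (by omega)
    rw [← map_neg_eq_map]
    convert this using 2
    push_cast
    module

end Lattice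

theorem exists_gauge {C : Set (ℝ × ℝ)} (hcpt : IsCompact C) (hconv : Convex ℝ C)
    (hint : (interior C).Nonempty) (hsymm : C = -C) :
    ∃ N : Seminorm ℝ (ℝ × ℝ), (∀ z, N z = 0 → z = 0) ∧ (∀ z, N z ≤ 1 ↔ z ∈ C) ∧
      ∀ z, z ∈ interior C → N z < 1 := by
  have hneg : ∀ ⦃x⦄, x ∈ C → -x ∈ C := fun x hx => by
    rw [hsymm] at hx; exact hx
  have h0 : C ∈ nhds (0 : ℝ × ℝ) := by
    obtain ⟨x, hx⟩ := hint
    rw [← mem_interior_iff_mem_nhds]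
    have h1 : -x ∈ interior C := by
      have : -interior C = interior C := by
        rw [← Set.image_neg_eq_neg, ← Homeomorph.coe_neg, Homeomorph.image_interior,
          Homeomorph.coe_neg, Set.image_neg_eq_neg, ← hsymm]
      rw [← this]; simpa using hx
    have := hconv.interior hx h1 (by norm_num : (0 : ℝ) ≤ 1 / 2) (by norm_num : (0 : ℝ) ≤ 1 / 2)
      (by norm_num)
    simpa using this
  have ha : Absorbent ℝ C := absorbent_nhds_zero h0
  have hb : Bornology.IsVonNBounded ℝ C := (NormedSpace.isVonNBounded_iff ℝ).2 hcpt.isBounded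
  refine ⟨gaugeSeminorm ((balanced_iff_neg_mem hconv).2 hneg) hconv ha, ?_, ?_, ?_⟩
  · exact fun z hz => (gauge_eq_zero ha hb).1 hz
  · intro z
    refine (gauge_le_one_iff_mem_closure hconv h0).trans ?_
    rw [hcpt.isClosed.closure_eq]
  · exact fun z hz => interior_subset_gauge_lt_one C hz

theorem exists_equilateral_frame {N : Seminorm ℝ (ℝ × ℝ)} {s : ℝ}
    (hs : 1 < s) (h : HasTriple N s) :
    ∃ (a v w : ℝ × ℝ) (d : ℝ), s ≤ d ∧ N v = 1 ∧ N w = 1 ∧ N (w - v) = 1 ∧ N a ≤ 1 ∧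
      N (a + d • v) ≤ 1 ∧ N (a + d • w) ≤ 1 := by
  have main : ∀ (a b x : ℝ × ℝ) (d : ℝ), s ≤ d → N a ≤ 1 → N b ≤ 1 → N x ≤ 1 → N (b - a) = d →
      N (x - a) = d → d ≤ N (x - b) → ∃ (a v w : ℝ × ℝ) (d : ℝ), s ≤ d ∧ N v = 1 ∧ N w = 1 ∧
      N (w - v) = 1 ∧ N a ≤ 1 ∧ N (a + d • v) ≤ 1 ∧ N (a + d • w) ≤ 1 := by
    intro a b x d hd ha hb hx hba hxa hxb
    have hd0 : 0 < d := by linarith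
    obtain ⟨v, hv⟩ : ∃ v, v = d⁻¹ • (b - a) := ⟨_, rfl⟩
    obtain ⟨u, hu⟩ : ∃ u, u = d⁻¹ • (x - a) := ⟨_, rfl⟩
    have hv1 : N v = 1 := by
      rw [hv, N.map_smul_of_nonneg' (by positivity), hba, inv_mul_cancel₀ hd0.ne']
    have hu1 : N u = 1 := by
      rw [hu, N.map_smul_of_nonneg' (by positivity), hxa, inv_mul_cancel₀ hd0.ne']
    have hb' : a + d • v = b := by
      rw [hv, smul_smul, mul_inv_cancel₀ hd0.ne', one_smul, add_sub_cancel]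
    have hx' : a + d • u = x := by
      rw [hu, smul_smul, mul_inv_cancel₀ hd0.ne', one_smul, add_sub_cancel]
    have huv : N (x - b) = d * N (u - v) := by
      rw [← hb', ← hx', ← N.map_smul_of_nonneg' hd0.le]; congr 1; module
    have huv1 : 1 ≤ N (u - v) := by
      rw [huv] at hxb
      exact le_of_mul_le_mul_left (by linarith) hd0
    have huv2 : N (u - v) < 2 := by
      have h1 : N (x - b) ≤ 2 := (map_sub_le_add N x b).trans (by linarith)
      rw [huv] at h1
      by_contra hcon
      push Not at hcon
      nlinarith
    have hsum : 0 < N (u + v) := by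
      have e : (2 : ℝ) • u = (1 : ℝ) • (u + v) + (1 : ℝ) • (u - v) := by module
      have := N.map_lincomb_le 1 1 (u + v) (u - v)
      rw [← e, N.map_smul_of_nonneg' zero_le_two, hu1, abs_one] at this
      linarith
    have hpos : ∀ t : ℝ, t ∈ Icc (0 : ℝ) 1 → 0 < N ((1 - t) • v + t • u) := by
      intro t ht
      rcases lt_trichotomy t (1 / 2) with h | h | h
      · have e : (1 - t) • v = (1 : ℝ) • ((1 - t) • v + t • u) + (-t) • u := by module
        have := N.map_lincomb_le 1 (-t) ((1 - t) • v + t • u) u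
        rw [← e, N.map_smul_of_nonneg' (by linarith [ht.2]), hv1, hu1, abs_one, abs_neg,
          abs_of_nonneg ht.1] at this
        linarith
      · have e : (1 - t) • v + t • u = (1 / 2 : ℝ) • (u + v) := by rw [h]; module
        rw [e, N.map_smul_of_nonneg' (by norm_num)]
        linarith
      · have e : t • u = (1 : ℝ) • ((1 - t) • v + t • u) + (-(1 - t)) • v := by module
        have := N.map_lincomb_le 1 (-(1 - t)) ((1 - t) • v + t • u) v
        rw [← e, N.map_smul_of_nonneg' ht.1, hv1, hu1, abs_one, abs_neg,
          abs_of_nonneg (by linarith [ht.2])] at this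
        linarith
    have hcont : ContinuousOn (fun t : ℝ =>
        N ((N ((1 - t) • v + t • u))⁻¹ • ((1 - t) • v + t • u) - v)) (Icc 0 1) := by
      have hcN := N.continuous_prod
      refine hcN.comp_continuousOn (ContinuousOn.sub (ContinuousOn.smul
        (ContinuousOn.inv₀ ?_ fun t ht => (hpos t ht).ne') ?_) continuousOn_const)
      · exact (hcN.comp (by fun_prop)).continuousOn
      · exact (by fun_prop : Continuous fun t : ℝ => (1 - t) • v + t • u).continuousOn
    obtain ⟨t, ht, hft⟩ := intermediate_value_Icc zero_le_one hcont
      (show (1 : ℝ) ∈ _ from ⟨by simp [hv1], by simpa [hu1] using huv1⟩)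
    simp only at hft
    have hn := hpos t ht
    set n := N ((1 - t) • v + t • u) with hn'
    obtain ⟨α, hα⟩ : ∃ α, α = n⁻¹ * (1 - t) := ⟨_, rfl⟩
    obtain ⟨β, hβ⟩ : ∃ β, β = n⁻¹ * t := ⟨_, rfl⟩
    have hα0 : 0 ≤ α := hα ▸ mul_nonneg (by positivity) (by linarith [ht.2])
    have hβ0 : 0 ≤ β := hβ ▸ mul_nonneg (by positivity) ht.1
    obtain ⟨w, hw⟩ : ∃ w, w = n⁻¹ • ((1 - t) • v + t • u) := ⟨_, rfl⟩
    rw [← hw] at hft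
    have hw1 : N w = 1 := by
      rw [hw, N.map_smul_of_nonneg' (by positivity), ← hn', inv_mul_cancel₀ hn.ne']
    have hwαβ : w = α • v + β • u := by
      rw [hw, hα, hβ, smul_add, smul_smul, smul_smul]
    refine ⟨a, v, w, d, hd, hv1, hw1, hft, ha, hb'.symm ▸ hb, ?_⟩
    have hc : cross v u ≠ 0 :=
      cross_ne_zero_of_unit hv1 hu1 (by linarith) hsum.ne'
    obtain ⟨l, m, hlm⟩ := exists_coords hc a
    have c1 : m < 0 → 0 ≤ α - β * l / m → N (a + d • w) ≤ 1 := by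
      intro hm h1
      have := N.map_add_smul_anti hv1 hw1 (a := a) (α := α - β * l / m) (β := β / (-m))
        h1 (div_nonneg hβ0 (by linarith)) hd0.le (by
          have := hm.ne
          rw [hwαβ, hlm]
          match_scalars <;> field_simp <;> ring)
      rw [hb'] at this
      exact this.trans hb
    have c2 : l < 0 → 0 ≤ β - α * m / l → N (a + d • w) ≤ 1 := by
      intro hl h1
      have := N.map_add_smul_anti hu1 hw1 (a := a) (α := β - α * m / l) (β := α / (-l))
        h1 (div_nonneg hα0 (by linarith)) hd0.le (by
          have := hl.ne
          rw [hwαβ, hlm]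
          match_scalars <;> field_simp <;> ring)
      rw [hx'] at this
      exact this.trans hx
    by_cases hm : m < 0
    · by_cases hl : l < 0
      · rcases le_total 0 (α * m - β * l) with h1 | h1
        · apply c2 hl
          have : β - α * m / l = (α * m - β * l) / (-l) := by
            have := hl.ne
            field_simp
            ring
          rw [this]
          exact div_nonneg h1 (by linarith)
        · apply c1 hm
          have : α - β * l / m = (-(α * m - β * l)) / (-m) := by
            have := hm.ne
            field_simp
          rw [this]
          exact div_nonneg (by linarith) (by linarith)
      · apply c1 hm
        have : β * l / m ≤ 0 := div_nonpos_of_nonneg_of_nonpos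
          (mul_nonneg hβ0 (not_lt.1 hl)) hm.le
        linarith
    · by_cases hl : l < 0
      · apply c2 hl
        have : α * m / l ≤ 0 := div_nonpos_of_nonneg_of_nonpos
          (mul_nonneg hα0 (not_lt.1 hm)) hl.le
        linarith
      · exfalso
        push Not at hm hl
        have k1 : (l + d) - m ≤ 1 := by
          have e : (l + d) • v = (1 : ℝ) • b + (-m) • u := by rw [← hb', hlm]; module
          have := N.map_lincomb_le 1 (-m) b u
          rw [← e, N.map_smul_of_nonneg' (by linarith), hv1, hu1, abs_one, abs_neg,
            abs_of_nonneg hm] at this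
          linarith
        have k2 : (m + d) - l ≤ 1 := by
          have e : (m + d) • u = (1 : ℝ) • x + (-l) • v := by rw [← hx', hlm]; module
          have := N.map_lincomb_le 1 (-l) x v
          rw [← e, N.map_smul_of_nonneg' (by linarith), hv1, hu1, abs_one, abs_neg,
            abs_of_nonneg hl] at this
          linarith
        linarith
  have short : ∀ a b c : ℝ × ℝ, N a ≤ 1 → N b ≤ 1 → N c ≤ 1 → s ≤ N (b - a) →
      N (b - a) ≤ N (c - a) → N (b - a) ≤ N (c - b) →
      ∃ (a v w : ℝ × ℝ) (d : ℝ), s ≤ d ∧ N v = 1 ∧ N w = 1 ∧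
      N (w - v) = 1 ∧ N a ≤ 1 ∧ N (a + d • v) ≤ 1 ∧ N (a + d • w) ≤ 1 := by
    intro a b c ha hb hc hab hac hbc
    obtain ⟨d, hd⟩ : ∃ d, d = N (b - a) := ⟨_, rfl⟩
    rw [← hd] at hab hac hbc
    have hd0 : 0 < d := by linarith
    obtain ⟨t, ht⟩ : ∃ t, t = d / N (c - a) := ⟨_, rfl⟩
    obtain ⟨u, hu⟩ : ∃ u, u = d / N (c - b) := ⟨_, rfl⟩
    have ht0 : 0 < t := ht ▸ div_pos hd0 (by linarith)
    have hu0 : 0 < u := hu ▸ div_pos hd0 (by linarith)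
    have ht1 : t ≤ 1 := ht ▸ div_le_one_of_le₀ hac (by linarith)
    have hu1 : u ≤ 1 := hu ▸ div_le_one_of_le₀ hbc (by linarith)
    obtain ⟨x, hx⟩ : ∃ x, x = (1 - t) • a + t • c := ⟨_, rfl⟩
    obtain ⟨y, hy⟩ : ∃ y, y = (1 - u) • b + u • c := ⟨_, rfl⟩
    have nx : N x ≤ 1 := by
      rw [hx]
      refine (N.map_lincomb_le _ _ _ _).trans ?_
      rw [abs_of_nonneg (by linarith), abs_of_nonneg ht0.le]
      nlinarith
    have ny : N y ≤ 1 := by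
      rw [hy]
      refine (N.map_lincomb_le _ _ _ _).trans ?_
      rw [abs_of_nonneg (by linarith), abs_of_nonneg hu0.le]
      nlinarith
    have dx : N (x - a) = d := by
      rw [hx, show (1 - t) • a + t • c - a = t • (c - a) by module, N.map_smul_of_nonneg' ht0.le,
        ht, div_mul_cancel₀ _ (by linarith)]
    have dy : N (y - b) = d := by
      rw [hy, show (1 - u) • b + u • c - b = u • (c - b) by module, N.map_smul_of_nonneg' hu0.le,
        hu, div_mul_cancel₀ _ (by linarith)]
    rcases le_or_gt d (N (x - b)) with h1 | h1
    · exact main a b x d hab ha hb nx hd.symm dx h1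
    rcases le_or_gt d (N (y - a)) with h2 | h2
    · exact main b a y d hab hb ha ny (by rw [map_sub_rev, hd]) dy h2
    exfalso
    obtain ⟨D, hD'⟩ : ∃ D, D = u + t - t * u := ⟨_, rfl⟩
    have hD : 0 < D := by nlinarith
    obtain ⟨l, hl⟩ : ∃ l, l = t / D := ⟨_, rfl⟩
    obtain ⟨m, hm⟩ : ∃ m, m = u / D := ⟨_, rfl⟩
    have hl0 : 0 ≤ l := hl ▸ by positivity
    have hm0 : 0 ≤ m := hm ▸ by positivity
    have hl1 : l ≤ 1 := by rw [hl, div_le_one hD]; nlinarith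
    have hm1 : m ≤ 1 := by rw [hm, div_le_one hD]; nlinarith
    have e1 : x - a = l • (y - a) + (1 - m) • (x - b) := by
      rw [hx, hy, hl, hm]
      match_scalars <;> field_simp <;> rw [hD'] <;> ring
    have e2 : y - b = (1 - l) • (y - a) + m • (x - b) := by
      rw [hx, hy, hl, hm]
      match_scalars <;> field_simp <;> rw [hD'] <;> ring
    have k1 := N.map_lincomb_le l (1 - m) (y - a) (x - b)
    have k2 := N.map_lincomb_le (1 - l) m (y - a) (x - b)
    rw [← e1, dx, abs_of_nonneg hl0, abs_of_nonneg (by linarith)] at k1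
    rw [← e2, dy, abs_of_nonneg hm0, abs_of_nonneg (by linarith)] at k2
    linarith
  obtain ⟨a, b, c, ha, hb, hc, hab, hbc, hac⟩ := h
  have r1 := map_sub_rev N a b
  have r2 := map_sub_rev N b c
  have r3 := map_sub_rev N a c
  rcases le_total (N (a - b)) (N (b - c)) with h1 | h1 <;>
  rcases le_total (N (b - c)) (N (a - c)) with h2 | h2 <;>
  rcases le_total (N (a - b)) (N (a - c)) with h3 | h3
  · exact short a b c ha hb hc (by linarith) (by linarith) (by linarith)
  · exact short a b c ha hb hc (by linarith) (by linarith) (by linarith)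
  · exact short a b c ha hb hc (by linarith) (by linarith) (by linarith)
  · exact short a c b ha hc hb (by linarith) (by linarith) (by linarith)
  · exact short b c a hb hc ha (by linarith) (by linarith) (by linarith)
  · exact short b c a hb hc ha (by linarith) (by linarith) (by linarith)
  · exact short a c b ha hc hb (by linarith) (by linarith) (by linarith)
  · exact short a c b ha hc hb (by linarith) (by linarith) (by linarith)

theorem gammaStar_le_of_hasTriple {C : Set (ℝ × ℝ)} {N : Seminorm ℝ (ℝ × ℝ)}
    (hC : ∀ z, N z ≤ 1 ↔ z ∈ C) (hi : ∀ z, z ∈ interior C → N z < 1)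
    {s : ℝ} (hs : 1 < s) (h : HasTriple N s) : gammaStar C ≤ 2 / s := by
  obtain ⟨a, v, w, d, hd, hv, hw, hvw, ha, hav, haw⟩ := exists_equilateral_frame hs h
  have hd0 : 0 < d := by linarith
  have hc : cross v w ≠ 0 := by
    refine cross_ne_zero_of_unit hv hw (by simp [hvw]) fun h0 => ?_
    have e : (2 : ℝ) • w = (1 : ℝ) • (w + v) + (1 : ℝ) • (w - v) := by module
    have := N.map_lincomb_le 1 1 (w + v) (w - v)
    rw [← e, N.map_smul_of_nonneg' zero_le_two, hw, hvw, h0, abs_one] at this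
    linarith
  have hli : LinearIndependent ℝ ![(2 : ℝ) • v, (2 : ℝ) • w] := by
    rw [LinearIndependent.pair_iff]
    intro x y hxy
    have e1 : cross v w * x = 0 := by
      have := congrArg (fun z => cross z w) hxy
      simp only [cross, Prod.fst_add, Prod.snd_add, Prod.smul_fst, Prod.smul_snd, smul_eq_mul,
        Prod.fst_zero, Prod.snd_zero] at this ⊢
      linarith
    have e2 : cross v w * y = 0 := by
      have := congrArg (fun z => cross v z) hxy
      simp only [cross, Prod.fst_add, Prod.snd_add, Prod.smul_fst, Prod.smul_snd, smul_eq_mul,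
        Prod.fst_zero, Prod.snd_zero] at this ⊢
      linarith
    exact ⟨(mul_eq_zero.1 e1).resolve_left hc, (mul_eq_zero.1 e2).resolve_left hc⟩
  have key : 2 / d ∈ {r : ℝ | 0 < r ∧ ∃ Λ : Set (ℝ × ℝ),
      IsLattice2 Λ ∧ IsPacking C Λ ∧ IsCovering (r • C) Λ} := by
    refine ⟨by positivity, _, ⟨(2 : ℝ) • v, (2 : ℝ) • w, hli, rfl⟩, ?_, ?_⟩
    · rintro _ ⟨m, n, rfl⟩ _ ⟨m', n', rfl⟩ hne
      rw [Set.disjoint_left]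
      intro p hp hp'
      have shift : ∀ x : ℝ × ℝ, p ∈ interior (C + {x}) → N (p - x) < 1 := by
        intro x hx
        apply hi
        rw [Set.add_singleton, ← Homeomorph.coe_addRight, ← Homeomorph.image_interior] at hx
        obtain ⟨y, hy, rfl⟩ := hx
        simpa using hy
      have h1 := shift _ hp
      have h2 := shift _ hp'
      have hmn : m - m' ≠ 0 ∨ n - n' ≠ 0 := by
        by_contra hcon
        push Not at hcon
        apply hne
        rw [sub_eq_zero.1 hcon.1, sub_eq_zero.1 hcon.2]
      have h3 := one_le_lattice hv hw hvw hmn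
      have h4 := map_sub_le_add N (p - ((m' : ℝ) • (2 : ℝ) • v + (n' : ℝ) • (2 : ℝ) • w))
        (p - ((m : ℝ) • (2 : ℝ) • v + (n : ℝ) • (2 : ℝ) • w))
      have e : p - ((m' : ℝ) • (2 : ℝ) • v + (n' : ℝ) • (2 : ℝ) • w)
          - (p - ((m : ℝ) • (2 : ℝ) • v + (n : ℝ) • (2 : ℝ) • w))
          = (2 : ℝ) • (((m - m' : ℤ) : ℝ) • v + ((n - n' : ℤ) : ℝ) • w) := by
        push_cast; module
      rw [e, N.map_smul_of_nonneg' zero_le_two] at h4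
      linarith
    · have hr : ∀ z, N z ≤ 1 → N (-(2 / d) • z) ≤ 2 / d := by
        intro z hz
        rw [neg_smul, map_neg_eq_map, N.map_smul_of_nonneg' (by positivity)]
        exact mul_le_of_le_one_right (by positivity) hz
      have cov := plane_covered hv hw hvw hc (hr a ha)
        (by
          convert hr _ hav using 2
          match_scalars <;> field_simp)
        (by
          convert hr _ haw using 2
          match_scalars <;> field_simp)
      rw [IsCovering, Set.eq_univ_iff_forall]
      intro z
      obtain ⟨m, n, hmn⟩ := cov z
      refine Set.mem_iUnion₂.2 ⟨_, ⟨m, n, rfl⟩, ?_⟩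
      refine ⟨z - ((m : ℝ) • (2 : ℝ) • v + (n : ℝ) • (2 : ℝ) • w), ?_, _,
        Set.mem_singleton _, sub_add_cancel _ _⟩
      rw [Set.mem_smul_set_iff_inv_smul_mem₀ (by positivity), ← hC,
        N.map_smul_of_nonneg' (by positivity), inv_mul_le_one₀ (by positivity)]
      exact hmn
  refine (csInf_le ⟨0, fun r hr => hr.1.le⟩ key).trans ?_
  exact div_le_div_of_nonneg_left zero_le_two (by linarith) hd

/-- The Euclidean unit vector of angle `θ`. -/
def dir (θ : ℝ) : ℝ × ℝ := (Real.cos θ, Real.sin θ)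

/-- The vector of `N`-length one in direction `θ`. -/
def unitVec (N : Seminorm ℝ (ℝ × ℝ)) (θ : ℝ) : ℝ × ℝ := (N (dir θ))⁻¹ • dir θ

theorem dir_continuous : Continuous dir := by unfold dir; fun_prop

theorem dir_add_pi (θ : ℝ) : dir (θ + Real.pi) = -dir θ := by
  simp [dir, Real.cos_add_pi, Real.sin_add_pi]

theorem cross_dir (θ φ : ℝ) : cross (dir θ) (dir φ) = Real.sin (φ - θ) := by
  simp [dir, cross, Real.sin_sub]; ring

theorem dir_ne_zero (θ : ℝ) : dir θ ≠ 0 := by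
  intro h
  have h1 := congrArg Prod.fst h
  have h2 := congrArg Prod.snd h
  simp only [dir, Prod.fst_zero, Prod.snd_zero] at h1 h2
  have := Real.sin_sq_add_cos_sq θ
  rw [h1, h2] at this
  norm_num at this

theorem sin_smul_dir (η ψ ψ' : ℝ) : Real.sin (ψ - η) • dir ψ' =
    Real.sin (ψ' - η) • dir ψ - Real.sin (ψ' - ψ) • dir η := by
  have := cross_smul_eq (dir η) (dir ψ) (dir ψ')
  simp only [cross_dir] at this
  rw [this, show ψ - ψ' = -(ψ' - ψ) by ring, Real.sin_neg]
  module

section UnitVec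

variable {N : Seminorm ℝ (ℝ × ℝ)} (hN : ∀ z, N z = 0 → z = 0)

include hN

theorem norm_dir_pos (θ : ℝ) : 0 < N (dir θ) :=
  lt_of_le_of_ne (apply_nonneg N _) fun h => dir_ne_zero θ (hN _ h.symm)

theorem norm_unitVec (θ : ℝ) : N (unitVec N θ) = 1 := by
  have := norm_dir_pos hN θ
  rw [unitVec, N.map_smul_of_nonneg' (by positivity), inv_mul_cancel₀ this.ne']

theorem unitVec_continuous : Continuous (unitVec N) := by
  unfold unitVec
  have h : Continuous fun θ => N (dir θ) := N.continuous_prod.comp dir_continuous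
  exact (h.inv₀ fun θ => (norm_dir_pos hN θ).ne').smul dir_continuous

omit hN in
theorem unitVec_add_pi (θ : ℝ) : unitVec N (θ + Real.pi) = -unitVec N θ := by
  simp [unitVec, dir_add_pi, map_neg_eq_map]

theorem dir_eq_smul_unitVec (θ : ℝ) : dir θ = N (dir θ) • unitVec N θ := by
  rw [unitVec, smul_smul, mul_inv_cancel₀ (norm_dir_pos hN θ).ne', one_smul]

omit hN in
theorem cross_unitVec (θ φ : ℝ) : cross (unitVec N θ) (unitVec N φ) =
    (N (dir θ))⁻¹ * (N (dir φ))⁻¹ * Real.sin (φ - θ) := by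
  rw [← cross_dir]; simp [unitVec, cross]; ring

theorem cross_unitVec_nonneg {θ φ : ℝ} (h : θ ≤ φ) (h' : φ ≤ θ + Real.pi) :
    0 ≤ cross (unitVec N θ) (unitVec N φ) := by
  have h1 := norm_dir_pos hN θ
  have h2 := norm_dir_pos hN φ
  have := Real.sin_nonneg_of_nonneg_of_le_pi (sub_nonneg.2 h) (by linarith)
  rw [cross_unitVec]
  positivity

theorem cross_unitVec_pos {θ φ : ℝ} (h : θ < φ) (h' : φ < θ + Real.pi) :
    0 < cross (unitVec N θ) (unitVec N φ) := by
  have h1 := norm_dir_pos hN θ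
  have h2 := norm_dir_pos hN φ
  have := Real.sin_pos_of_pos_of_lt_pi (sub_pos.2 h) (by linarith)
  rw [cross_unitVec]
  positivity

omit hN in
theorem exists_unitVec_eq {z : ℝ × ℝ} (hz : N z = 1) :
    ∃ θ, z = unitVec N θ := by
  have hz0 : z ≠ 0 := by rintro rfl; simp at hz
  let ζ : ℂ := ⟨z.1, z.2⟩
  have hζ : ζ ≠ 0 := fun h => hz0 (Prod.ext (congrArg Complex.re h) (congrArg Complex.im h))
  have hpos : 0 < ‖ζ‖ := norm_pos_iff.2 hζ
  have hd : z = ‖ζ‖ • dir ζ.arg := by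
    ext
    · simp [dir, Complex.norm_mul_cos_arg, ζ]
    · simp [dir, Complex.norm_mul_sin_arg, ζ]
  refine ⟨ζ.arg, ?_⟩
  have h1 : ‖ζ‖ * N (dir ζ.arg) = 1 := by
    rw [← N.map_smul_of_nonneg' hpos.le, ← hd, hz]
  rw [unitVec, ← eq_inv_of_mul_eq_one_left h1]
  exact hd

theorem norm_add_anti_aux {η ψ ψ' a b : ℝ} (ha : 0 ≤ a) (hb : 0 ≤ b)
    (hk : Real.sin (ψ - η) ≠ 0) (hl : 0 ≤ Real.sin (ψ' - η) / Real.sin (ψ - η))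
    (hm : 0 ≤ Real.sin (ψ' - ψ) / Real.sin (ψ - η)) :
    N (a • unitVec N η + b • unitVec N ψ') ≤ N (a • unitVec N η + b • unitVec N ψ) := by
  rcases ha.eq_or_lt with rfl | ha
  · simp only [zero_smul, zero_add, N.map_smul_of_nonneg' hb, norm_unitVec hN]; exact le_rfl
  have h1 := norm_dir_pos hN η
  have h2 := norm_dir_pos hN ψ
  have h3 := norm_dir_pos hN ψ'
  refine N.map_add_smul_anti (norm_unitVec hN ψ) (norm_unitVec hN ψ')
    (α := Real.sin (ψ' - η) / Real.sin (ψ - η) * (N (dir ψ) / N (dir ψ')))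
    (β := Real.sin (ψ' - ψ) / Real.sin (ψ - η) * (N (dir η) / N (dir ψ') / a))
    (mul_nonneg hl (by positivity)) (mul_nonneg hm (by positivity)) hb ?_
  have e := sin_smul_dir η ψ ψ'
  have e' : dir ψ' = (Real.sin (ψ' - η) / Real.sin (ψ - η)) • dir ψ
      - (Real.sin (ψ' - ψ) / Real.sin (ψ - η)) • dir η := by
    have := congrArg (fun z => (Real.sin (ψ - η))⁻¹ • z) e
    simp only [smul_sub, smul_smul, inv_mul_cancel₀ hk, one_smul] at this
    rw [this, div_eq_inv_mul, div_eq_inv_mul]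
  have e'' : unitVec N ψ' = (N (dir ψ'))⁻¹ •
      ((Real.sin (ψ' - η) / Real.sin (ψ - η)) • (N (dir ψ) • unitVec N ψ)
      - (Real.sin (ψ' - ψ) / Real.sin (ψ - η)) • (N (dir η) • unitVec N η)) := by
    rw [← dir_eq_smul_unitVec hN, ← dir_eq_smul_unitVec hN, ← e']
    rfl
  rw [e'']
  match_scalars <;> field_simp

theorem norm_add_mono {θ θ' φ φ' a b : ℝ} (ha : 0 ≤ a) (hb : 0 ≤ b) (h1 : θ ≤ θ')
    (h2 : θ' ≤ φ') (h3 : φ' ≤ φ) (h4 : φ ≤ θ + Real.pi) :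
    N (a • unitVec N θ + b • unitVec N φ) ≤ N (a • unitVec N θ' + b • unitVec N φ') := by
  have hpi := Real.pi_pos
  have top : ∀ ψ, ∀ a b : ℝ, 0 ≤ a → 0 ≤ b → ∀ η,
      N (a • unitVec N η + b • unitVec N ψ) ≤ N (a • unitVec N η + b • unitVec N η) := by
    intro ψ a b ha hb η
    rw [← add_smul, N.map_smul_of_nonneg' (by linarith), norm_unitVec hN]
    refine (N.map_lincomb_le _ _ _ _).trans ?_
    rw [abs_of_nonneg ha, abs_of_nonneg hb, norm_unitVec hN, norm_unitVec hN]
    linarith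
  have s1 : N (a • unitVec N θ + b • unitVec N φ) ≤ N (a • unitVec N θ + b • unitVec N φ') := by
    rcases (h1.trans h2).eq_or_lt with h | h
    · rw [← h]; exact top _ _ _ ha hb _
    rcases h3.eq_or_lt with h' | h'
    · rw [h']
    have k : 0 < Real.sin (φ' - θ) := Real.sin_pos_of_pos_of_lt_pi (by linarith) (by linarith)
    have l : 0 ≤ Real.sin (φ - θ) := Real.sin_nonneg_of_nonneg_of_le_pi (by linarith) (by linarith)
    have m : 0 ≤ Real.sin (φ - φ') :=
      Real.sin_nonneg_of_nonneg_of_le_pi (by linarith) (by linarith)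
    exact norm_add_anti_aux hN ha hb k.ne' (div_nonneg l k.le) (div_nonneg m k.le)
  have s2 : N (a • unitVec N θ + b • unitVec N φ') ≤ N (a • unitVec N θ' + b • unitVec N φ') := by
    rw [add_comm, add_comm (a • _)]
    rcases h2.eq_or_lt with h | h
    · rw [h]; exact top _ _ _ hb ha _
    rcases h1.eq_or_lt with h' | h'
    · rw [h']
    have k : Real.sin (θ' - φ') < 0 := by
      have := Real.sin_pos_of_pos_of_lt_pi (x := φ' - θ') (by linarith) (by linarith)
      rw [← neg_sub, Real.sin_neg]; linarith
    have l : Real.sin (θ - φ') ≤ 0 := by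
      have := Real.sin_nonneg_of_nonneg_of_le_pi (x := φ' - θ) (by linarith) (by linarith)
      rw [← neg_sub, Real.sin_neg]; linarith
    have m : Real.sin (θ - θ') ≤ 0 := by
      have := Real.sin_nonneg_of_nonneg_of_le_pi (x := θ' - θ) (by linarith) (by linarith)
      rw [← neg_sub, Real.sin_neg]; linarith
    exact norm_add_anti_aux hN hb ha k.ne (div_nonneg_of_nonpos l k.le)
      (div_nonneg_of_nonpos m k.le)
  exact s1.trans s2

theorem norm_sub_mono {θ θ' φ φ' a b : ℝ} (ha : 0 ≤ a) (hb : 0 ≤ b) (h1 : θ ≤ θ')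
    (h2 : θ' ≤ φ') (h3 : φ' ≤ φ) (h4 : φ ≤ θ + Real.pi) :
    N (a • unitVec N θ' - b • unitVec N φ') ≤ N (a • unitVec N θ - b • unitVec N φ) := by
  have := norm_add_mono hN (θ := φ') (θ' := φ) (φ' := θ + Real.pi) (φ := θ' + Real.pi)
    hb ha h3 h4 (by linarith) (by linarith)
  rw [unitVec_add_pi, unitVec_add_pi] at this
  rw [← map_neg_eq_map N (_ - _), ← map_neg_eq_map N (a • unitVec N θ - _)]
  convert this using 2 <;> module

end UnitVec

/-- The lowest zero set of a function that decreases as the interval `[θ, φ]` widens is a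
curve. -/
theorem exists_zero_path {f : ℝ → ℝ → ℝ} (hf : Continuous (Function.uncurry f))
    (mono : ∀ θ θ' φ φ', θ ≤ θ' → θ' ≤ φ' → φ' ≤ φ → φ ≤ θ + Real.pi → f θ φ ≤ f θ' φ')
    (h0 : ∀ θ, 0 < f θ θ) (hpi : ∀ θ, f θ (θ + Real.pi) < 0)
    (hper : ∀ θ φ, f (θ + Real.pi) (φ + Real.pi) = f θ φ) :
    ∃ Θ Φ : ℝ → ℝ, Continuous Θ ∧ Continuous Φ ∧ Monotone Θ ∧ Monotone Φ ∧
      (∀ σ, Θ σ < Φ σ) ∧ (∀ σ, Φ σ < Θ σ + Real.pi) ∧ (∀ σ, f (Θ σ) (Φ σ) = 0) ∧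
      (∀ σ, Θ (σ + 2 * Real.pi) = Θ σ + Real.pi) ∧ (∀ σ, Φ (σ + 2 * Real.pi) = Φ σ + Real.pi) ∧
      ∀ θ φ, θ ≤ φ → φ ≤ θ + Real.pi → f θ φ = 0 → Θ (θ + φ) ≤ θ ∧ φ ≤ Φ (θ + φ) := by
  have pp := Real.pi_pos
  let S : ℝ → Set ℝ := fun σ => {t | t ∈ Icc 0 Real.pi ∧ 0 ≤ f ((σ - t) / 2) ((σ + t) / 2)}
  have hcont : ∀ σ, Continuous fun t => f ((σ - t) / 2) ((σ + t) / 2) := fun σ =>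
    hf.comp (by fun_prop : Continuous fun t : ℝ => ((σ - t) / 2, (σ + t) / 2))
  have hg : ∀ σ, ∃ t, IsGreatest (S σ) t := by
    intro σ
    have hS : IsCompact (S σ) :=
      isCompact_Icc.inter_right (isClosed_le continuous_const (hcont σ))
    exact hS.exists_isGreatest ⟨0, ⟨le_rfl, pp.le⟩, by simpa using (h0 (σ / 2)).le⟩
  choose g hg using hg
  have hlip : ∀ σ σ', g σ - |σ' - σ| ≤ g σ' := by
    intro σ σ'
    rcases le_or_gt 0 (g σ - |σ' - σ|) with h | h
    · apply (hg σ').2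
      have h1 := (hg σ).1.1
      have a1 := le_abs_self (σ' - σ)
      have a2 := neg_abs_le (σ' - σ)
      have a3 := abs_nonneg (σ' - σ)
      refine ⟨⟨h, by linarith [h1.2]⟩, (hg σ).1.2.trans (mono _ _ _ _ ?_ ?_ ?_ ?_)⟩ <;>
        linarith [h1.1, h1.2]
    · exact h.le.trans (hg σ').1.1.1
  have hlip' : ∀ σ σ', |g σ' - g σ| ≤ |σ' - σ| := by
    intro σ σ'
    have := hlip σ σ'
    have := hlip σ' σ
    rw [abs_sub_comm σ σ'] at this
    exact abs_le.2 ⟨by linarith, by linarith⟩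
  have hgc : Continuous g := by
    refine (LipschitzWith.of_dist_le_mul (K := 1) ?_).continuous
    intro x y
    simpa [Real.dist_eq] using hlip' y x
  have hzero : ∀ σ, f ((σ - g σ) / 2) ((σ + g σ) / 2) = 0 := by
    intro σ
    have hmem := (hg σ).1
    have hend : f ((σ - Real.pi) / 2) ((σ + Real.pi) / 2) < 0 := by
      have := hpi ((σ - Real.pi) / 2)
      rwa [show (σ - Real.pi) / 2 + Real.pi = (σ + Real.pi) / 2 by ring] at this
    obtain ⟨t, ht, ht0⟩ := intermediate_value_Icc' hmem.1.2 (hcont σ).continuousOn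
      (show (0 : ℝ) ∈ _ from ⟨hend.le, hmem.2⟩)
    have : t ≤ g σ := (hg σ).2 ⟨⟨hmem.1.1.trans ht.1, ht.2⟩, ht0.ge⟩
    rw [le_antisymm ht.1 this]
    exact ht0
  have hg0 : ∀ σ, 0 < g σ := by
    intro σ
    refine lt_of_le_of_ne (hg σ).1.1.1 fun h => ?_
    have := hzero σ
    rw [← h, sub_zero, add_zero] at this
    exact (h0 _).ne' this
  have hgpi : ∀ σ, g σ < Real.pi := by
    intro σ
    refine lt_of_le_of_ne (hg σ).1.1.2 fun h => ?_
    have := hzero σ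
    have h' := hpi ((σ - Real.pi) / 2)
    rw [show (σ - Real.pi) / 2 + Real.pi = (σ + Real.pi) / 2 by ring] at h'
    rw [h] at this
    exact h'.ne this
  have hgper : ∀ σ, g (σ + 2 * Real.pi) = g σ := by
    intro σ
    have hS : S (σ + 2 * Real.pi) = S σ := by
      ext t
      have := hper ((σ - t) / 2) ((σ + t) / 2)
      simp only [S, Set.mem_ofPred_eq]
      rw [← this, show (σ + 2 * Real.pi - t) / 2 = (σ - t) / 2 + Real.pi by ring,
        show (σ + 2 * Real.pi + t) / 2 = (σ + t) / 2 + Real.pi by ring]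
    have := hg (σ + 2 * Real.pi)
    rw [hS] at this
    exact this.unique (hg σ)
  refine ⟨fun σ => (σ - g σ) / 2, fun σ => (σ + g σ) / 2, by fun_prop, by fun_prop,
    ?_, ?_, ?_, ?_, hzero, ?_, ?_, ?_⟩
  · intro x y hxy
    have := (abs_le.1 (hlip' x y)).2
    rw [abs_of_nonneg (sub_nonneg.2 hxy)] at this
    dsimp only
    linarith
  · intro x y hxy
    have := (abs_le.1 (hlip' x y)).1
    rw [abs_of_nonneg (sub_nonneg.2 hxy)] at this
    dsimp only
    linarith
  · intro σ
    linarith [hg0 σ]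
  · intro σ
    linarith [hgpi σ]
  · intro σ
    dsimp only
    rw [hgper]; ring
  · intro σ
    dsimp only
    rw [hgper]; ring
  · intro θ φ h1 h2 h3
    have : φ - θ ≤ g (θ + φ) := by
      refine (hg (θ + φ)).2 ⟨⟨by linarith, by linarith⟩, ?_⟩
      rw [show (θ + φ - (φ - θ)) / 2 = θ by ring, show (θ + φ + (φ - θ)) / 2 = φ by ring, h3]
    constructor <;> linarith

section Area

variable {N : Seminorm ℝ (ℝ × ℝ)} (hN : ∀ z, N z = 0 → z = 0)

include hN

theorem cross_rotate_nonneg {θ θ' φ φ' α β : ℝ} (hβ : 0 < β) (hβα : β ≤ α)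
    (hαβ : α ^ 2 + β ^ 2 = 1) (h1 : θ ≤ θ') (h2 : θ' ≤ φ) (h3 : φ ≤ φ')
    (h4 : φ' ≤ θ + Real.pi)
    (hP : N (α • unitVec N θ' + β • unitVec N φ') ≤ 1)
    (hQ : N ((-β) • unitVec N θ' + α • unitVec N φ') ≤ 1) :
    0 ≤ cross (α • unitVec N θ + β • unitVec N φ) (α • unitVec N θ' + β • unitVec N φ') ∧
    0 ≤ cross ((-β) • unitVec N θ + α • unitVec N φ)
      ((-β) • unitVec N θ' + α • unitVec N φ') := by
  have nu := norm_unitVec hN θ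
  have nu' := norm_unitVec hN θ'
  have nw := norm_unitVec hN φ
  have nw' := norm_unitVec hN φ'
  have c1 := cross_unitVec_nonneg hN h1 (by linarith)
  have c2 := cross_unitVec_nonneg hN h3 (by linarith)
  have c3 := cross_unitVec_nonneg hN (h1.trans (h2.trans h3)) h4
  have c4 := cross_unitVec_nonneg hN (h2.trans h3) (by linarith)
  have c5 := cross_unitVec_nonneg hN h2 (by linarith)
  set u := unitVec N θ
  set u' := unitVec N θ'
  set w := unitVec N φ
  set w' := unitVec N φ'
  have hα : 0 < α := by linarith
  have hα1 : α ≤ 1 := by nlinarith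
  have k1 : cross u' w' ≤ cross u w' + cross u u' := by
    have e : cross u' w' • u = cross u w' • u' + (-cross u u') • w' := by
      ext <;> simp [cross] <;> ring
    have := N.map_lincomb_le (cross u w') (-cross u u') u' w'
    rw [← e, N.map_smul_of_nonneg' c4, nu, nu', nw', abs_neg, abs_of_nonneg c3,
      abs_of_nonneg c1] at this
    linarith
  have k4 : cross u' w' ≤ cross w w' + cross u' w := by
    have e : cross u' w' • w = cross w w' • u' + cross u' w • w' := by
      ext <;> simp [cross] <;> ring
    have := N.map_lincomb_le (cross w w') (cross u' w) u' w'
    rw [← e, N.map_smul_of_nonneg' c4, nw, nu', nw', abs_of_nonneg c2,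
      abs_of_nonneg c5] at this
    linarith
  have k2 : β * cross u' w + α * cross w w' - β * cross u' w' ≤ cross w w' := by
    have e : (β * cross u' w + α * cross w w') • w' = cross w w' • ((-β) • u' + α • w')
        + (β * cross u' w') • w := by
      ext <;> simp [cross] <;> ring
    have := N.map_lincomb_le (cross w w') (β * cross u' w') ((-β) • u' + α • w') w
    rw [← e, N.map_smul_of_nonneg' (by positivity), nw, nw', abs_of_nonneg c2,
      abs_of_nonneg (by positivity)] at this
    nlinarith
  have k3 : α * cross u u' + β * cross u w' - β * cross u' w' ≤ cross u u' := by
    have e : (α * cross u u' + β * cross u w') • u' = cross u u' • (α • u' + β • w')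
        + (β * cross u' w') • u := by
      ext <;> simp [cross] <;> ring
    have := N.map_lincomb_le (cross u u') (β * cross u' w') (α • u' + β • w') u
    rw [← e, N.map_smul_of_nonneg' (by positivity), nu, nu', abs_of_nonneg c1,
      abs_of_nonneg (by positivity)] at this
    nlinarith
  have eP : cross (α • u + β • w) (α • u' + β • w') = α ^ 2 * cross u u' + β ^ 2 * cross w w'
      + α * β * (cross u w' - cross u' w) := by simp [cross]; ring
  have eQ : cross ((-β) • u + α • w) ((-β) • u' + α • w') = β ^ 2 * cross u u'
      + α ^ 2 * cross w w' - α * β * (cross u w' - cross u' w) := by simp [cross]; ring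
  rw [eP, eQ]
  generalize cross u u' = a at *
  generalize cross w w' = b at *
  generalize cross u w' = x at *
  generalize cross u' w = y at *
  generalize cross u' w' = z at *
  have m1 := mul_le_mul_of_nonneg_left k1 (mul_pos hα hβ).le
  have m4 := mul_le_mul_of_nonneg_left k4 (mul_pos hα hβ).le
  have m2 := mul_le_mul_of_nonneg_left k2 hα.le
  have m3 := mul_le_mul_of_nonneg_left k3 hα.le
  have p1 : 0 ≤ α * (α - β) * a := mul_nonneg (mul_nonneg hα.le (by linarith)) c1
  have p2 : 0 ≤ α * (α - β) * b := mul_nonneg (mul_nonneg hα.le (by linarith)) c2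
  have p3 : 0 ≤ (1 - α) * a := mul_nonneg (by linarith) c1
  have p4 : 0 ≤ (1 - α) * b := mul_nonneg (by linarith) c2
  have q : β ^ 2 = 1 - α ^ 2 := by linarith
  constructor
  · rw [q]; nlinarith
  · rw [q]; nlinarith

/-- Radial function of the unit ball. -/
def radial (N : Seminorm ℝ (ℝ × ℝ)) (θ : ℝ) : ℝ := (N (dir θ))⁻¹

theorem radial_continuous : Continuous (radial N) :=
  (N.continuous_prod.comp dir_continuous).inv₀ fun θ => (norm_dir_pos hN θ).ne'

theorem radial_pos (θ : ℝ) : 0 < radial N θ := inv_pos.2 (norm_dir_pos hN θ)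

omit hN in
theorem radial_add_pi (θ : ℝ) : radial N (θ + Real.pi) = radial N θ := by
  simp [radial, dir_add_pi, map_neg_eq_map]

/-- Twice the area swept by the radius of the unit ball. -/
def sweep (N : Seminorm ℝ (ℝ × ℝ)) (θ : ℝ) : ℝ := ∫ t in (0 : ℝ)..θ, radial N t ^ 2

theorem sweep_sub (x y : ℝ) : sweep N y - sweep N x = ∫ t in x..y, radial N t ^ 2 := by
  have h : ∀ a b, IntervalIntegrable (fun t => radial N t ^ 2) MeasureTheory.volume a b :=
    fun a b => ((radial_continuous hN).pow 2).intervalIntegrable a b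
  rw [sweep, sweep, intervalIntegral.integral_interval_sub_left (h _ _) (h _ _)]

theorem sweep_add_pi (x : ℝ) : sweep N (x + Real.pi) - sweep N x = sweep N Real.pi := by
  have hp : Function.Periodic (fun t => radial N t ^ 2) Real.pi := fun t => by
    simp only [radial_add_pi]
  rw [sweep_sub hN, hp.intervalIntegral_add_eq x 0, zero_add, sweep]

theorem sweep_pi_pos : 0 < sweep N Real.pi :=
  intervalIntegral.intervalIntegral_pos_of_pos
    (((radial_continuous hN).pow 2).intervalIntegrable _ _)
    (fun x => pow_pos (radial_pos hN x) 2) Real.pi_pos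

theorem sector_estimate (K : ℝ) {η : ℝ} (hη : 0 < η) : ∃ δ > 0, ∀ t t' : ℝ, -K ≤ t → t ≤ K →
    t ≤ t' → t' < t + δ → |cross (unitVec N t) (unitVec N t') - (sweep N t' - sweep N t)|
      ≤ η * (t' - t) := by
  have hr := radial_continuous hN
  have hF : Continuous fun p : ℝ × ℝ => radial N p.1 * radial N (p.1 + p.2) * Real.sinc p.2 := by
    have := Real.continuous_sinc
    fun_prop
  have hG : Continuous fun p : ℝ × ℝ => radial N (p.1 + p.2) ^ 2 := by fun_prop
  have hK : IsCompact (Icc (-K) K ×ˢ Icc (0 : ℝ) 1) := isCompact_Icc.prod isCompact_Icc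
  obtain ⟨δ₁, hδ₁, h1⟩ := Metric.uniformContinuousOn_iff.1
    (hK.uniformContinuousOn_of_continuous hF.continuousOn) (η / 2) (by linarith)
  obtain ⟨δ₂, hδ₂, h2⟩ := Metric.uniformContinuousOn_iff.1
    (hK.uniformContinuousOn_of_continuous hG.continuousOn) (η / 2) (by linarith)
  refine ⟨min 1 (min δ₁ δ₂), by positivity, ?_⟩
  intro t t' ht1 ht2 htt' hlt
  obtain ⟨m1, m2⟩ := lt_min_iff.1 (show t' - t < min 1 (min δ₁ δ₂) by linarith)
  obtain ⟨m2, m3⟩ := lt_min_iff.1 m2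
  have hx0 : 0 ≤ t' - t := by linarith
  have a1 := h1 (t, t' - t) ⟨⟨ht1, ht2⟩, ⟨hx0, m1.le⟩⟩ (t, 0) ⟨⟨ht1, ht2⟩, ⟨le_rfl, zero_le_one⟩⟩
    (by simp [Prod.dist_eq, abs_of_nonneg hx0]; exact ⟨hδ₁, m2⟩)
  have a2 : ∀ x ∈ Set.uIoc t t', ‖radial N x ^ 2 - radial N t ^ 2‖ ≤ η / 2 := by
    intro x hx
    rw [Set.uIoc_of_le htt'] at hx
    have hx1 : 0 ≤ x - t := by linarith [hx.1]
    have := h2 (t, x - t) ⟨⟨ht1, ht2⟩, ⟨hx1, by linarith [hx.2]⟩⟩ (t, 0)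
      ⟨⟨ht1, ht2⟩, ⟨le_rfl, zero_le_one⟩⟩
      (by
        simp [Prod.dist_eq, abs_of_nonneg hx1]
        exact ⟨hδ₂, by linarith [hx.2]⟩)
    rw [Real.dist_eq] at this
    simpa using this.le
  have a3 := intervalIntegral.norm_integral_le_of_norm_le_const a2
  rw [intervalIntegral.integral_sub ((show Continuous fun x => radial N x ^ 2 from hr.pow 2).intervalIntegrable _ _)
    (continuous_const.intervalIntegrable _ _), intervalIntegral.integral_const,
    ← sweep_sub hN, Real.norm_eq_abs, abs_of_nonneg hx0, smul_eq_mul] at a3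
  have a4 : |cross (unitVec N t) (unitVec N t') - radial N t ^ 2 * (t' - t)|
      ≤ η / 2 * (t' - t) := by
    have e : cross (unitVec N t) (unitVec N t')
        = radial N t * radial N t' * Real.sinc (t' - t) * (t' - t) := by
      rw [cross_unitVec]
      rcases hx0.eq_or_lt with h | h
      · rw [← h]; simp
      · rw [Real.sinc_of_ne_zero h.ne', radial, radial]
        field_simp
    rw [e, ← sub_mul, abs_mul, abs_of_nonneg hx0]
    refine mul_le_mul_of_nonneg_right ?_ hx0
    rw [Real.dist_eq] at a1
    simp only [add_sub_cancel, add_zero, Real.sinc_zero, mul_one] at a1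
    rw [sq]
    exact a1.le
  rw [abs_le] at a3 a4 ⊢
  constructor <;> linarith [a3.1, a3.2, a4.1, a4.2]

theorem exists_angle {Θ Φ : ℝ → ℝ} (hΘ : Continuous Θ) (hΦ : Continuous Φ)
    (h1 : ∀ σ, Θ σ < Φ σ) (h2 : ∀ σ, Φ σ < Θ σ + Real.pi) (c₁ : ℝ) {c₂ : ℝ} (hc : 0 < c₂) :
    ∃ ψ : ℝ → ℝ, Continuous ψ ∧ (∀ σ, c₁ • unitVec N (Θ σ) + c₂ • unitVec N (Φ σ) =
      N (c₁ • unitVec N (Θ σ) + c₂ • unitVec N (Φ σ)) • unitVec N (ψ σ)) ∧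
      (∀ σ, 0 < N (c₁ • unitVec N (Θ σ) + c₂ • unitVec N (Φ σ))) ∧
      ∀ σ σ', Θ σ' = Θ σ + Real.pi → Φ σ' = Φ σ + Real.pi → ψ σ' = ψ σ + Real.pi := by
  have hr := radial_continuous hN
  let ζ : ℝ → ℂ := fun σ => ⟨c₁ * radial N (Θ σ) + c₂ * radial N (Φ σ) * Real.cos (Φ σ - Θ σ),
    c₂ * radial N (Φ σ) * Real.sin (Φ σ - Θ σ)⟩
  have him : ∀ σ, 0 < (ζ σ).im := fun σ => mul_pos (mul_pos hc (radial_pos hN _))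
    (Real.sin_pos_of_pos_of_lt_pi (by linarith [h1 σ]) (by linarith [h2 σ]))
  have hζ : Continuous ζ := by
    have : ζ = fun σ => (((c₁ * radial N (Θ σ) + c₂ * radial N (Φ σ) * Real.cos (Φ σ - Θ σ) : ℝ) : ℂ)
        + ((c₂ * radial N (Φ σ) * Real.sin (Φ σ - Θ σ) : ℝ) : ℂ) * Complex.I) := by
      funext σ
      exact Complex.mk_eq_add_mul_I _ _
    rw [this]
    exact (Complex.continuous_ofReal.comp (by fun_prop)).add
      ((Complex.continuous_ofReal.comp (by fun_prop)).mul continuous_const)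
  have hpos : ∀ σ, 0 < ‖ζ σ‖ := fun σ => norm_pos_iff.2 fun h => by
    have := him σ
    rw [h] at this
    simp at this
  have key : ∀ σ, c₁ • unitVec N (Θ σ) + c₂ • unitVec N (Φ σ)
      = ‖ζ σ‖ • dir (Θ σ + (ζ σ).arg) := by
    intro σ
    have e1 : ‖ζ σ‖ * Real.cos (ζ σ).arg = (ζ σ).re := Complex.norm_mul_cos_arg _
    have e2 : ‖ζ σ‖ * Real.sin (ζ σ).arg = (ζ σ).im := Complex.norm_mul_sin_arg _
    have e3 : Φ σ = Θ σ + (Φ σ - Θ σ) := by ring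
    have e4 : dir (Φ σ) = (Real.cos (Θ σ) * Real.cos (Φ σ - Θ σ)
        - Real.sin (Θ σ) * Real.sin (Φ σ - Θ σ), Real.sin (Θ σ) * Real.cos (Φ σ - Θ σ)
        + Real.cos (Θ σ) * Real.sin (Φ σ - Θ σ)) := by
      rw [← Real.cos_add, ← Real.sin_add, ← e3]; rfl
    have e5 : unitVec N (Φ σ) = radial N (Φ σ) • dir (Φ σ) := rfl
    have e6 : unitVec N (Θ σ) = radial N (Θ σ) • dir (Θ σ) := rfl
    rw [e5, e6, e4]
    ext
    · simp only [dir, Prod.fst_add, Prod.smul_fst, smul_eq_mul, Real.cos_add]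
      linear_combination -Real.cos (Θ σ) * e1 + Real.sin (Θ σ) * e2
    · simp only [dir, Prod.snd_add, Prod.smul_snd, smul_eq_mul, Real.sin_add]
      linear_combination -Real.sin (Θ σ) * e1 - Real.cos (Θ σ) * e2
  refine ⟨fun σ => Θ σ + (ζ σ).arg, ?_, ?_, ?_, ?_⟩
  · refine hΘ.add (continuous_iff_continuousAt.2 fun σ => ?_)
    exact (Complex.continuousAt_arg (Or.inr (him σ).ne')).comp hζ.continuousAt
  · intro σ
    rw [key σ, N.map_smul_of_nonneg' (hpos σ).le, mul_smul, ← dir_eq_smul_unitVec hN]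
  · intro σ
    rw [key σ, N.map_smul_of_nonneg' (hpos σ).le]
    exact mul_pos (hpos σ) (norm_dir_pos hN _)
  · intro σ σ' e1 e2
    have : ζ σ' = ζ σ := by
      simp only [ζ, e1, e2, radial_add_pi, add_sub_add_right_eq_sub]
    dsimp only
    rw [this, e1]; ring

end Area

section Rotation

variable {N : Seminorm ℝ (ℝ × ℝ)}

theorem cross_le_of_sweep (hN : ∀ z, N z = 0 → z = 0) {κ η δ K x x' : ℝ} {z z' : ℝ × ℝ}
    (hδ : ∀ t t' : ℝ, -K ≤ t → t ≤ K → t ≤ t' → t' < t + δ →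
      |cross (unitVec N t) (unitVec N t') - (sweep N t' - sweep N t)| ≤ η * (t' - t))
    (hz : z = N z • unitVec N x) (hz' : z' = N z' • unitVec N x') (h0 : 0 < N z) (h0' : 0 < N z')
    (hκ : N z ≤ κ) (hκ' : N z' ≤ κ) (hx : |x| ≤ K) (hxd : |x' - x| < δ)
    (hxp : |x' - x| < Real.pi) (hc : 0 ≤ cross z z') :
    cross z z' ≤ κ ^ 2 * (sweep N x' - sweep N x + η * (x' - x)) := by
  have e : cross z z' = N z * N z' * cross (unitVec N x) (unitVec N x') := by
    conv_lhs => rw [hz, hz']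
    simp only [cross, Prod.smul_fst, Prod.smul_snd, smul_eq_mul]
    ring
  have hc' : 0 ≤ cross (unitVec N x) (unitVec N x') := by
    rw [e] at hc
    exact nonneg_of_mul_nonneg_right hc (by positivity)
  have hxx : x ≤ x' := by
    by_contra! h
    have := cross_unitVec_pos hN h (by linarith [neg_abs_le (x' - x)])
    have h' : cross (unitVec N x) (unitVec N x') = - cross (unitVec N x') (unitVec N x) := by
      simp only [cross]; ring
    linarith
  obtain ⟨hx1, hx2⟩ := abs_le.1 hx
  have := (abs_le.1 (hδ x x' hx1 hx2 hxx (by linarith [le_abs_self (x' - x)]))).2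
  rw [e]
  calc N z * N z' * cross (unitVec N x) (unitVec N x')
      ≤ κ ^ 2 * cross (unitVec N x) (unitVec N x') := by
        refine mul_le_mul_of_nonneg_right ?_ hc'
        rw [sq]
        exact mul_le_mul hκ hκ' h0'.le (h0.le.trans hκ)
    _ ≤ _ := mul_le_mul_of_nonneg_left (by linarith) (sq_nonneg κ)

/-- A rotation of two unit vectors along a closed curve preserves the total swept area, so the
rotated vectors cannot stay inside the open unit ball. -/
theorem rotation_not_interior (hN : ∀ z, N z = 0 → z = 0) {Θ Φ : ℝ → ℝ} {α β : ℝ}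
    (hΘ : Continuous Θ) (hΦ : Continuous Φ) (mΘ : Monotone Θ) (mΦ : Monotone Φ)
    (h1 : ∀ σ, Θ σ < Φ σ) (h2 : ∀ σ, Φ σ < Θ σ + Real.pi)
    (pΘ : ∀ σ, Θ (σ + 2 * Real.pi) = Θ σ + Real.pi)
    (pΦ : ∀ σ, Φ (σ + 2 * Real.pi) = Φ σ + Real.pi)
    (hβ : 0 < β) (hβα : β ≤ α) (hαβ : α ^ 2 + β ^ 2 = 1)
    (hP : ∀ σ, N (α • unitVec N (Θ σ) + β • unitVec N (Φ σ)) < 1)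
    (hQ : ∀ σ, N ((-β) • unitVec N (Θ σ) + α • unitVec N (Φ σ)) < 1) : False := by
  have pp := Real.pi_pos
  have hue := unitVec_continuous hN
  have hNc := N.continuous_prod
  have hα : 0 < α := by linarith
  obtain ⟨ψ, hψ, eψ, posP, perψ⟩ := exists_angle hN hΘ hΦ h1 h2 α hβ
  obtain ⟨χ, hχ, eχ, posQ, perχ⟩ := exists_angle hN hΘ hΦ h1 h2 (-β) hα
  have hI : IsCompact (Icc (0 : ℝ) (2 * Real.pi)) := isCompact_Icc
  have hIne : (Icc (0 : ℝ) (2 * Real.pi)).Nonempty := nonempty_Icc.2 (by linarith)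
  obtain ⟨κ, κP, κQ, hκ1⟩ : ∃ κ : ℝ,
      (∀ σ ∈ Icc (0 : ℝ) (2 * Real.pi), N (α • unitVec N (Θ σ) + β • unitVec N (Φ σ)) ≤ κ) ∧
      (∀ σ ∈ Icc (0 : ℝ) (2 * Real.pi), N ((-β) • unitVec N (Θ σ) + α • unitVec N (Φ σ)) ≤ κ) ∧
      κ < 1 := by
    obtain ⟨σ₀, -, hσ₀⟩ := hI.exists_isMaxOn hIne (f := fun σ =>
      max (N (α • unitVec N (Θ σ) + β • unitVec N (Φ σ)))
        (N ((-β) • unitVec N (Θ σ) + α • unitVec N (Φ σ)))) (by fun_prop)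
    exact ⟨_, fun σ hσ => (le_max_left _ _).trans (hσ₀ hσ),
      fun σ hσ => (le_max_right _ _).trans (hσ₀ hσ), max_lt (hP _) (hQ _)⟩
  have hκ0 : 0 < κ := (posP 0).trans_le (κP 0 ⟨le_rfl, by linarith⟩)
  obtain ⟨K, hK⟩ : ∃ K : ℝ, ∀ σ ∈ Icc (0 : ℝ) (2 * Real.pi),
      |Θ σ| ≤ K ∧ |Φ σ| ≤ K ∧ |ψ σ| ≤ K ∧ |χ σ| ≤ K := by
    obtain ⟨σ₀, -, hσ₀⟩ := hI.exists_isMaxOn hIne (f := fun σ =>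
      |Θ σ| + |Φ σ| + |ψ σ| + |χ σ|) (by fun_prop)
    refine ⟨|Θ σ₀| + |Φ σ₀| + |ψ σ₀| + |χ σ₀|, fun σ hσ => ?_⟩
    have : |Θ σ| + |Φ σ| + |ψ σ| + |χ σ| ≤ |Θ σ₀| + |Φ σ₀| + |ψ σ₀| + |χ σ₀| := hσ₀ hσ
    have a1 := abs_nonneg (Θ σ)
    have a2 := abs_nonneg (Φ σ)
    have a3 := abs_nonneg (ψ σ)
    have a4 := abs_nonneg (χ σ)
    refine ⟨?_, ?_, ?_, ?_⟩ <;> linarith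
  obtain ⟨A, hA⟩ : ∃ A, A = sweep N Real.pi := ⟨_, rfl⟩
  have hA0 : 0 < A := hA ▸ sweep_pi_pos hN
  have hκ2 : 0 < 1 - κ ^ 2 := by nlinarith
  obtain ⟨η, hη, hηpi⟩ : ∃ η : ℝ, 0 < η ∧ 4 * Real.pi * η = A * (1 - κ ^ 2) :=
    ⟨A * (1 - κ ^ 2) / (4 * Real.pi), by positivity, by field_simp⟩
  obtain ⟨δ, hδ0, hδ⟩ := sector_estimate hN K hη
  obtain ⟨γ, hγ0, hγ⟩ : ∃ γ > 0, ∀ σ ∈ Icc (0 : ℝ) (2 * Real.pi),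
      γ ≤ Φ σ - Θ σ ∧ γ ≤ Θ σ + Real.pi - Φ σ := by
    obtain ⟨σ₀, -, hσ₀⟩ := hI.exists_isMinOn hIne (f := fun σ =>
      min (Φ σ - Θ σ) (Θ σ + Real.pi - Φ σ)) (by fun_prop)
    refine ⟨_, ?_, fun σ hσ => ⟨(hσ₀ hσ).trans (min_le_left _ _),
      (hσ₀ hσ).trans (min_le_right _ _)⟩⟩
    exact lt_min (by linarith [h1 σ₀]) (by linarith [h2 σ₀])
  obtain ⟨μ, hμ0, hμ⟩ := Metric.uniformContinuousOn_iff.1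
    (hI.uniformContinuousOn_of_continuous (f := fun σ => ((Θ σ, Φ σ), (ψ σ, χ σ)))
      (by fun_prop)) (min δ (min γ Real.pi)) (by positivity)
  let T : ℝ → ℝ := fun σ => sweep N (Θ σ) + sweep N (Φ σ) - η * (Θ σ + Φ σ)
    - κ ^ 2 * (sweep N (ψ σ) + sweep N (χ σ) + η * (ψ σ + χ σ))
  have step : ∀ σ ∈ Icc (0 : ℝ) (2 * Real.pi), ∀ σ' ∈ Icc (0 : ℝ) (2 * Real.pi), σ ≤ σ' →
      σ' - σ < μ → T σ' ≤ T σ := by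
    intro σ hσ σ' hσ' hle hlt
    have hd := hμ σ' hσ' σ hσ (by rwa [Real.dist_eq, abs_of_nonneg (by linarith)])
    simp only [Prod.dist_eq, Real.dist_eq, max_lt_iff, lt_min_iff] at hd
    obtain ⟨⟨⟨d1, d2⟩, d3, d4⟩, ⟨⟨d1', d2'⟩, -, -⟩, -, d3', d4'⟩ := hd
    obtain ⟨k1, k2, k3, k4⟩ := hK σ hσ
    obtain ⟨g1, g2⟩ := hγ σ hσ
    have iΘ := mΘ hle
    have iΦ := mΦ hle
    obtain ⟨cP, cQ⟩ := cross_rotate_nonneg hN hβ hβα hαβ iΘ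
      (by linarith [le_abs_self (Θ σ' - Θ σ)]) iΦ (by linarith [le_abs_self (Φ σ' - Φ σ)])
      (hP σ').le (hQ σ').le
    have bP := cross_le_of_sweep hN hδ (eψ σ) (eψ σ') (posP σ) (posP σ') (κP σ hσ) (κP σ' hσ')
      k3 d3 d3' cP
    have bQ := cross_le_of_sweep hN hδ (eχ σ) (eχ σ') (posQ σ) (posQ σ') (κQ σ hσ) (κQ σ' hσ')
      k4 d4 d4' cQ
    have bΘ := (abs_le.1 (hδ _ _ (abs_le.1 k1).1 (abs_le.1 k1).2 iΘ
      (by linarith [le_abs_self (Θ σ' - Θ σ)]))).1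
    have bΦ := (abs_le.1 (hδ _ _ (abs_le.1 k2).1 (abs_le.1 k2).2 iΦ
      (by linarith [le_abs_self (Φ σ' - Φ σ)]))).1
    have e : cross (α • unitVec N (Θ σ) + β • unitVec N (Φ σ))
        (α • unitVec N (Θ σ') + β • unitVec N (Φ σ')) +
        cross ((-β) • unitVec N (Θ σ) + α • unitVec N (Φ σ))
        ((-β) • unitVec N (Θ σ') + α • unitVec N (Φ σ')) =
        cross (unitVec N (Θ σ)) (unitVec N (Θ σ')) +
        cross (unitVec N (Φ σ)) (unitVec N (Φ σ')) := by
      simp only [cross, Prod.fst_add, Prod.snd_add, Prod.smul_fst, Prod.smul_snd, smul_eq_mul]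
      linear_combination ((unitVec N (Θ σ)).1 * (unitVec N (Θ σ')).2
        - (unitVec N (Θ σ)).2 * (unitVec N (Θ σ')).1 + (unitVec N (Φ σ)).1 * (unitVec N (Φ σ')).2
        - (unitVec N (Φ σ)).2 * (unitVec N (Φ σ')).1) * hαβ
    simp only [T]
    nlinarith
  obtain ⟨n, hn⟩ := exists_nat_gt (2 * Real.pi / μ)
  have hn0 : (0 : ℝ) < n := lt_trans (by positivity) hn
  have hn' : 2 * Real.pi / n < μ := by
    rw [div_lt_iff₀ hμ0] at hn
    rw [div_lt_iff₀ hn0]; linarith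
  have hmem : ∀ i : ℕ, i ≤ n → (i : ℝ) * (2 * Real.pi / n) ∈ Icc (0 : ℝ) (2 * Real.pi) := by
    intro i hi
    refine ⟨by positivity, ?_⟩
    have : (i : ℝ) ≤ n := by exact_mod_cast hi
    calc (i : ℝ) * (2 * Real.pi / n) ≤ n * (2 * Real.pi / n) :=
          mul_le_mul_of_nonneg_right this (by positivity)
      _ = 2 * Real.pi := by field_simp
  have chain : ∀ i : ℕ, i ≤ n → T (i * (2 * Real.pi / n)) ≤ T 0 := by
    intro i
    induction i with
    | zero => intro _; simp
    | succ j ih =>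
      intro hj
      refine (step _ (hmem j (by omega)) _ (hmem _ hj) ?_ ?_).trans (ih (by omega))
      · push_cast
        have : 0 ≤ 2 * Real.pi / n := by positivity
        linarith
      · push_cast
        linarith
  have hfin := chain n le_rfl
  rw [show (n : ℝ) * (2 * Real.pi / n) = 0 + 2 * Real.pi by field_simp; ring] at hfin
  have sΘ := sweep_add_pi hN (Θ 0)
  have sΦ := sweep_add_pi hN (Φ 0)
  have sψ := sweep_add_pi hN (ψ 0)
  have sχ := sweep_add_pi hN (χ 0)
  simp only [T, perψ _ _ (pΘ 0) (pΦ 0), perχ _ _ (pΘ 0) (pΦ 0), pΘ, pΦ] at hfin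
  rw [← hA] at sΘ sΦ sψ sχ
  have : 2 * A - 2 * Real.pi * η - κ ^ 2 * (2 * A + 2 * Real.pi * η) ≤ 0 := by
    rw [show sweep N (Θ 0 + Real.pi) = sweep N (Θ 0) + A by linarith,
      show sweep N (Φ 0 + Real.pi) = sweep N (Φ 0) + A by linarith,
      show sweep N (ψ 0 + Real.pi) = sweep N (ψ 0) + A by linarith,
      show sweep N (χ 0 + Real.pi) = sweep N (χ 0) + A by linarith] at hfin
    linarith
  have h3 : κ ^ 2 * (2 * Real.pi * η) ≤ 1 * (2 * Real.pi * η) :=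
    mul_le_mul_of_nonneg_right (by linarith) (by positivity)
  nlinarith

end Rotation

section Even

theorem exists_unitVec_pair {N : Seminorm ℝ (ℝ × ℝ)} (hN : ∀ z, N z = 0 → z = 0) {u w : ℝ × ℝ}
    (hu : N u = 1) (hw : N w = 1) (h : 0 < cross u w) :
    ∃ θ φ, u = unitVec N θ ∧ w = unitVec N φ ∧ θ < φ ∧ φ < θ + Real.pi := by
  have pp := Real.pi_pos
  obtain ⟨θ, rfl⟩ := exists_unitVec_eq hu
  obtain ⟨φ, rfl⟩ := exists_unitVec_eq hw
  have hper : Function.Periodic (unitVec N) (2 * Real.pi) := fun x => by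
    rw [two_mul, ← add_assoc, unitVec_add_pi, unitVec_add_pi, neg_neg]
  obtain ⟨ψ, hψ, e⟩ : ∃ ψ ∈ Ico θ (θ + 2 * Real.pi), unitVec N φ = unitVec N ψ :=
    hper.exists_mem_Ico (by positivity) φ θ
  refine ⟨θ, ψ, rfl, e, ?_⟩
  rw [e, cross_unitVec] at h
  have h1 := norm_dir_pos hN θ
  have h2 := norm_dir_pos hN ψ
  have hs : 0 < Real.sin (ψ - θ) := pos_of_mul_pos_right h (by positivity)
  constructor
  · refine lt_of_le_of_ne hψ.1 ?_
    rintro rfl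
    simp at hs
  · by_contra! hc
    have := Real.sin_nonpos_of_nonpos_of_neg_pi_le (x := ψ - θ - 2 * Real.pi)
      (by linarith [hψ.2]) (by linarith)
    rw [Real.sin_sub_two_pi] at this
    linarith

/-- The unit vectors `p`, `r` form a frame in which `s • p ± r` have the same norm, which
dominates the norms of `p ± s • r`. -/
structure IsEvenFrame (N : Seminorm ℝ (ℝ × ℝ)) (s : ℝ) (p r : ℝ × ℝ) : Prop where
  left : N p = 1
  right : N r = 1
  indep : cross p r ≠ 0
  eq : N (s • p - r) = N (s • p + r)
  add_le : N (p + s • r) ≤ N (s • p + r)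
  sub_le : N (p - s • r) ≤ N (s • p + r)

variable {N : Seminorm ℝ (ℝ × ℝ)} {s : ℝ}

theorem IsEvenFrame.of_rotated (hN : ∀ z, N z = 0 → z = 0) (hs : 1 < s) {u w : ℝ × ℝ}
    (hu : N u = 1) (hw : N w = 1) (hc : 0 < cross u w)
    (h : N (u + s • w) = N (s • u - w))
    (hm : max (N ((2 * s / (s ^ 2 + 1)) • u + ((s ^ 2 - 1) / (s ^ 2 + 1)) • w))
      (N ((-((s ^ 2 - 1) / (s ^ 2 + 1))) • u + (2 * s / (s ^ 2 + 1)) • w)) = 1) :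
    ∃ p r, IsEvenFrame N s p r := by
  obtain ⟨n, hn⟩ : ∃ n, n = N (u + s • w) := ⟨_, rfl⟩
  have hn0 : 0 < n := by
    refine lt_of_le_of_ne (hn ▸ apply_nonneg N _) fun h0 => ?_
    have := hN (u + s • w) (by rw [← hn, ← h0])
    have h1 : cross u w * s = cross u (u + s • w) := by simp [cross]; ring
    rw [this] at h1
    have : 0 < cross u w * s := by positivity
    simp [cross] at h1
    rcases h1 with h1 | h1
    · simp only [cross] at hc; linarith
    · linarith
  have hs1 : 0 < s ^ 2 + 1 := by positivity
  obtain ⟨p, hp⟩ : ∃ p, p = n⁻¹ • (s • u - w) := ⟨_, rfl⟩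
  obtain ⟨r, hr⟩ : ∃ r, r = n⁻¹ • (u + s • w) := ⟨_, rfl⟩
  have np : N p = 1 := by
    rw [hp, N.map_smul_of_nonneg' (by positivity), ← h, ← hn, inv_mul_cancel₀ hn0.ne']
  have nr : N r = 1 := by
    rw [hr, N.map_smul_of_nonneg' (by positivity), ← hn, inv_mul_cancel₀ hn0.ne']
  have hcr : cross p r = n⁻¹ ^ 2 * (s ^ 2 + 1) * cross u w := by
    rw [hp, hr]; simp [cross]; ring
  have hcr' : 0 < cross p r := by rw [hcr]; positivity
  have a1 : N (s • p + r) = (s ^ 2 + 1) / n := by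
    rw [show s • p + r = ((s ^ 2 + 1) / n) • u by rw [hp, hr]; match_scalars <;> field_simp <;> ring,
      N.map_smul_of_nonneg' (by positivity), hu, mul_one]
  have b2 : N (p - s • r) = (s ^ 2 + 1) / n := by
    rw [show p - s • r = -(((s ^ 2 + 1) / n) • w) by
        rw [hp, hr]; match_scalars <;> field_simp <;> ring, map_neg_eq_map,
      N.map_smul_of_nonneg' (by positivity), hw, mul_one]
  have b1 : N (p + s • r) = (s ^ 2 + 1) / n *
      N ((2 * s / (s ^ 2 + 1)) • u + ((s ^ 2 - 1) / (s ^ 2 + 1)) • w) := by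
    rw [← N.map_smul_of_nonneg' (by positivity)]
    congr 1
    rw [hp, hr]; match_scalars <;> field_simp <;> ring
  have a2 : N (s • p - r) = (s ^ 2 + 1) / n *
      N ((-((s ^ 2 - 1) / (s ^ 2 + 1))) • u + (2 * s / (s ^ 2 + 1)) • w) := by
    rw [← N.map_smul_of_nonneg' (by positivity), ← map_neg_eq_map N (s • p - r)]
    congr 1
    rw [hp, hr]; match_scalars <;> field_simp <;> ring
  have hq : 0 < (s ^ 2 + 1) / n := by positivity
  generalize N ((2 * s / (s ^ 2 + 1)) • u + ((s ^ 2 - 1) / (s ^ 2 + 1)) • w) = P at *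
  generalize N ((-((s ^ 2 - 1) / (s ^ 2 + 1))) • u + (2 * s / (s ^ 2 + 1)) • w) = Q at *
  have hP1 : P ≤ 1 := hm ▸ le_max_left _ _
  have hQ1 : Q ≤ 1 := hm ▸ le_max_right _ _
  have hPm := mul_le_mul_of_nonneg_left hP1 hq.le
  have hQm := mul_le_mul_of_nonneg_left hQ1 hq.le
  rcases max_choice P Q with h' | h' <;> rw [hm] at h'
  · refine ⟨r, p, nr, np, ?_, ?_, ?_, ?_⟩
    · intro h0
      have : cross p r = - cross r p := by simp only [cross]; ring
      linarith
    · rw [add_comm, b1, ← map_neg_eq_map, neg_sub, b2, ← h', mul_one]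
    · rw [add_comm, a1, add_comm (s • r), b1, ← h', mul_one]
    · rw [← map_neg_eq_map, neg_sub, a2, add_comm (s • r), b1, ← h']; exact hQm
  · refine ⟨p, r, np, nr, hcr'.ne', ?_, ?_, ?_⟩
    · rw [a1, a2, ← h', mul_one]
    · rw [a1, b1]; linarith
    · rw [a1, b2]

theorem IsEvenFrame.comp {R : (ℝ × ℝ) →ₗ[ℝ] (ℝ × ℝ)} {p r : ℝ × ℝ}
    (h : IsEvenFrame (N.comp R) s p r) (hR : cross (R p) (R r) ≠ 0) :
    IsEvenFrame N s (R p) (R r) := by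
  obtain ⟨h1, h2, -, h3, h4, h5⟩ := h
  simp only [Seminorm.comp_apply, map_add, map_sub, map_smul] at h1 h2 h3 h4 h5
  exact ⟨h1, h2, hR, h3, h4, h5⟩

theorem exists_isEvenFrame_of_rotated_frame (hN : ∀ z, N z = 0 → z = 0) (hs : 1 < s)
    (hs2 : s ≤ 2) {p r : ℝ × ℝ} (hp : N p = 1) (hr : N r = 1) (hc : 0 < cross p r)
    (h : N (p - s • r) = N (s • p + r)) (h1 : N (s • p - r) ≤ N (s • p + r))
    (h2 : N (p + s • r) ≤ N (s • p + r)) : ∃ p r, IsEvenFrame N s p r := by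
  by_contra hne
  have pp := Real.pi_pos
  have hue := unitVec_continuous hN
  have hNc := N.continuous_prod
  let f : ℝ → ℝ → ℝ := fun θ φ => N ((1 : ℝ) • unitVec N θ + s • unitVec N φ)
    - N (s • unitVec N θ - (1 : ℝ) • unitVec N φ)
  have hfc : Continuous (Function.uncurry f) := by
    unfold f Function.uncurry
    fun_prop
  have mono : ∀ θ θ' φ φ', θ ≤ θ' → θ' ≤ φ' → φ' ≤ φ → φ ≤ θ + Real.pi → f θ φ ≤ f θ' φ' :=
    fun θ θ' φ φ' i1 i2 i3 i4 => sub_le_sub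
      (norm_add_mono hN zero_le_one (by linarith) i1 i2 i3 i4)
      (norm_sub_mono hN (by linarith) zero_le_one i1 i2 i3 i4)
  obtain ⟨Θ, Φ, cΘ, cΦ, mΘ, mΦ, i1, i2, hz, pΘ, pΦ, hlow⟩ := exists_zero_path hfc mono
    (fun θ => by
      simp only [f]
      rw [← add_smul, ← sub_smul, N.map_smul_of_nonneg' (by linarith),
        N.map_smul_of_nonneg' (by linarith), norm_unitVec hN]
      linarith)
    (fun θ => by
      simp only [f, unitVec_add_pi, smul_neg, sub_neg_eq_add]
      rw [← sub_eq_add_neg, ← add_smul, ← sub_smul, ← map_neg_eq_map, ← neg_smul, neg_sub,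
        N.map_smul_of_nonneg' (by linarith), N.map_smul_of_nonneg' (by linarith), norm_unitVec hN]
      linarith)
    (fun θ φ => by
      simp only [f, unitVec_add_pi, smul_neg]
      rw [← neg_add, map_neg_eq_map, neg_sub_neg, ← map_neg_eq_map N (_ - _), neg_sub])
  let H : ℝ → ℝ → ℝ := fun θ φ =>
    max (N ((2 * s / (s ^ 2 + 1)) • unitVec N θ + ((s ^ 2 - 1) / (s ^ 2 + 1)) • unitVec N φ))
      (N ((-((s ^ 2 - 1) / (s ^ 2 + 1))) • unitVec N θ + (2 * s / (s ^ 2 + 1)) • unitVec N φ))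
  have hHc : ∀ a b : ℝ → ℝ, Continuous a → Continuous b → Continuous fun σ => H (a σ) (b σ) := by
    intro a b ha hb
    simp only [H]
    fun_prop
  have hH1 : ∀ θ φ, θ < φ → φ < θ + Real.pi → f θ φ = 0 → H θ φ ≠ 1 := by
    intro θ φ j1 j2 j3 j4
    refine hne (IsEvenFrame.of_rotated hN hs (norm_unitVec hN θ) (norm_unitVec hN φ)
      (cross_unitVec_pos hN j1 j2) ?_ j4)
    have := sub_eq_zero.1 j3
    rwa [one_smul, one_smul] at this
  have hbig : ∃ σ, 1 < H (Θ σ) (Φ σ) := by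
    by_contra! hle
    have hlt : ∀ σ, H (Θ σ) (Φ σ) < 1 := fun σ =>
      lt_of_le_of_ne (hle σ) (hH1 _ _ (i1 σ) (i2 σ) (hz σ))
    refine rotation_not_interior hN cΘ cΦ mΘ mΦ i1 i2 pΘ pΦ
      (α := 2 * s / (s ^ 2 + 1)) (β := (s ^ 2 - 1) / (s ^ 2 + 1)) ?_ ?_ ?_
      (fun σ => (max_lt_iff.1 (hlt σ)).1) (fun σ => (max_lt_iff.1 (hlt σ)).2)
    · exact div_pos (by nlinarith) (by positivity)
    · exact div_le_div_of_nonneg_right (by nlinarith) (by positivity)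
    · field_simp; ring
  have hall : ∀ σ, 1 < H (Θ σ) (Φ σ) := by
    intro σ
    by_contra! hle
    obtain ⟨σ₁, h₁⟩ := hbig
    have hpath : Continuous fun σ => H (Θ σ) (Φ σ) := hHc Θ Φ cΘ cΦ
    obtain ⟨τ, hτ⟩ := mem_range_of_exists_le_of_exists_ge hpath ⟨σ, hle⟩ ⟨σ₁, h₁.le⟩
    exact hH1 _ _ (i1 τ) (i2 τ) (hz τ) hτ
  obtain ⟨M, hM⟩ : ∃ M, M = N (s • p + r) := ⟨_, rfl⟩
  have hM0 : 0 < M := by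
    refine lt_of_le_of_ne (hM ▸ apply_nonneg N _) fun h0 => ?_
    have := hN (s • p + r) (by rw [← hM, ← h0])
    have e : cross p r = cross p (s • p + r) := by simp [cross]; ring
    rw [e, this] at hc
    simp [cross] at hc
  obtain ⟨u, hu⟩ : ∃ u, u = M⁻¹ • (s • p + r) := ⟨_, rfl⟩
  obtain ⟨w, hw⟩ : ∃ w, w = M⁻¹ • (s • r - p) := ⟨_, rfl⟩
  have nu : N u = 1 := by
    rw [hu, N.map_smul_of_nonneg' (by positivity), ← hM, inv_mul_cancel₀ hM0.ne']
  have nw : N w = 1 := by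
    rw [hw, N.map_smul_of_nonneg' (by positivity), ← map_neg_eq_map, neg_sub, h, ← hM,
      inv_mul_cancel₀ hM0.ne']
  have huw : 0 < cross u w := by
    have : cross u w = M⁻¹ ^ 2 * (s ^ 2 + 1) * cross p r := by
      rw [hu, hw]; simp [cross]; ring
    rw [this]; positivity
  have e1 : (2 * s / (s ^ 2 + 1)) • u + ((s ^ 2 - 1) / (s ^ 2 + 1)) • w = M⁻¹ • (p + s • r) := by
    rw [hu, hw]; match_scalars <;> field_simp <;> ring
  have e2 : (-((s ^ 2 - 1) / (s ^ 2 + 1))) • u + (2 * s / (s ^ 2 + 1)) • w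
      = M⁻¹ • (-(s • p - r)) := by
    rw [hu, hw]; match_scalars <;> field_simp <;> ring
  have e3 : (1 : ℝ) • u + s • w = (M⁻¹ * (s ^ 2 + 1)) • r := by
    rw [hu, hw]; match_scalars <;> field_simp <;> ring
  have e4 : s • u - (1 : ℝ) • w = (M⁻¹ * (s ^ 2 + 1)) • p := by
    rw [hu, hw]; match_scalars <;> field_simp <;> ring
  obtain ⟨θ, φ, rfl, rfl, j1, j2⟩ := exists_unitVec_pair hN nu nw huw
  have hf0 : f θ φ = 0 := by
    simp only [f]
    rw [e3, e4, map_smul_eq_mul, map_smul_eq_mul, hp, hr, sub_self]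
  have hle : H θ φ ≤ 1 := by
    simp only [H]
    rw [e1, e2, N.map_smul_of_nonneg' (by positivity), N.map_smul_of_nonneg' (by positivity),
      map_neg_eq_map, inv_mul_eq_div, inv_mul_eq_div]
    refine max_le ?_ ?_ <;> rw [div_le_one hM0, hM] <;> assumption
  obtain ⟨l1, l2⟩ := hlow θ φ j1.le j2.le hf0
  have k1 := i1 (θ + φ)
  have k2 := i2 (θ + φ)
  have kz := hz (θ + φ)
  have kall := hall (θ + φ)
  generalize Θ (θ + φ) = θ₀ at *
  generalize Φ (θ + φ) = φ₀ at *
  have hseg : Continuous fun t : ℝ => H (θ₀ + t * (θ - θ₀)) (φ₀ + t * (φ - φ₀)) :=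
    hHc (fun t => θ₀ + t * (θ - θ₀)) (fun t => φ₀ + t * (φ - φ₀)) (by fun_prop) (by fun_prop)
  obtain ⟨t, ht, ht1⟩ := intermediate_value_Icc' (zero_le_one (α := ℝ)) hseg.continuousOn
    (show (1 : ℝ) ∈ _ by simpa using ⟨hle, kall.le⟩)
  have q1 : 0 ≤ t * (θ - θ₀) := mul_nonneg ht.1 (by linarith)
  have q2 : t * (θ - θ₀) ≤ 1 * (θ - θ₀) := mul_le_mul_of_nonneg_right ht.2 (by linarith)
  have q3 : 0 ≤ t * (φ₀ - φ) := mul_nonneg ht.1 (by linarith)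
  have q4 : t * (φ₀ - φ) ≤ 1 * (φ₀ - φ) := mul_le_mul_of_nonneg_right ht.2 (by linarith)
  refine hH1 _ _ (by linarith) (by linarith) (le_antisymm ?_ ?_) ht1
  · rw [← hf0]
    exact mono _ _ _ _ (by linarith) (by linarith) (by linarith) (by linarith)
  · rw [← kz]
    exact mono _ _ _ _ (by linarith) (by linarith) (by linarith) (by linarith)

theorem exists_isEvenFrame (hN : ∀ z, N z = 0 → z = 0) (hs : 1 < s) (hs2 : s ≤ 2) :
    ∃ p r, IsEvenFrame N s p r := by
  have pp := Real.pi_pos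
  have hue := unitVec_continuous hN
  have hNc := N.continuous_prod
  have rot : ∀ p r : ℝ × ℝ, N p = 1 → N r = 1 → cross p r ≠ 0 → N (p - s • r) = N (s • p + r) →
      N (s • p - r) ≤ N (s • p + r) → N (p + s • r) ≤ N (s • p + r) →
      ∃ p r, IsEvenFrame N s p r := by
    intro p r hp hr hc h h1 h2
    rcases hc.lt_or_gt with hc | hc
    · let R : (ℝ × ℝ) →ₗ[ℝ] (ℝ × ℝ) := LinearMap.prodMap LinearMap.id (-LinearMap.id)
      have hRc : ∀ a b, cross (R a) (R b) = - cross a b := fun a b => by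
        simp [R, cross]; ring
      have hRR : ∀ a, R (R a) = a := fun a => by simp [R]
      have hN' : ∀ z, N.comp R z = 0 → z = 0 := fun z hz => by
        have := hN _ hz
        rw [← hRR z, this, map_zero]
      obtain ⟨a, b, hab⟩ := exists_isEvenFrame_of_rotated_frame (N := N.comp R) hN' hs hs2
        (p := R p) (r := R r) (by simpa [hRR] using hp) (by simpa [hRR] using hr)
        (by rw [hRc]; linarith) (by simpa [hRR] using h) (by simpa [hRR] using h1)
        (by simpa [hRR] using h2)
      exact ⟨_, _, hab.comp (by rw [hRc]; exact neg_ne_zero.2 hab.indep)⟩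
    · exact exists_isEvenFrame_of_rotated_frame hN hs hs2 hp hr hc h h1 h2
  obtain ⟨p, hp⟩ : ∃ p, p = unitVec N 0 := ⟨_, rfl⟩
  have np : N p = 1 := hp ▸ norm_unitVec hN 0
  let g : ℝ → ℝ := fun φ =>
    max (N (s • p + unitVec N φ)) (N (p + s • unitVec N φ)) -
      max (N (s • p - unitVec N φ)) (N (p - s • unitVec N φ))
  have hg : Continuous g := by unfold g; fun_prop
  have n1 : N (s • p + p) = s + 1 := by
    rw [show s • p + p = (s + 1) • p by module, N.map_smul_of_nonneg' (by linarith), np, mul_one]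
  have n2 : N (p + s • p) = s + 1 := by rw [add_comm, n1]
  have n3 : N (s • p - p) = s - 1 := by
    rw [show s • p - p = (s - 1) • p by module, N.map_smul_of_nonneg' (by linarith), np, mul_one]
  have n4 : N (p - s • p) = s - 1 := by rw [← map_neg_eq_map, neg_sub, n3]
  have g0 : 0 < g 0 := by
    simp only [g, ← hp, n1, n2, n3, n4, max_self]; linarith
  have gpi : g Real.pi < 0 := by
    have e : unitVec N Real.pi = -p := by rw [hp, ← unitVec_add_pi, zero_add]
    simp only [g, e, smul_neg, sub_neg_eq_add, ← sub_eq_add_neg, n1, n2, n3, n4, max_self]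
    linarith
  obtain ⟨φ, hφ, hφ0⟩ := intermediate_value_Icc' pp.le hg.continuousOn
    (show (0 : ℝ) ∈ _ from ⟨gpi.le, g0.le⟩)
  have hφ1 : 0 < φ := lt_of_le_of_ne hφ.1 fun h => g0.ne' (h ▸ hφ0)
  have hφ2 : φ < Real.pi := lt_of_le_of_ne hφ.2 fun h => gpi.ne (h ▸ hφ0)
  have hc := cross_unitVec_pos hN hφ1 (by linarith)
  rw [← hp] at hc
  have nr := norm_unitVec hN φ
  simp only [g] at hφ0
  generalize unitVec N φ = r at *
  have hc' : cross r p ≠ 0 := by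
    intro h0
    have : cross p r = - cross r p := by simp only [cross]; ring
    linarith
  have s1 : N (r - s • p) = N (s • p - r) := by rw [← map_neg_eq_map, neg_sub]
  have s2 : N (s • r - p) = N (p - s • r) := by rw [← map_neg_eq_map, neg_sub]
  have s3 : N (s • r + p) = N (p + s • r) := by rw [add_comm]
  have s4 : N (r + s • p) = N (s • p + r) := by rw [add_comm]
  rcases le_total (N (s • p + r)) (N (p + s • r)) with h1 | h1 <;>
    rcases le_total (N (s • p - r)) (N (p - s • r)) with h2 | h2 <;>
    [rw [max_eq_right h1, max_eq_right h2] at hφ0; rw [max_eq_right h1, max_eq_left h2] at hφ0;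
      rw [max_eq_left h1, max_eq_right h2] at hφ0; rw [max_eq_left h1, max_eq_left h2] at hφ0]
  · exact ⟨r, p, nr, np, hc', by linarith, by linarith, by linarith⟩
  · exact rot r p nr np hc' (by linarith) (by linarith) (by linarith)
  · exact rot p r np nr hc.ne' (by linarith) (by linarith) (by linarith)
  · exact ⟨p, r, np, nr, hc.ne', by linarith, by linarith, by linarith⟩

end Even

section Odd

/-- The coordinate axes form an even frame of a norm of the plane, with `m` the common norm. -/
structure IsEvenBasis (N : Seminorm ℝ (ℝ × ℝ)) (s m : ℝ) : Prop where
  fst : N (1, 0) = 1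
  snd : N (0, 1) = 1
  add : N (s, 1) = m
  sub : N (s, -1) = m
  add_le : N (1, s) ≤ m
  sub_le : N (1, -s) ≤ m
  lower : 1707 / 1000 ≤ s
  upper : s ≤ 17072 / 10000
  le : s ≤ m
  le_sq : m ≤ s ^ 2 - 1

/-- The reflection of the plane in the vertical axis. -/
def reflect : (ℝ × ℝ) →ₗ[ℝ] (ℝ × ℝ) := LinearMap.prodMap (-LinearMap.id) LinearMap.id

theorem reflect_mk (x y : ℝ) : reflect (x, y) = (-x, y) := by simp [reflect]

variable {N : Seminorm ℝ (ℝ × ℝ)} {s m : ℝ}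

theorem Seminorm.neg_mk (N : Seminorm ℝ (ℝ × ℝ)) (x y : ℝ) : N (-x, -y) = N (x, y) := by
  rw [← map_neg_eq_map N (x, y)]; rfl

theorem Seminorm.neg_mk' (N : Seminorm ℝ (ℝ × ℝ)) (x y : ℝ) : N (x, -y) = N (-x, y) := by
  rw [← N.neg_mk, neg_neg]

theorem Seminorm.comp_reflect (N : Seminorm ℝ (ℝ × ℝ)) (x y : ℝ) :
    N.comp reflect (x, y) = N (-x, y) := by
  rw [Seminorm.comp_apply, reflect_mk]

theorem Seminorm.mk_le_of_comb (N : Seminorm ℝ (ℝ × ℝ)) {a b x₁ y₁ x₂ y₂ x y : ℝ} (ha : 0 ≤ a)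
    (hb : 0 ≤ b) (hx : x = a * x₁ + b * x₂) (hy : y = a * y₁ + b * y₂) :
    N (x, y) ≤ a * N (x₁, y₁) + b * N (x₂, y₂) := by
  have := N.map_lincomb_le a b (x₁, y₁) (x₂, y₂)
  rw [abs_of_nonneg ha, abs_of_nonneg hb] at this
  convert this using 2
  simp [hx, hy]

namespace IsEvenBasis

theorem reflect (h : IsEvenBasis N s m) : IsEvenBasis (N.comp reflect) s m := by
  obtain ⟨h1, h2, h3, h4, h5, h6, h7, h8, h9, h10⟩ := h
  refine ⟨?_, ?_, ?_, ?_, ?_, ?_, h7, h8, h9, h10⟩ <;> rw [N.comp_reflect]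
  · rw [← neg_zero, N.neg_mk, h1]
  · rw [neg_zero, h2]
  · rw [← N.neg_mk', h4]
  · rw [N.neg_mk, h3]
  · rw [← N.neg_mk']; exact h6
  · rw [N.neg_mk]; exact h5

variable (h : IsEvenBasis N s m)

include h

theorem k_le : m - s ≤ 2074 / 10000 := by
  have := h.lower; have := h.upper; have := h.le_sq
  nlinarith

theorem m_le : m ≤ 19146 / 10000 := by
  have := h.lower; have := h.upper; have := h.le_sq
  nlinarith

theorem le_of_nonneg {x y B : ℝ} (hx : 0 ≤ x) (hy : 0 ≤ y) (h1 : y + (m - s) * x ≤ B)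
    (h2 : x + (m - s) * y ≤ B) (h3 : m * (x + y) ≤ B * (s + 1)) : N (x, y) ≤ B := by
  have hs := h.lower
  rcases le_total (s * x) y with hxy | hxy
  · have := N.mk_le_of_comb (x₁ := 1) (y₁ := s) (x₂ := 0) (y₂ := 1) hx (sub_nonneg.2 hxy)
      (x := x) (y := y) (by ring) (by ring)
    rw [h.snd] at this
    have := mul_le_mul_of_nonneg_left h.add_le hx
    linarith
  rcases le_total (s * y) x with hyx | hyx
  · have := N.mk_le_of_comb (x₁ := s) (y₁ := 1) (x₂ := 1) (y₂ := 0) hy (sub_nonneg.2 hyx)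
      (x := x) (y := y) (by ring) (by ring)
    rw [h.fst, h.add] at this
    linarith
  · have hc : 0 < s ^ 2 - 1 := by nlinarith
    have e1 : 0 ≤ (s * x - y) / (s ^ 2 - 1) := div_nonneg (by linarith) hc.le
    have e2 : 0 ≤ (s * y - x) / (s ^ 2 - 1) := div_nonneg (by linarith) hc.le
    have := N.mk_le_of_comb (x₁ := s) (y₁ := 1) (x₂ := 1) (y₂ := s) e1 e2
      (x := x) (y := y) (by field_simp; ring) (by field_simp; ring)
    have h4 := mul_le_mul_of_nonneg_left h.add_le e2
    rw [h.add] at this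
    have e : (s * x - y) / (s ^ 2 - 1) * m + (s * y - x) / (s ^ 2 - 1) * m
        = m * (x + y) / (s + 1) := by
      rw [show s ^ 2 - 1 = (s - 1) * (s + 1) by ring]
      have : s - 1 ≠ 0 := by linarith
      have : s + 1 ≠ 0 := by linarith
      field_simp; ring
    have : m * (x + y) / (s + 1) ≤ B := by rwa [div_le_iff₀ (by linarith)]
    linarith

theorem le_of_abs {x y B : ℝ} (h1 : |y| + (m - s) * |x| ≤ B)
    (h2 : |x| + (m - s) * |y| ≤ B) (h3 : m * (|x| + |y|) ≤ B * (s + 1)) : N (x, y) ≤ B := by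
  have e : N (x, y) = N (|x|, |y|) ∨ N (x, y) = N.comp _root_.reflect (|x|, |y|) := by
    rcases abs_choice x with hx | hx <;> rcases abs_choice y with hy | hy <;>
      rw [hx, hy, N.comp_reflect]
    · left; rfl
    · right; rw [N.neg_mk]
    · right; rw [neg_neg]
    · left; rw [N.neg_mk]
  rcases e with e | e <;> rw [e]
  · exact h.le_of_nonneg (abs_nonneg _) (abs_nonneg _) h1 h2 h3
  · exact h.reflect.le_of_nonneg (abs_nonneg _) (abs_nonneg _) h1 h2 h3

theorem fst_sub_le (x y : ℝ) : |x| - (m - s) * |y| ≤ N (x, y) := by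
  have main : ∀ {N : Seminorm ℝ (ℝ × ℝ)}, IsEvenBasis N s m → ∀ x y : ℝ, 0 ≤ x → 0 ≤ y →
      x - (m - s) * y ≤ N (x, y) := by
    intro N h x y hx hy
    have := N.mk_le_of_comb (x₁ := x) (y₁ := y) (x₂ := s) (y₂ := -1) zero_le_one hy
      (x := x + s * y) (y := 0) (by ring) (by ring)
    have e2 : N (x + s * y, 0) = x + s * y := by
      have : ((x + s * y, 0) : ℝ × ℝ) = (x + s * y) • ((1 : ℝ), (0 : ℝ)) := by simp
      rw [this, N.map_smul_of_nonneg' (add_nonneg hx (mul_nonneg (by linarith [h.lower]) hy)),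
        h.fst, mul_one]
    rw [h.sub, e2] at this
    linarith
  rcases abs_choice x with hx | hx <;> rcases abs_choice y with hy | hy
  · have := main h |x| |y| (abs_nonneg _) (abs_nonneg _)
    rwa [hx, hy] at this ⊢
  · have := main h.reflect |x| |y| (abs_nonneg _) (abs_nonneg _)
    rw [N.comp_reflect] at this
    rw [hx, hy] at this ⊢
    rwa [N.neg_mk] at this
  · have := main h.reflect |x| |y| (abs_nonneg _) (abs_nonneg _)
    rw [N.comp_reflect] at this
    rw [hx, hy] at this ⊢
    rwa [neg_neg] at this
  · have := main h |x| |y| (abs_nonneg _) (abs_nonneg _)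
    rw [hx, hy] at this ⊢
    rwa [N.neg_mk] at this

theorem snd_sub_le (x y : ℝ) : |y| - (m - s) * |x| ≤ N (x, y) := by
  have main : ∀ {N : Seminorm ℝ (ℝ × ℝ)}, IsEvenBasis N s m → ∀ x y : ℝ, 0 ≤ x → 0 ≤ y →
      y - (m - s) * x ≤ N (x, y) := by
    intro N h x y hx hy
    have := N.mk_le_of_comb (x₁ := x) (y₁ := y) (x₂ := -1) (y₂ := s) zero_le_one hx
      (x := 0) (y := y + s * x) (by ring) (by ring)
    have e2 : N (0, y + s * x) = y + s * x := by
      have : ((0, y + s * x) : ℝ × ℝ) = (y + s * x) • ((0 : ℝ), (1 : ℝ)) := by simp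
      rw [this, N.map_smul_of_nonneg' (add_nonneg hy (mul_nonneg (by linarith [h.lower]) hx)),
        h.snd, mul_one]
    have := mul_le_mul_of_nonneg_left h.sub_le hx
    rw [N.neg_mk'] at this
    linarith
  rcases abs_choice x with hx | hx <;> rcases abs_choice y with hy | hy
  · have := main h |x| |y| (abs_nonneg _) (abs_nonneg _)
    rwa [hx, hy] at this ⊢
  · have := main h.reflect |x| |y| (abs_nonneg _) (abs_nonneg _)
    rw [N.comp_reflect] at this
    rw [hx, hy] at this ⊢
    rwa [N.neg_mk] at this
  · have := main h.reflect |x| |y| (abs_nonneg _) (abs_nonneg _)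
    rw [N.comp_reflect] at this
    rw [hx, hy] at this ⊢
    rwa [neg_neg] at this
  · have := main h |x| |y| (abs_nonneg _) (abs_nonneg _)
    rw [hx, hy] at this ⊢
    rwa [N.neg_mk] at this

/-- Bounds on the coordinates of a unit vector according to its direction. -/
theorem fst_add_le {x y : ℝ} (hn : N (x, y) = 1) (hx : 0 ≤ x) (hxy : x ≤ s * y) :
    x + (m - s) * y ≤ 1 := by
  have hy : 0 ≤ y := by
    by_contra! hy
    have := h.lower
    nlinarith
  have := N.mk_le_of_comb (x₁ := x) (y₁ := y) (x₂ := 1) (y₂ := 0) zero_le_one (sub_nonneg.2 hxy)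
    (x := s * y) (y := y) (by ring) (by ring)
  have e : N (s * y, y) = y * m := by
    have : ((s * y, y) : ℝ × ℝ) = y • (s, (1 : ℝ)) := by simp [mul_comm]
    rw [this, N.map_smul_of_nonneg' hy, h.add]
  rw [hn, h.fst, e] at this
  linarith

theorem add_ge {x y : ℝ} (hn : N (x, y) = 1) (hxy : x ≤ s * y) (hyx : y ≤ s * x) :
    s + 1 ≤ m * (x + y) := by
  have hs := h.lower
  have hc : 0 < s ^ 2 - 1 := by nlinarith
  have e1 : 0 ≤ (s * x - y) / (s ^ 2 - 1) := div_nonneg (by linarith) hc.le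
  have e2 : 0 ≤ (s * y - x) / (s ^ 2 - 1) := div_nonneg (by linarith) hc.le
  have := N.mk_le_of_comb (x₁ := s) (y₁ := 1) (x₂ := 1) (y₂ := s) e1 e2
    (x := x) (y := y) (by field_simp; ring) (by field_simp; ring)
  have h4 := mul_le_mul_of_nonneg_left h.add_le e2
  rw [h.add, hn] at this
  have e : (s * x - y) / (s ^ 2 - 1) * m + (s * y - x) / (s ^ 2 - 1) * m
      = m * (x + y) / (s + 1) := by
    rw [show s ^ 2 - 1 = (s - 1) * (s + 1) by ring]
    have : s - 1 ≠ 0 := by linarith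
    have : s + 1 ≠ 0 := by linarith
    field_simp; ring
  have h5 : 1 ≤ m * (x + y) / (s + 1) := by linarith
  rwa [le_div_iff₀ (by linarith), one_mul] at h5

theorem snd_steep {x y : ℝ} (hn : N (x, y) = 1) (hx : 0 ≤ x) (hxy : s * x ≤ y) :
    s ≤ m * y := by
  have hs := h.lower
  have := N.mk_le_of_comb (x₁ := 1) (y₁ := s) (x₂ := 0) (y₂ := 1) hx (sub_nonneg.2 hxy)
    (x := x) (y := y) (by ring) (by ring)
  rw [h.snd, hn] at this
  have := mul_le_mul_of_nonneg_left h.add_le hx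
  have h1 : 1 ≤ (m - s) * x + y := by linarith
  have h2 : (m - s) * (s * x) ≤ (m - s) * y := mul_le_mul_of_nonneg_left hxy (by linarith [h.le])
  nlinarith

theorem fst_flat {x y : ℝ} (hn : N (x, y) = 1) (hy : 0 ≤ y) (hxy : s * y ≤ x) :
    1 ≤ x + (m - s) * y := by
  have := N.mk_le_of_comb (x₁ := s) (y₁ := 1) (x₂ := 1) (y₂ := 0) hy (sub_nonneg.2 hxy)
    (x := x) (y := y) (by ring) (by ring)
  rw [h.fst, h.add, hn] at this
  linarith

theorem snd_ge {x y : ℝ} (hn : N (x, y) = 1) (hx : 0 ≤ x) (hxy : x ≤ s * y) : 1 ≤ m * y := by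
  have hs := h.lower
  have hm := h.le
  rcases le_total y (s * x) with hyx | hyx
  · have := h.add_ge hn hxy hyx
    have : m * (x + y) ≤ m * (s * y + y) := mul_le_mul_of_nonneg_left (by linarith) (by linarith)
    nlinarith
  · linarith [h.snd_steep hn hx hyx]

theorem fst_ge {x y : ℝ} (hn : N (x, y) = 1) (hy : 0 ≤ y) (hyx : y ≤ s * x) : 1 ≤ m * x := by
  have hs := h.lower
  have hm := h.le
  rcases le_total x (s * y) with hxy | hxy
  · have := h.add_ge hn hxy hyx
    have : m * (x + y) ≤ m * (x + s * x) := mul_le_mul_of_nonneg_left (by linarith) (by linarith)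
    nlinarith
  · have h1 := h.fst_flat hn hy hxy
    have h2 : (m - s) * (s * y) ≤ (m - s) * x := mul_le_mul_of_nonneg_left hxy (by linarith)
    nlinarith

theorem snd_flat {x y : ℝ} (hn : N (x, y) = 1) (hy : 0 ≤ y) (hxy : s * y ≤ x) : m * y ≤ 1 := by
  have hs := h.lower
  have hm := h.le
  rcases hy.eq_or_lt with rfl | hy
  · linarith
  have hx : 0 < x := by nlinarith
  have hq : s * y / x ≤ 1 := (div_le_one hx).2 hxy
  have := N.mk_le_of_comb (x₁ := x) (y₁ := y) (x₂ := 0) (y₂ := 1) (a := s * y / x)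
    (b := (1 - s * y / x) * y) (by positivity) (mul_nonneg (by linarith) hy.le)
    (x := s * y) (y := y) (by field_simp; ring) (by ring)
  have e : N (s * y, y) = y * m := by
    have : ((s * y, y) : ℝ × ℝ) = y • (s, (1 : ℝ)) := by simp [mul_comm]
    rw [this, N.map_smul_of_nonneg' hy.le, h.add]
  rw [e, hn, h.snd, mul_one, mul_one] at this
  have h1 : m ≤ s / x + (1 - s * y / x) := by
    have e2 : s * y / x + (1 - s * y / x) * y = (s / x + (1 - s * y / x)) * y := by
      field_simp
    rw [e2, mul_comm] at this
    exact le_of_mul_le_mul_right this hy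
  have h2 : m * x ≤ s + x - s * y := by
    have := mul_le_mul_of_nonneg_right h1 hx.le
    have e3 : (s / x + (1 - s * y / x)) * x = s + x - s * y := by field_simp; ring
    linarith
  nlinarith

end IsEvenBasis

end Odd

namespace IsEvenBasis

variable {N : Seminorm ℝ (ℝ × ℝ)} {s m : ℝ} (h : IsEvenBasis N s m)

include h

theorem le_of_steep {x y : ℝ} (hxy : s * |x| ≤ y) : N (x, y) ≤ y + (m - s) * |x| := by
  have main : ∀ {N : Seminorm ℝ (ℝ × ℝ)}, IsEvenBasis N s m → ∀ x y : ℝ, 0 ≤ x → s * x ≤ y →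
      N (x, y) ≤ y + (m - s) * x := by
    intro N h x y hx hxy
    have := N.mk_le_of_comb (x₁ := 1) (y₁ := s) (x₂ := 0) (y₂ := 1) hx (sub_nonneg.2 hxy)
      (x := x) (y := y) (by ring) (by ring)
    rw [h.snd] at this
    have := mul_le_mul_of_nonneg_left h.add_le hx
    linarith
  rcases abs_choice x with hx | hx
  · have := main h |x| y (abs_nonneg x) hxy
    rwa [hx] at this ⊢
  · have := main h.reflect |x| y (abs_nonneg x) hxy
    rw [N.comp_reflect, hx, neg_neg] at this
    rwa [hx]

theorem k_mul_le : (m - s) * (s + 1) ≤ s - 1 := by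
  have := h.lower; have := h.upper; have := h.k_le; have := h.le
  nlinarith

theorem k_mul_le_one : (m - s) * s ≤ 1 := by
  have := h.lower; have := h.upper; have := h.k_le; have := h.le
  nlinarith

theorem m_mul_le : m * (s ^ 2 + 2 * s - 1) ≤ (s + 1) * (s ^ 2 + 1) := by
  have := h.lower; have := h.upper; have := h.le_sq
  have h1 : m * (s ^ 2 + 2 * s - 1) ≤ (s ^ 2 - 1) * (s ^ 2 + 2 * s - 1) :=
    mul_le_mul_of_nonneg_right h.le_sq (by nlinarith)
  have h2 : 0 ≤ s * (s + 1) * (3 - s ^ 2) := mul_nonneg (by nlinarith) (by nlinarith)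
  nlinarith

variable {x₁ y₁ x₃ y₃ : ℝ}

theorem add_le_sub_of_edge (n₁ : N (x₁, y₁) = 1) (n₃ : N.comp _root_.reflect (x₃, y₃) = 1)
    (hy₁ : 0 ≤ y₁) (hy₃ : 0 ≤ y₃) (e₁ : x₁ = s * y₁) (e₂ : y₃ ≤ s * y₁) (e₃ : y₃ ≤ s * x₃)
    (r₃ : x₃ ≤ s * y₃) :
    N (s * x₁ - x₃, s * y₁ + y₃) ≤ N (s * x₁ + x₃, s * y₁ - y₃) := by
  have hs := h.lower
  have hm := h.le
  have hk := h.k_mul_le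
  have hk1 := h.k_mul_le_one
  have hkk := h.k_le
  have my₁ : m * y₁ = 1 := le_antisymm (h.snd_flat n₁ hy₁ e₁.ge)
    (h.snd_ge n₁ (e₁ ▸ mul_nonneg (by linarith) hy₁) e₁.le)
  have mx₃ : 1 ≤ m * x₃ := h.reflect.fst_ge n₃ hy₃ e₃
  have hxy : y₁ ≤ x₃ := by
    have : m * y₁ ≤ m * x₃ := by linarith
    exact le_of_mul_le_mul_left this (by linarith)
  refine le_trans ?_ (h.fst_sub_le _ _)
  subst e₁
  have hsy : 0 ≤ s * y₁ := mul_nonneg (by linarith) hy₁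
  have hX : 0 ≤ s * (s * y₁) - x₃ := by nlinarith
  rw [abs_of_nonneg (show 0 ≤ s * (s * y₁) + x₃ by nlinarith),
    abs_of_nonneg (sub_nonneg.2 e₂)]
  refine h.le_of_nonneg hX (by linarith) ?_ ?_ ?_
  · have p1 := mul_le_mul_of_nonneg_right e₂ (show 0 ≤ 1 - (m - s) by linarith)
    have p2 := mul_le_mul_of_nonneg_right hxy (show 0 ≤ 1 + (m - s) by linarith)
    have p3 := mul_le_mul_of_nonneg_left hk (mul_nonneg hy₁ (show 0 ≤ s - 1 by linarith))
    nlinarith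
  · have p1 := mul_le_mul_of_nonneg_left hk1 hy₁
    nlinarith
  · have p1 := mul_le_mul_of_nonneg_right e₂ (show 0 ≤ m - (s + 1) * (m - s) by linarith)
    have p2 := mul_le_mul_of_nonneg_right hxy (show 0 ≤ m + s + 1 by linarith)
    have p3 := mul_le_mul_of_nonneg_left h.m_mul_le hy₁
    nlinarith

theorem add_le_add_of_edge (n₁ : N (x₁, y₁) = 1) (n₃ : N.comp _root_.reflect (x₃, y₃) = 1)
    (hx₁ : 0 ≤ x₁) (hy₁ : 0 ≤ y₁) (hx₃ : 0 ≤ x₃) (e₁ : x₁ ≤ s * y₁) (r₁ : y₁ ≤ s * x₁)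
    (e₂ : y₃ = s * y₁) (e₃ : y₃ ≤ s * x₃) (r₃ : x₃ ≤ s * y₃) :
    N (s * x₁ - x₃, s * y₁ + y₃) ≤ N (x₁ - s * x₃, y₁ + s * y₃) := by
  have hs := h.lower
  have hsu := h.upper
  have hm := h.le
  have hk := h.k_mul_le
  have hk1 := h.k_mul_le_one
  have hkk := h.k_le
  have my₁ := h.snd_ge n₁ hx₁ e₁
  have sum₁ := h.add_ge n₁ e₁ r₁
  have u₃ := h.reflect.fst_add_le n₃ hx₃ r₃
  subst e₂
  obtain ⟨k, hkd⟩ : ∃ k, k = m - s := ⟨_, rfl⟩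
  have hk0 : 0 ≤ k := by linarith
  have hxy : y₁ ≤ x₃ := le_of_mul_le_mul_left e₃ (by linarith)
  have b1 : s * |s * x₁ - x₃| ≤ s * y₁ + s * y₁ := by
    have : |s * x₁ - x₃| ≤ 2 * y₁ := by
      rw [abs_le]
      constructor <;> nlinarith
    nlinarith
  refine (h.le_of_steep b1).trans (le_trans ?_ (h.snd_sub_le _ _))
  rw [abs_of_nonneg (show 0 ≤ y₁ + s * (s * y₁) by positivity)]
  rw [← hkd] at hk hk1 hkk u₃ ⊢
  have E1 : k * (s + 1) * (x₁ - x₃) ≤ (s - 1) ^ 2 * y₁ := by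
    have p1 : k * (s + 1) * (x₁ - x₃) ≤ k * (s + 1) * ((s - 1) * y₁) :=
      mul_le_mul_of_nonneg_left (by linarith) (by positivity)
    have p2 := mul_le_mul_of_nonneg_right hk (mul_nonneg (show 0 ≤ s - 1 by linarith) hy₁)
    linarith
  have E2 : k * (s + 1) * (x₃ - x₁) ≤ (s - 1) ^ 2 * y₁ := by
    have q : k * (1 - k * s) * (s + 1) ≤ (s - 1) ^ 2 := by
      have q1 : 4 * s * (k * (1 - k * s)) ≤ 1 := by nlinarith [sq_nonneg (2 * k * s - 1)]
      have q2 : (s + 1) * (4 * s * (k * (1 - k * s))) ≤ (s + 1) * 1 :=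
        mul_le_mul_of_nonneg_left q1 (by linarith)
      have q3 : s + 1 ≤ 4 * s * (s - 1) ^ 2 := by
        have : (7 / 10 : ℝ) ^ 2 ≤ (s - 1) ^ 2 := pow_le_pow_left₀ (by norm_num) (by linarith) 2
        nlinarith
      refine le_of_mul_le_mul_left (a := 4 * s) ?_ (by linarith)
      linarith
    have p0 : m * (x₃ - x₁) ≤ m * y₁ * (1 - k * s) := by
      have := mul_le_mul_of_nonneg_left u₃ (show 0 ≤ m by linarith)
      nlinarith
    have p1 := mul_le_mul_of_nonneg_left p0 (show 0 ≤ k * (s + 1) by positivity)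
    have p2 := mul_le_mul_of_nonneg_left q (show 0 ≤ m * y₁ by linarith)
    refine le_of_mul_le_mul_left (a := m) ?_ (by linarith)
    linarith
  have E3 : k * (s - 1) * (x₁ + x₃) ≤ (s - 1) ^ 2 * y₁ := by
    have q : k * (2 * s + k - k * s) ≤ s - 1 := by
      nlinarith [mul_nonneg hk0 (show 0 ≤ 1 / 5 + 1 / 100 - k by linarith), sq_nonneg (k - 1 / 5),
        mul_nonneg (sq_nonneg (k - 1 / 5)) (show 0 ≤ s - 1 by linarith)]
    have p0 : x₁ + x₃ ≤ (2 * s + k - k * s) * y₁ := by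
      have : m * y₁ = s * y₁ + k * y₁ := by rw [hkd]; ring
      nlinarith
    have p1 := mul_le_mul_of_nonneg_left p0 (mul_nonneg hk0 (show 0 ≤ s - 1 by linarith))
    have p2 := mul_le_mul_of_nonneg_left q (mul_nonneg (show 0 ≤ s - 1 by linarith) hy₁)
    linarith
  have E4 : 0 ≤ k * (s - 1) * (x₁ + x₃) :=
    mul_nonneg (mul_nonneg hk0 (by linarith)) (by linarith)
  rcases abs_choice (s * x₁ - x₃) with h1 | h1 <;> rcases abs_choice (x₁ - s * x₃) with h2 | h2 <;>
    rw [h1, h2] <;> nlinarith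

theorem sub_le_add_of_edge (n₁ : N (x₁, y₁) = 1) (n₃ : N.comp _root_.reflect (x₃, y₃) = 1)
    (hx₁ : 0 ≤ x₁) (hx₃ : 0 ≤ x₃) (e₁ : x₁ ≤ s * y₁)
    (e₂ : y₃ ≤ s * y₁) (r₂ : y₁ ≤ s * y₃) (e₃ : y₃ = s * x₃) :
    N (x₁ + s * x₃, y₁ - s * y₃) ≤ N (x₁ - s * x₃, y₁ + s * y₃) := by
  have hs := h.lower
  have hm := h.le
  have hk := h.k_mul_le
  have hk1 := h.k_mul_le_one
  have hkk := h.k_le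
  have my₁ := h.snd_ge n₁ hx₁ e₁
  have u₁ := h.fst_add_le n₁ hx₁ e₁
  have mx₃ : 1 ≤ m * x₃ := h.reflect.fst_ge n₃ (e₃ ▸ mul_nonneg (by linarith) hx₃) e₃.le
  subst e₃
  have hxy : x₃ ≤ y₁ := le_of_mul_le_mul_left e₂ (by linarith)
  have hxx : x₁ ≤ s * x₃ := by
    have p1 := mul_le_mul_of_nonneg_left u₁ (show 0 ≤ m by linarith)
    have p2 := mul_le_mul_of_nonneg_left my₁ (show 0 ≤ m - s by linarith)
    have p3 := mul_le_mul_of_nonneg_left mx₃ (show 0 ≤ s by linarith)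
    refine le_of_mul_le_mul_left (a := m) ?_ (by linarith)
    nlinarith
  have hs0 : 0 < s := by linarith
  have hy₁ : 0 ≤ y₁ := by linarith
  refine le_trans ?_ (h.snd_sub_le _ _)
  rw [abs_of_nonneg (show 0 ≤ y₁ + s * (s * x₃) by positivity), abs_of_nonpos
    (show x₁ - s * x₃ ≤ 0 by linarith)]
  have e : N (x₁ + s * x₃, y₁ - s * (s * x₃))
      = N.comp _root_.reflect (x₁ + s * x₃, s * (s * x₃) - y₁) := by
    rw [N.comp_reflect, ← N.neg_mk', neg_sub]
  rw [e]
  refine h.reflect.le_of_nonneg (by positivity) (by linarith) ?_ ?_ ?_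
  · have p1 := mul_le_mul_of_nonneg_left hk1 hx₃
    nlinarith
  · have p1 := mul_le_mul_of_nonneg_left hxx (show 0 ≤ 1 - (m - s) by linarith)
    have p2 := mul_le_mul_of_nonneg_left hxy (show 0 ≤ 1 + (m - s) by linarith)
    have p3 := mul_le_mul_of_nonneg_left hk (mul_nonneg hx₃ (show 0 ≤ s - 1 by linarith))
    nlinarith
  · have p1 := mul_le_mul_of_nonneg_right hxx (show 0 ≤ m - (s + 1) * (m - s) by linarith)
    have p2 := mul_le_mul_of_nonneg_right hxy (show 0 ≤ m + s + 1 by linarith)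
    have p3 := mul_le_mul_of_nonneg_left h.m_mul_le hx₃
    nlinarith

end IsEvenBasis

section Config

variable {N : Seminorm ℝ (ℝ × ℝ)} {s m x₁ y₁ x₃ y₃ : ℝ}

/-- Two unit vectors `(x₁, y₁)` and `(-x₃, y₃)` of the upper half plane for which the two larger
pairs of combinations with ratio `s` have the same norm. -/
structure IsBalanced (N : Seminorm ℝ (ℝ × ℝ)) (s x₁ y₁ x₃ y₃ : ℝ) : Prop where
  n₁ : N (x₁, y₁) = 1
  n₃ : N.comp reflect (x₃, y₃) = 1
  hx₁ : 0 ≤ x₁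
  hx₃ : 0 ≤ x₃
  det : 0 < x₁ * y₃ + x₃ * y₁
  bal : max (N (s * x₁ - x₃, s * y₁ + y₃)) (N (x₁ - s * x₃, y₁ + s * y₃)) =
    max (N (s * x₁ + x₃, s * y₁ - y₃)) (N (x₁ + s * x₃, y₁ - s * y₃))

/-- The coordinates of two consecutive vectors have ratio at most `s`. -/
structure IsSpread (s x₁ y₁ x₃ y₃ : ℝ) : Prop where
  e₁ : x₁ ≤ s * y₁
  e₂ : y₃ ≤ s * y₁
  e₃ : y₃ ≤ s * x₃
  r₁ : y₁ ≤ s * x₁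
  r₂ : y₁ ≤ s * y₃
  r₃ : x₃ ≤ s * y₃

/-- One of the two orderings of the pair `(x₁, y₁)`, `(-x₃, y₃)` is an even frame. -/
def IsGood (N : Seminorm ℝ (ℝ × ℝ)) (s x₁ y₁ x₃ y₃ : ℝ) : Prop :=
  (N (s * x₁ - x₃, s * y₁ + y₃) = N (s * x₁ + x₃, s * y₁ - y₃) ∧
    N (x₁ - s * x₃, y₁ + s * y₃) ≤ N (s * x₁ - x₃, s * y₁ + y₃) ∧
    N (x₁ + s * x₃, y₁ - s * y₃) ≤ N (s * x₁ - x₃, s * y₁ + y₃)) ∨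
  (N (x₁ - s * x₃, y₁ + s * y₃) = N (x₁ + s * x₃, y₁ - s * y₃) ∧
    N (s * x₁ - x₃, s * y₁ + y₃) ≤ N (x₁ - s * x₃, y₁ + s * y₃) ∧
    N (s * x₁ + x₃, s * y₁ - y₃) ≤ N (x₁ - s * x₃, y₁ + s * y₃))

theorem Seminorm.reflect_sub_add (N : Seminorm ℝ (ℝ × ℝ)) (a b c d : ℝ) :
    N.comp reflect (a - b, c + d) = N (b - a, d + c) := by
  rw [N.comp_reflect, neg_sub, add_comm]

theorem Seminorm.reflect_add_sub (N : Seminorm ℝ (ℝ × ℝ)) (a b c d : ℝ) :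
    N.comp reflect (a + b, c - d) = N (b + a, d - c) := by
  rw [N.comp_reflect, ← N.neg_mk', neg_sub, add_comm]

theorem Seminorm.comp_reflect_comp_reflect (N : Seminorm ℝ (ℝ × ℝ)) :
    (N.comp reflect).comp reflect = N := by
  ext ⟨x, y⟩
  rw [Seminorm.comp_reflect, Seminorm.comp_reflect, neg_neg]

theorem IsBalanced.mirror (c : IsBalanced N s x₁ y₁ x₃ y₃) :
    IsBalanced (N.comp reflect) s x₃ y₃ x₁ y₁ where
  n₁ := c.n₃
  n₃ := by rw [N.comp_reflect_comp_reflect, c.n₁]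
  hx₁ := c.hx₃
  hx₃ := c.hx₁
  det := by linarith [c.det]
  bal := by
    rw [N.reflect_sub_add, N.reflect_sub_add, N.reflect_add_sub, N.reflect_add_sub, max_comm,
      c.bal, max_comm]

theorem IsSpread.mirror (c : IsSpread s x₁ y₁ x₃ y₃) : IsSpread s x₃ y₃ x₁ y₁ :=
  ⟨c.r₃, c.r₂, c.r₁, c.e₃, c.e₂, c.e₁⟩

theorem IsGood.of_mirror (c : IsGood (N.comp reflect) s x₃ y₃ x₁ y₁) :
    IsGood N s x₁ y₁ x₃ y₃ := by
  unfold IsGood at *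
  rw [N.reflect_sub_add, N.reflect_sub_add, N.reflect_add_sub, N.reflect_add_sub] at c
  exact c.symm

namespace IsEvenBasis

theorem flat_abs (h : IsEvenBasis N s m) {x y : ℝ} (hn : N (x, y) = 1) (hy : s * |y| ≤ x) :
    m * |y| ≤ 1 ∧ 1 ≤ x + (m - s) * |y| := by
  rcases abs_choice y with h1 | h1
  · rw [h1] at hy ⊢
    have := h1 ▸ abs_nonneg y
    exact ⟨h.snd_flat hn this hy, h.fst_flat hn this hy⟩
  · rw [h1] at hy ⊢
    have h0 := h1 ▸ abs_nonneg y
    have hn' : N.comp _root_.reflect (x, -y) = 1 := by rw [N.comp_reflect, N.neg_mk, hn]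
    exact ⟨h.reflect.snd_flat hn' h0 hy, h.reflect.fst_flat hn' h0 hy⟩

theorem add_lt_sub_of_flat (h : IsEvenBasis N s m) (c : IsBalanced N s x₁ y₁ x₃ y₃)
    (e₁ : s * y₁ ≤ x₁) (r₃ : s * y₃ ≤ x₃) :
    N (s * x₁ - x₃, s * y₁ + y₃) < N (s * x₁ + x₃, s * y₁ - y₃) := by
  have hs := h.lower
  have hsu := h.upper
  have hm := h.le
  have hmu := h.m_le
  have hk := h.k_le
  have key : ∀ a b u v : ℝ, 0 ≤ a → 0 ≤ u → s * b ≤ a → s * v ≤ u → 0 < a * v + u * b →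
      s * |b| ≤ a := by
    intro a b u v ha hu hb hv hd
    rcases le_total 0 b with hb0 | hb0
    · rwa [abs_of_nonneg hb0]
    · rw [abs_of_nonpos hb0]
      have hv0 : 0 < v := by
        by_contra! hv0
        nlinarith [mul_nonneg ha (neg_nonneg.2 hv0), mul_nonneg hu (neg_nonneg.2 hb0)]
      have := mul_le_mul_of_nonneg_right hv (neg_nonneg.2 hb0)
      refine le_of_mul_le_mul_right ?_ hv0
      linarith
  have a₁ := key x₁ y₁ x₃ y₃ c.hx₁ c.hx₃ e₁ r₃ c.det
  have a₃ := key x₃ y₃ x₁ y₁ c.hx₃ c.hx₁ r₃ e₁ (by linarith [c.det])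
  obtain ⟨b₁, d₁⟩ := h.flat_abs c.n₁ a₁
  obtain ⟨b₃, d₃⟩ := h.reflect.flat_abs c.n₃ a₃
  have u₁ := h.fst_sub_le x₁ y₁
  have u₃ := h.reflect.fst_sub_le x₃ y₃
  rw [c.n₁, abs_of_nonneg c.hx₁] at u₁
  rw [c.n₃, abs_of_nonneg c.hx₃] at u₃
  have hk' : m - s ≤ 1085 / 10000 * m := by linarith
  have c₁ : (m - s) * |y₁| ≤ 1085 / 10000 := by
    have := mul_le_mul_of_nonneg_right hk' (abs_nonneg y₁); linarith
  have c₃ : (m - s) * |y₃| ≤ 1085 / 10000 := by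
    have := mul_le_mul_of_nonneg_right hk' (abs_nonneg y₃); linarith
  have hX : |s * x₁ - x₃| ≤ 101 / 100 := by
    rw [abs_le]; constructor <;> nlinarith
  have hY : ∀ t, |t| = |y₃| → |s * y₁ + t| ≤ s * |y₁| + |y₃| := fun t ht => by
    have := abs_add_le (s * y₁) t
    rwa [abs_mul, abs_of_nonneg (show 0 ≤ s by linarith), ht] at this
  have hY1 := hY y₃ rfl
  have hY2 := hY (-y₃) (abs_neg _)
  rw [← sub_eq_add_neg] at hY2
  have k0 : 0 ≤ m - s := by linarith
  have kY : (m - s) * (s * |y₁| + |y₃|) ≤ 3 / 10 := by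
    have := mul_le_mul_of_nonneg_left c₁ (show 0 ≤ s by linarith)
    linarith
  have mY : m * (s * |y₁| + |y₃|) ≤ s + 1 := by
    have := mul_le_mul_of_nonneg_left b₁ (show 0 ≤ s by linarith)
    linarith
  have Y0 : s * |y₁| + |y₃| ≤ 16 / 10 := by
    have : 0 ≤ s * |y₁| + |y₃| := by positivity
    nlinarith
  refine lt_of_le_of_lt (b := 185 / 100) (h.le_of_abs ?_ ?_ ?_)
    (lt_of_lt_of_le ?_ (h.fst_sub_le _ _))
  · have := mul_le_mul hk hX (abs_nonneg _) (by norm_num)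
    linarith
  · have := mul_le_mul_of_nonneg_left hY1 k0
    linarith
  · have p1 := mul_le_mul_of_nonneg_left hY1 (show 0 ≤ m by linarith)
    have p2 := mul_le_mul hmu hX (abs_nonneg _) (by norm_num)
    linarith
  · have p1 := mul_le_mul_of_nonneg_left hY2 k0
    have p2 := le_abs_self (s * x₁ + x₃)
    have p3 : 1707 / 1000 * (8915 / 10000) ≤ s * x₁ :=
      mul_le_mul hs (by linarith) (by norm_num) (by linarith)
    linarith

theorem sub_lt_add_of_steep (h : IsEvenBasis N s m) (c : IsBalanced N s x₁ y₁ x₃ y₃)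
    (r₁ : s * x₁ ≤ y₁) (e₃ : s * x₃ ≤ y₃) :
    N (s * x₁ + x₃, s * y₁ - y₃) < N (s * x₁ - x₃, s * y₁ + y₃) := by
  have hs := h.lower
  have hsu := h.upper
  have hm := h.le
  have hmu := h.m_le
  have hk := h.k_le
  have k0 : 0 ≤ m - s := by linarith
  have key : ∀ {N : Seminorm ℝ (ℝ × ℝ)}, IsEvenBasis N s m → ∀ x y : ℝ, 0 ≤ x → s * x ≤ y →
      N (x, y) = 1 → x ≤ 668 / 1000 ∧ 89 / 100 ≤ y ∧ y ≤ 114 / 100 := by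
    intro N h x y hx hxy hn
    have p1 := h.snd_steep hn hx hxy
    have p2 := h.snd_sub_le x y
    have y0 : 0 ≤ y := le_trans (mul_nonneg (by linarith) hx) hxy
    rw [hn, abs_of_nonneg y0, abs_of_nonneg hx] at p2
    have p3 := mul_le_mul_of_nonneg_right hk hx
    have hx1 : x ≤ 668 / 1000 := by nlinarith
    refine ⟨hx1, by nlinarith, by linarith⟩
  obtain ⟨a₁, b₁, d₁⟩ := key h x₁ y₁ c.hx₁ r₁ c.n₁
  obtain ⟨a₃, b₃, d₃⟩ := key h.reflect x₃ y₃ c.hx₃ e₃ c.n₃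
  have hx₁ := c.hx₁
  have hx₃ := c.hx₃
  have sx₁ : s * x₁ ≤ 17072 / 10000 * (668 / 1000) := mul_le_mul hsu a₁ hx₁ (by norm_num)
  have sx0 : 0 ≤ s * x₁ := mul_nonneg (by linarith) hx₁
  have sy₁ : s * y₁ ≤ 17072 / 10000 * (114 / 100) :=
    mul_le_mul hsu d₁ (by linarith) (by norm_num)
  have sy₁' : 1707 / 1000 * (89 / 100) ≤ s * y₁ :=
    mul_le_mul hs b₁ (by norm_num) (by linarith)
  have hX : |s * x₁ + x₃| ≤ 181 / 100 := by rw [abs_of_nonneg (by linarith)]; linarith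
  have hX' : |s * x₁ - x₃| ≤ 115 / 100 := by rw [abs_le]; constructor <;> linarith
  have hY : |s * y₁ - y₃| ≤ 107 / 100 := by rw [abs_le]; constructor <;> linarith
  refine lt_of_le_of_lt (b := 21 / 10) (h.le_of_abs ?_ ?_ ?_)
    (lt_of_lt_of_le ?_ (h.snd_sub_le _ _))
  · have := mul_le_mul hk hX (abs_nonneg _) (by norm_num)
    linarith
  · have := mul_le_mul hk hY (abs_nonneg _) (by norm_num)
    linarith
  · have := mul_le_mul hmu (add_le_add hX hY) (by positivity) (by norm_num)
    linarith
  · have p1 := mul_le_mul hk hX' (abs_nonneg _) (by norm_num)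
    have p2 := le_abs_self (s * y₁ + y₃)
    linarith

theorem not_flat_flat (h : IsEvenBasis N s m) (c : IsBalanced N s x₁ y₁ x₃ y₃)
    (e₁ : s * y₁ ≤ x₁) (r₃ : s * y₃ ≤ x₃) : False := by
  have p1 := h.add_lt_sub_of_flat c e₁ r₃
  have p2 := h.reflect.add_lt_sub_of_flat c.mirror r₃ e₁
  rw [N.reflect_sub_add, N.reflect_add_sub] at p2
  exact (max_lt_max p1 p2).ne c.bal

theorem not_steep_steep (h : IsEvenBasis N s m) (c : IsBalanced N s x₁ y₁ x₃ y₃)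
    (r₁ : s * x₁ ≤ y₁) (e₃ : s * x₃ ≤ y₃) : False := by
  have p1 := h.sub_lt_add_of_steep c r₁ e₃
  have p2 := h.reflect.sub_lt_add_of_steep c.mirror e₃ r₁
  rw [N.reflect_sub_add, N.reflect_add_sub] at p2
  exact (max_lt_max p1 p2).ne' c.bal

theorem not_flat_of_snd (h : IsEvenBasis N s m) (c : IsBalanced N s x₁ y₁ x₃ y₃)
    (e₁ : s * y₁ ≤ x₁) (r₂ : s * y₃ ≤ y₁) : False := by
  have hs := h.lower
  refine h.not_flat_flat c e₁ ?_
  by_contra! hlt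
  have hx₃ := c.hx₃
  have y0 : 0 < y₃ := pos_of_mul_pos_right (hx₃.trans_lt hlt) (by linarith)
  have p1 := h.reflect.snd_ge c.n₃ hx₃ hlt.le
  have p2 := h.snd_flat c.n₁ (by nlinarith) e₁
  nlinarith [h.le, mul_le_mul_of_nonneg_left r₂ (show 0 ≤ m by linarith [h.le])]

theorem not_steep_of_snd (h : IsEvenBasis N s m) (c : IsBalanced N s x₁ y₁ x₃ y₃)
    (e₂ : s * y₁ ≤ y₃) (r₁ : s * x₁ ≤ y₁) : False := by
  have hs := h.lower
  have hm := h.le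
  have p1 := h.snd_steep c.n₁ c.hx₁ r₁
  have p2 := h.reflect.snd_sub_le x₃ y₃
  have p3 := h.reflect.fst_sub_le x₃ y₃
  have y0 : 0 ≤ y₁ := le_trans (mul_nonneg (by linarith) c.hx₁) r₁
  have y3 : 0 ≤ y₃ := le_trans (mul_nonneg (by linarith) y0) e₂
  rw [c.n₃, abs_of_nonneg c.hx₃, abs_of_nonneg y3] at p2 p3
  have p4 := mul_le_mul_of_nonneg_right h.k_le c.hx₃
  have p5 := mul_le_mul_of_nonneg_right h.k_le y3
  have p6 := mul_le_mul_of_nonneg_right h.m_le y0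
  have p7 := mul_le_mul_of_nonneg_right hs y0
  linarith

theorem not_corner (h : IsEvenBasis N s m) (c : IsBalanced N s x₁ y₁ x₃ y₃)
    (e : s * y₁ ≤ x₁ ∨ s * y₁ ≤ y₃ ∨ s * x₃ ≤ y₃)
    (r : s * x₁ ≤ y₁ ∨ s * y₃ ≤ y₁ ∨ s * y₃ ≤ x₃) : False := by
  have hs := h.lower
  have key' : ∀ x y : ℝ, s * y ≤ x → s * x ≤ y → x ≤ 0 := by
    intro x y h1 h2
    by_contra! hx
    have h3 := mul_le_mul_of_nonneg_right hs hx.le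
    have h4 := mul_le_mul_of_nonneg_right hs (show 0 ≤ y by linarith)
    linarith
  have key : ∀ x y : ℝ, s * y ≤ x → s * x ≤ y → x ≤ 0 ∧ y ≤ 0 :=
    fun x y h1 h2 => ⟨key' x y h1 h2, key' y x h2 h1⟩
  have det := c.det
  have hx₁ := c.hx₁
  have hx₃ := c.hx₃
  rcases e with e | e | e <;> rcases r with r | r | r
  · obtain ⟨h1, h2⟩ := key _ _ e r
    have : x₁ = 0 := le_antisymm h1 hx₁
    subst this
    nlinarith
  · exact h.not_flat_of_snd c e r
  · exact h.not_flat_flat c e r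
  · exact h.not_steep_of_snd c e r
  · obtain ⟨h1, h2⟩ := key _ _ e r
    nlinarith
  · exact h.reflect.not_flat_of_snd c.mirror r e
  · exact h.not_steep_steep c r e
  · exact h.reflect.not_steep_of_snd c.mirror r e
  · obtain ⟨h1, h2⟩ := key _ _ r e
    have : x₃ = 0 := le_antisymm h1 hx₃
    subst this
    nlinarith

theorem isGood_of_edge (h : IsEvenBasis N s m) (c : IsBalanced N s x₁ y₁ x₃ y₃)
    (d : IsSpread s x₁ y₁ x₃ y₃)
    (hp : N (x₁ - s * x₃, y₁ + s * y₃) ≤ N (s * x₁ - x₃, s * y₁ + y₃))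
    (hm : N (s * x₁ + x₃, s * y₁ - y₃) ≤ N (x₁ + s * x₃, y₁ - s * y₃))
    (e : s * y₁ ≤ x₁ ∨ s * y₁ ≤ y₃ ∨ s * x₃ ≤ y₃) : IsGood N s x₁ y₁ x₃ y₃ := by
  have hs := h.lower
  have hy₁ : 0 ≤ y₁ := nonneg_of_mul_nonneg_right (c.hx₁.trans d.e₁) (by linarith)
  have hy₃ : 0 ≤ y₃ := nonneg_of_mul_nonneg_right (c.hx₃.trans d.r₃) (by linarith)
  have bal := c.bal
  rw [max_eq_left hp, max_eq_right hm] at bal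
  rcases e with e | e | e
  · have := h.add_le_sub_of_edge c.n₁ c.n₃ hy₁ hy₃ (le_antisymm d.e₁ e) d.e₂ d.e₃ d.r₃
    exact Or.inl ⟨by linarith, hp, bal.ge⟩
  · have := h.add_le_add_of_edge c.n₁ c.n₃ c.hx₁ hy₁ c.hx₃ d.e₁ d.r₁ (le_antisymm d.e₂ e)
      d.e₃ d.r₃
    exact Or.inr ⟨by linarith, this, by linarith⟩
  · have := h.sub_le_add_of_edge c.n₁ c.n₃ c.hx₁ c.hx₃ d.e₁ d.e₂ d.r₂ (le_antisymm d.e₃ e)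
    exact Or.inr ⟨by linarith, by linarith, by linarith⟩

end IsEvenBasis

end Config

section Path

variable {N : Seminorm ℝ (ℝ × ℝ)} {s m x₁ y₁ x₃ y₃ : ℝ}

theorem unitVec_zero (h : N (1, 0) = 1) : unitVec N 0 = (1, 0) := by
  simp [unitVec, dir, h]

theorem unitVec_pi_div_two (h : N (0, 1) = 1) : unitVec N (Real.pi / 2) = (0, 1) := by
  simp [unitVec, dir, h]

theorem unitVec_pi (h : N (1, 0) = 1) : unitVec N Real.pi = (-1, 0) := by
  rw [← zero_add Real.pi, unitVec_add_pi, unitVec_zero h]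
  simp

theorem isGood_of_le (c : IsBalanced N s x₁ y₁ x₃ y₃)
    (h : (N (x₁ - s * x₃, y₁ + s * y₃) ≤ N (s * x₁ - x₃, s * y₁ + y₃) ∧
        N (x₁ + s * x₃, y₁ - s * y₃) ≤ N (s * x₁ + x₃, s * y₁ - y₃)) ∨
      (N (s * x₁ - x₃, s * y₁ + y₃) ≤ N (x₁ - s * x₃, y₁ + s * y₃) ∧
        N (s * x₁ + x₃, s * y₁ - y₃) ≤ N (x₁ + s * x₃, y₁ - s * y₃))) :
    IsGood N s x₁ y₁ x₃ y₃ := by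
  have bal := c.bal
  rcases h with ⟨h1, h2⟩ | ⟨h1, h2⟩
  · rw [max_eq_left h1, max_eq_left h2] at bal
    exact Or.inl ⟨bal, h1, bal ▸ h2⟩
  · rw [max_eq_right h1, max_eq_right h2] at bal
    exact Or.inr ⟨bal, h1, bal ▸ h2⟩

/-- Along a path of balanced pairs that starts with a flat first vector and ends with a flat
second vector, some pair is both spread and good. -/
theorem IsEvenBasis.exists_isGood_of_path (h : IsEvenBasis N s m) {x₁ y₁ x₃ y₃ : ℝ → ℝ} {a b : ℝ}
    (hab : a ≤ b) (cx₁ : Continuous x₁) (cy₁ : Continuous y₁) (cx₃ : Continuous x₃)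
    (cy₃ : Continuous y₃)
    (bal : ∀ σ ∈ Icc a b, IsBalanced N s (x₁ σ) (y₁ σ) (x₃ σ) (y₃ σ))
    (ha : s * y₁ a ≤ x₁ a) (hb : s * y₃ b ≤ x₃ b) :
    ∃ σ, IsBalanced N s (x₁ σ) (y₁ σ) (x₃ σ) (y₃ σ) ∧ IsSpread s (x₁ σ) (y₁ σ) (x₃ σ) (y₃ σ) ∧
      IsGood N s (x₁ σ) (y₁ σ) (x₃ σ) (y₃ σ) := by
  by_contra! hne'
  have hne := fun σ hσ => hne' σ (bal σ hσ)
  have hNc := N.continuous_prod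
  have cE : ∀ f g : ℝ → ℝ, Continuous f → Continuous g → Continuous fun σ => N (f σ, g σ) := by
    intro f g hf hg
    fun_prop
  have cAp := cE (fun σ => s * x₁ σ - x₃ σ) (fun σ => s * y₁ σ + y₃ σ) (by fun_prop) (by fun_prop)
  have cAm := cE (fun σ => s * x₁ σ + x₃ σ) (fun σ => s * y₁ σ - y₃ σ) (by fun_prop) (by fun_prop)
  have cBp := cE (fun σ => x₁ σ - s * x₃ σ) (fun σ => y₁ σ + s * y₃ σ) (by fun_prop) (by fun_prop)
  have cBm := cE (fun σ => x₁ σ + s * x₃ σ) (fun σ => y₁ σ - s * y₃ σ) (by fun_prop) (by fun_prop)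
  let E : Set ℝ := {σ | s * y₁ σ ≤ x₁ σ} ∪ ({σ | s * y₁ σ ≤ y₃ σ} ∪ {σ | s * x₃ σ ≤ y₃ σ})
  let R : Set ℝ := {σ | s * x₁ σ ≤ y₁ σ} ∪ ({σ | s * y₃ σ ≤ y₁ σ} ∪ {σ | s * y₃ σ ≤ x₃ σ})
  have cl : ∀ f g : ℝ → ℝ, Continuous f → Continuous g → IsClosed {σ | f σ ≤ g σ} :=
    fun f g => isClosed_le
  have hE : IsClosed E := (cl _ _ (by fun_prop) cx₁).union
    ((cl _ _ (by fun_prop) cy₃).union (cl _ _ (by fun_prop) cy₃))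
  have hR : IsClosed R := (cl _ _ (by fun_prop) cy₁).union
    ((cl _ _ (by fun_prop) cy₁).union (cl _ _ (by fun_prop) cx₃))
  let O : Set ℝ := {σ | IsSpread s (x₁ σ) (y₁ σ) (x₃ σ) (y₃ σ)}
  have hO : IsClosed O := by
    have : O = {σ | x₁ σ ≤ s * y₁ σ} ∩ ({σ | y₃ σ ≤ s * y₁ σ} ∩ ({σ | y₃ σ ≤ s * x₃ σ} ∩
        ({σ | y₁ σ ≤ s * x₁ σ} ∩ ({σ | y₁ σ ≤ s * y₃ σ} ∩ {σ | x₃ σ ≤ s * y₃ σ})))) := by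
      ext σ
      exact ⟨fun h => ⟨h.e₁, h.e₂, h.e₃, h.r₁, h.r₂, h.r₃⟩,
        fun h => ⟨h.1, h.2.1, h.2.2.1, h.2.2.2.1, h.2.2.2.2.1, h.2.2.2.2.2⟩⟩
    rw [this]
    exact (cl _ _ cx₁ (by fun_prop)).inter <| (cl _ _ cy₃ (by fun_prop)).inter <|
      (cl _ _ cy₃ (by fun_prop)).inter <| (cl _ _ cy₁ (by fun_prop)).inter <|
      (cl _ _ cy₁ (by fun_prop)).inter (cl _ _ cx₃ (by fun_prop))
  let U : Set ℝ := {σ | N (s * x₁ σ - x₃ σ, s * y₁ σ + y₃ σ) ≤ N (x₁ σ - s * x₃ σ, y₁ σ + s * y₃ σ)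
    ∧ N (x₁ σ + s * x₃ σ, y₁ σ - s * y₃ σ) ≤ N (s * x₁ σ + x₃ σ, s * y₁ σ - y₃ σ)}
  let V : Set ℝ := {σ | N (x₁ σ - s * x₃ σ, y₁ σ + s * y₃ σ) ≤ N (s * x₁ σ - x₃ σ, s * y₁ σ + y₃ σ)
    ∧ N (s * x₁ σ + x₃ σ, s * y₁ σ - y₃ σ) ≤ N (x₁ σ + s * x₃ σ, y₁ σ - s * y₃ σ)}
  have hU : IsClosed U := (cl _ _ cAp cBp).inter (cl _ _ cBm cAm)
  have hV : IsClosed V := (cl _ _ cBp cAp).inter (cl _ _ cAm cBm)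
  obtain ⟨σ, hσ, hl, hr⟩ := isPreconnected_closed_iff.1 (isPreconnected_Icc (a := a) (b := b))
    (E ∪ (O ∩ U)) (R ∪ (O ∩ V)) (hE.union (hO.inter hU)) (hR.union (hO.inter hV)) (by
      intro σ hσ
      by_cases hσE : σ ∈ E
      · exact Or.inl (Or.inl hσE)
      by_cases hσR : σ ∈ R
      · exact Or.inr (Or.inl hσR)
      simp only [E, R, mem_union, mem_ofPred_eq, not_or, not_le] at hσE hσR
      have hs : IsSpread s (x₁ σ) (y₁ σ) (x₃ σ) (y₃ σ) :=
        ⟨hσE.1.le, hσE.2.1.le, hσE.2.2.le, hσR.1.le, hσR.2.1.le, hσR.2.2.le⟩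
      have hg := fun hle => hne σ hσ hs (isGood_of_le (bal σ hσ) hle)
      rcases le_total (N (s * x₁ σ - x₃ σ, s * y₁ σ + y₃ σ))
          (N (x₁ σ - s * x₃ σ, y₁ σ + s * y₃ σ)) with h1 | h1 <;>
        rcases le_total (N (x₁ σ + s * x₃ σ, y₁ σ - s * y₃ σ))
          (N (s * x₁ σ + x₃ σ, s * y₁ σ - y₃ σ)) with h2 | h2
      · exact Or.inl (Or.inr ⟨hs, h1, h2⟩)
      · exact (hg (Or.inr ⟨h1, h2⟩)).elim
      · exact (hg (Or.inl ⟨h1, h2⟩)).elim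
      · exact Or.inr (Or.inr ⟨hs, h1, h2⟩))
    ⟨a, left_mem_Icc.2 hab, Or.inl (Or.inl ha)⟩
    ⟨b, right_mem_Icc.2 hab, Or.inl (Or.inr (Or.inr hb))⟩
  have c := bal σ hσ
  rcases hl with hl | ⟨hs, hl⟩ <;> rcases hr with hr | ⟨hs', hr⟩
  · exact h.not_corner c hl hr
  · exact hne σ hσ hs' (h.isGood_of_edge c hs' hr.1 hr.2 hl)
  · refine hne σ hσ hs (IsGood.of_mirror (h.reflect.isGood_of_edge c.mirror hs.mirror ?_ ?_ ?_))
    · rw [N.reflect_sub_add, N.reflect_sub_add]; exact hl.1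
    · rw [N.reflect_add_sub, N.reflect_add_sub]; exact hl.2
    · rcases hr with hr | hr | hr
      exacts [Or.inr (Or.inr hr), Or.inr (Or.inl hr), Or.inl hr]
  · exact hne σ hσ hs (isGood_of_le c (Or.inl ⟨hr.1, hl.2⟩))

theorem IsEvenBasis.exists_isGood (hN : ∀ z, N z = 0 → z = 0) (h : IsEvenBasis N s m) :
    ∃ x₁ y₁ x₃ y₃, IsBalanced N s x₁ y₁ x₃ y₃ ∧ IsSpread s x₁ y₁ x₃ y₃ ∧
      IsGood N s x₁ y₁ x₃ y₃ := by
  have pp := Real.pi_pos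
  have hs := h.lower
  have hue := unitVec_continuous hN
  have hNc := N.continuous_prod
  let f : ℝ → ℝ → ℝ := fun θ φ =>
    max (N (s • unitVec N θ + (1 : ℝ) • unitVec N φ)) (N ((1 : ℝ) • unitVec N θ + s • unitVec N φ))
    - max (N (s • unitVec N θ - (1 : ℝ) • unitVec N φ))
      (N ((1 : ℝ) • unitVec N θ - s • unitVec N φ))
  have hfc : Continuous (Function.uncurry f) := by
    unfold f Function.uncurry
    fun_prop
  have mono : ∀ θ θ' φ φ', θ ≤ θ' → θ' ≤ φ' → φ' ≤ φ → φ ≤ θ + Real.pi → f θ φ ≤ f θ' φ' :=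
    fun θ θ' φ φ' i1 i2 i3 i4 => sub_le_sub
      (max_le_max (norm_add_mono hN (by linarith) zero_le_one i1 i2 i3 i4)
        (norm_add_mono hN zero_le_one (by linarith) i1 i2 i3 i4))
      (max_le_max (norm_sub_mono hN (by linarith) zero_le_one i1 i2 i3 i4)
        (norm_sub_mono hN zero_le_one (by linarith) i1 i2 i3 i4))
  have n1 : ∀ θ, N (s • unitVec N θ + (1 : ℝ) • unitVec N θ) = s + 1 := fun θ => by
    rw [← add_smul, N.map_smul_of_nonneg' (by linarith), norm_unitVec hN, mul_one]
  have n2 : ∀ θ, N ((1 : ℝ) • unitVec N θ + s • unitVec N θ) = s + 1 := fun θ => by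
    rw [add_comm, n1]
  have n3 : ∀ θ, N (s • unitVec N θ - (1 : ℝ) • unitVec N θ) = s - 1 := fun θ => by
    rw [← sub_smul, N.map_smul_of_nonneg' (by linarith), norm_unitVec hN, mul_one]
  have n4 : ∀ θ, N ((1 : ℝ) • unitVec N θ - s • unitVec N θ) = s - 1 := fun θ => by
    rw [← map_neg_eq_map, neg_sub, n3]
  obtain ⟨Θ, Φ, cΘ, cΦ, mΘ, mΦ, i1, i2, hz, -, -, hlow⟩ := exists_zero_path hfc mono
    (fun θ => by
      simp only [f, n1, n2, n3, n4, max_self]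
      linarith)
    (fun θ => by
      simp only [f, unitVec_add_pi, smul_neg, sub_neg_eq_add, ← sub_eq_add_neg, n1, n2, n3, n4,
        max_self]
      linarith)
    (fun θ φ => by
      have e : ∀ a b : ℝ, N (a • unitVec N (θ + Real.pi) + b • unitVec N (φ + Real.pi)) =
          N (a • unitVec N θ + b • unitVec N φ) := fun a b => by
        rw [unitVec_add_pi, unitVec_add_pi, smul_neg, smul_neg, ← neg_add, map_neg_eq_map]
      have e' : ∀ a b : ℝ, N (a • unitVec N (θ + Real.pi) - b • unitVec N (φ + Real.pi)) =
          N (a • unitVec N θ - b • unitVec N φ) := fun a b => by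
        rw [unitVec_add_pi, unitVec_add_pi, smul_neg, smul_neg, neg_sub_neg,
          ← map_neg_eq_map N, neg_sub]
      simp only [f, e, e'])
  have u0 := unitVec_zero h.fst
  have u1 := unitVec_pi_div_two h.snd
  have u2 := unitVec_pi h.fst
  obtain ⟨l1, l2⟩ := hlow 0 (Real.pi / 2) (by linarith) (by linarith) (by
    simp [f, u0, u1, h.add, h.sub, h.add_le, h.sub_le])
  obtain ⟨l3, l4⟩ := hlow (Real.pi / 2) Real.pi (by linarith) (by linarith) (by
    have e1 : N (-s, 1) = m := by rw [← N.neg_mk', h.sub]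
    have e2 : N (-1, s) ≤ m := by rw [← N.neg_mk']; exact h.sub_le
    simp [f, u1, u2, e1, e2, h.add, h.add_le])
  have pos := fun θ => norm_dir_pos hN θ
  rw [zero_add] at l1 l2
  obtain ⟨σ, hσ⟩ := h.exists_isGood_of_path (a := Real.pi / 2) (b := Real.pi / 2 + Real.pi)
    (x₁ := fun σ => (unitVec N (Θ σ)).1) (y₁ := fun σ => (unitVec N (Θ σ)).2)
    (x₃ := fun σ => -(unitVec N (Φ σ)).1) (y₃ := fun σ => (unitVec N (Φ σ)).2)
    (by linarith) (hue.comp cΘ).fst (hue.comp cΘ).snd (hue.comp cΦ).fst.neg (hue.comp cΦ).snd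
    (fun σ hσ => by
      have t1 : Θ σ ≤ Real.pi / 2 := (mΘ hσ.2).trans l3
      have t2 : Real.pi / 2 ≤ Φ σ := l2.trans (mΦ hσ.1)
      have t3 := i1 σ
      have t4 := i2 σ
      refine ⟨norm_unitVec hN _, ?_, ?_, ?_, ?_, ?_⟩
      · rw [N.comp_reflect, neg_neg]; exact norm_unitVec hN _
      · exact mul_nonneg (inv_nonneg.2 (pos _).le)
          (Real.cos_nonneg_of_neg_pi_div_two_le_of_le (by linarith) t1)
      · exact neg_nonneg.2 (mul_nonpos_of_nonneg_of_nonpos (inv_nonneg.2 (pos _).le)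
          (Real.cos_nonpos_of_pi_div_two_le_of_le t2 (by linarith)))
      · have := cross_unitVec_pos hN t3 t4
        simp only [cross] at this
        linarith
      · have := sub_eq_zero.1 (hz σ)
        simp only [one_smul] at this
        rw [← Prod.mk.eta (p := unitVec N (Θ σ)), ← Prod.mk.eta (p := unitVec N (Φ σ))] at this
        simpa only [Prod.smul_mk, Prod.mk_add_mk, Prod.mk_sub_mk, smul_eq_mul, mul_neg,
          sub_neg_eq_add, ← sub_eq_add_neg] using this)
    (by
      have t3 := i1 (Real.pi / 2)
      have t4 := i2 (Real.pi / 2)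
      have h1 : (unitVec N (Θ (Real.pi / 2))).2 ≤ 0 :=
        mul_nonpos_of_nonneg_of_nonpos (inv_nonneg.2 (pos _).le)
          (Real.sin_nonpos_of_nonpos_of_neg_pi_le l1 (by linarith))
      have h2 : 0 ≤ (unitVec N (Θ (Real.pi / 2))).1 :=
        mul_nonneg (inv_nonneg.2 (pos _).le)
          (Real.cos_nonneg_of_neg_pi_div_two_le_of_le (by linarith) (by linarith))
      exact (mul_nonpos_of_nonneg_of_nonpos (by linarith) h1).trans h2)
    (by
      have t3 := i1 (Real.pi / 2 + Real.pi)
      have t4 := i2 (Real.pi / 2 + Real.pi)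
      obtain ⟨b, hb⟩ : ∃ b, b = Φ (Real.pi / 2 + Real.pi) := ⟨_, rfl⟩
      rw [← hb] at l4 t3 t4 ⊢
      have h1 : (unitVec N b).2 ≤ 0 := by
        refine mul_nonpos_of_nonneg_of_nonpos (inv_nonneg.2 (pos _).le) ?_
        have := Real.sin_nonneg_of_nonneg_of_le_pi (x := b - Real.pi) (by linarith) (by linarith)
        rw [Real.sin_sub_pi] at this
        exact neg_nonneg.1 this
      have h2 : (unitVec N b).1 ≤ 0 :=
        mul_nonpos_of_nonneg_of_nonpos (inv_nonneg.2 (pos _).le)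
          (Real.cos_nonpos_of_pi_div_two_le_of_le (by linarith) (by linarith))
      exact (mul_nonpos_of_nonneg_of_nonpos (by linarith) h1).trans (neg_nonneg.2 h2))
  exact ⟨_, _, _, _, hσ⟩

end Path

section Main

variable {N : Seminorm ℝ (ℝ × ℝ)} {s m : ℝ}

theorem mul_add_le_two_mul {a b c d : ℝ} (ha : 0 ≤ a) (hc : 0 ≤ c) (hd : 0 ≤ d)
    (h1 : d + a ≤ b + c) (h2 : c + d ≤ a + b) : (d + a) * (c + d) ≤ 2 * (a * c + b * d) := by
  rcases le_total c a with h | h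
  · have p1 := mul_le_mul_of_nonneg_right h1 hd
    have p2 := mul_nonneg (sub_nonneg.2 h) (add_nonneg hc hd)
    nlinarith [sq_nonneg (d - c)]
  · have p1 := mul_le_mul_of_nonneg_right h2 hd
    have p2 := mul_nonneg (sub_nonneg.2 h) (add_nonneg ha hd)
    nlinarith [sq_nonneg (d - a)]

theorem one_le_of_add_bounds {a b c d t : ℝ} (ha : 0 ≤ a) (hb : 0 ≤ b) (hc : 0 ≤ c) (hd : 0 ≤ d)
    (hD : 0 < a * c + b * d) (h1 : a * c + b * d ≤ t * (b + c)) (h2 : a * c + b * d ≤ t * (d + a))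
    (h3 : 1 ≤ t * (a + b)) (h4 : 1 ≤ t * (c + d)) : 1 ≤ 2 * t ^ 2 := by
  have key : ∀ u v : ℝ, u * v ≤ 2 * (a * c + b * d) → a * c + b * d ≤ t * u → 1 ≤ t * v →
      1 ≤ 2 * t ^ 2 := by
    intro u v huv hu hv
    have := mul_le_mul hu hv zero_le_one (hD.le.trans hu)
    have := mul_le_mul_of_nonneg_left huv (sq_nonneg t)
    refine le_of_mul_le_mul_right ?_ hD
    linarith
  rcases le_total (d + a) (b + c) with i | i <;> rcases le_total (c + d) (a + b) with j | j
  · exact key _ _ (mul_add_le_two_mul ha hc hd i j) h2 h4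
  · refine key _ _ ?_ h2 h3
    have := mul_add_le_two_mul (a := d) (b := c) (c := b) (d := a) hd hb ha (by linarith)
      (by linarith)
    linarith
  · refine key _ _ ?_ h1 h4
    have := mul_add_le_two_mul (a := b) (b := a) (c := d) (d := c) hb hd hc (by linarith)
      (by linarith)
    linarith
  · refine key _ _ ?_ h1 h3
    have := mul_add_le_two_mul (a := c) (b := d) (c := a) (d := b) hc ha hb (by linarith)
      (by linarith)
    linarith

theorem IsEvenBasis.le_of_isSpread (h : IsEvenBasis N s m) (hs : 2 * (s - 1) ^ 2 < 1)
    {x₁ y₁ x₃ y₃ M : ℝ} (c : IsBalanced N s x₁ y₁ x₃ y₃) (d : IsSpread s x₁ y₁ x₃ y₃)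
    (h1 : N (s * x₁ - x₃, s * y₁ + y₃) ≤ M) (h2 : N (s * x₁ + x₃, s * y₁ - y₃) ≤ M)
    (h3 : N (x₁ - s * x₃, y₁ + s * y₃) ≤ M) (h4 : N (x₁ + s * x₃, y₁ - s * y₃) ≤ M) :
    s ^ 2 - 1 ≤ M := by
  by_contra! hM
  have hsl := h.lower
  have hm := h.le
  have hx₁ := c.hx₁
  have hx₃ := c.hx₃
  have hy₁ : 0 ≤ y₁ := nonneg_of_mul_nonneg_right (hx₁.trans d.e₁) (by linarith)
  have hy₃ : 0 ≤ y₃ := nonneg_of_mul_nonneg_right (hx₃.trans d.r₃) (by linarith)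
  have det := c.det
  have hc : 0 < s ^ 2 - 1 := by nlinarith
  have ratio : ∀ {N : Seminorm ℝ (ℝ × ℝ)}, IsEvenBasis N s m → ∀ x y x' : ℝ, 0 ≤ x → x ≤ s * y →
      N (x, y) = 1 → 1 ≤ m * x' → x ≤ s * x' := by
    intro N h x y x' hx hxy hn hx'
    have p1 := h.fst_add_le hn hx hxy
    have p2 := h.snd_ge hn hx hxy
    have p3 := mul_le_mul_of_nonneg_left p1 (show 0 ≤ m by linarith)
    have p4 := mul_le_mul_of_nonneg_left p2 (show 0 ≤ m - s by linarith)
    have p5 := mul_le_mul_of_nonneg_left hx' (show 0 ≤ s by linarith)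
    refine le_of_mul_le_mul_left (a := m) ?_ (by linarith)
    linarith
  have t1 := ratio h x₁ y₁ x₃ hx₁ d.e₁ c.n₁ (h.reflect.fst_ge c.n₃ hy₃ d.e₃)
  have t3 := ratio h.reflect x₃ y₃ x₁ hx₃ d.r₃ c.n₃ (h.fst_ge c.n₁ hy₁ d.r₁)
  have comb : ∀ u v A B : ℝ, A ≤ s ^ 2 - 1 → B ≤ s ^ 2 - 1 → u ≤ s * v → v ≤ s * u →
      (s * v - u) / (s ^ 2 - 1) * A + (s * u - v) / (s ^ 2 - 1) * B ≤ (s - 1) * (u + v) := by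
    intro u v A B hA hB hu hv
    have q1 := mul_le_mul_of_nonneg_left hA
      (div_nonneg (sub_nonneg.2 hu) hc.le : 0 ≤ (s * v - u) / (s ^ 2 - 1))
    have q2 := mul_le_mul_of_nonneg_left hB
      (div_nonneg (sub_nonneg.2 hv) hc.le : 0 ≤ (s * u - v) / (s ^ 2 - 1))
    rw [div_mul_cancel₀ _ hc.ne'] at q1 q2
    linarith
  have D1 : x₁ * y₃ + x₃ * y₁ ≤ (s - 1) * (x₁ + x₃) := by
    have e : N (0, x₁ * y₃ + x₃ * y₁) = x₁ * y₃ + x₃ * y₁ := by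
      have : ((0, x₁ * y₃ + x₃ * y₁) : ℝ × ℝ) = (x₁ * y₃ + x₃ * y₁) • (0, (1 : ℝ)) := by simp
      rw [this, N.map_smul_of_nonneg' det.le, h.snd, mul_one]
    rw [← e]
    refine (N.mk_le_of_comb (x₁ := s * x₁ - x₃) (y₁ := s * y₁ + y₃) (x₂ := x₁ - s * x₃)
      (y₂ := y₁ + s * y₃) (div_nonneg (sub_nonneg.2 t1) hc.le) (div_nonneg (sub_nonneg.2 t3) hc.le)
      ?_ ?_).trans (comb _ _ _ _ (h1.trans hM.le) (h3.trans hM.le) t1 t3)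
    · field_simp; ring
    · field_simp; ring
  have D2 : x₁ * y₃ + x₃ * y₁ ≤ (s - 1) * (y₁ + y₃) := by
    have e : N (x₁ * y₃ + x₃ * y₁, 0) = x₁ * y₃ + x₃ * y₁ := by
      have : ((x₁ * y₃ + x₃ * y₁, 0) : ℝ × ℝ) = (x₁ * y₃ + x₃ * y₁) • ((1 : ℝ), 0) := by simp
      rw [this, N.map_smul_of_nonneg' det.le, h.fst, mul_one]
    rw [← e]
    refine (N.mk_le_of_comb (x₁ := s * x₁ + x₃) (y₁ := s * y₁ - y₃) (x₂ := x₁ + s * x₃)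
      (y₂ := y₁ - s * y₃) (div_nonneg (sub_nonneg.2 d.r₂) hc.le)
      (div_nonneg (sub_nonneg.2 d.e₂) hc.le)
      ?_ ?_).trans (comb _ _ _ _ (h2.trans hM.le) (h4.trans hM.le) d.r₂ d.e₂)
    · field_simp; ring
    · field_simp; ring
  have sum : ∀ x y : ℝ, 0 ≤ x → 0 ≤ y → s + 1 ≤ m * (x + y) → 1 ≤ (s - 1) * (x + y) := by
    intro x y hx hy hxy
    have := mul_le_mul_of_nonneg_right h.le_sq (add_nonneg hx hy)
    refine le_of_mul_le_mul_left (a := s + 1) ?_ (by linarith)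
    linarith
  have s1 := sum _ _ hx₁ hy₁ (h.add_ge c.n₁ d.e₁ d.r₁)
  have s3 := sum _ _ hx₃ hy₃ (h.reflect.add_ge c.n₃ d.r₃ d.e₃)
  have := one_le_of_add_bounds (a := y₁) (b := x₁) (c := x₃) (d := y₃) (t := s - 1) hy₁ hx₁ hx₃ hy₃
    (by linarith) (by linarith) (by linarith) (by linarith) s3
  linarith

theorem IsEvenBasis.hasTriple (hN : ∀ z, N z = 0 → z = 0) (h : IsEvenBasis N s m)
    (hs : 2 * (s - 1) ^ 2 < 1) : HasTriple N s := by
  obtain ⟨x₁, y₁, x₃, y₃, c, d, g⟩ := h.exists_isGood hN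
  have hsl := h.lower
  have n₃ := c.n₃
  rw [N.comp_reflect] at n₃
  rcases g with ⟨g1, g2, g3⟩ | ⟨g1, g2, g3⟩
  · have hM := h.le_of_isSpread hs c d le_rfl g1.ge g2 g3
    refine hasTriple_of_frame N (p := (x₁, y₁)) (r := (-x₃, y₃)) (by linarith) hs.le hM c.n₁ n₃
      ?_ ?_ ?_ ?_ <;>
      simp only [Prod.smul_mk, Prod.mk_add_mk, Prod.mk_sub_mk, smul_eq_mul, mul_neg,
        sub_neg_eq_add, ← sub_eq_add_neg]
    exacts [le_rfl, g1.le, g2, g3]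
  · have hM := h.le_of_isSpread hs c d g2 g3 le_rfl g1.ge
    refine hasTriple_of_frame N (p := (-x₃, y₃)) (r := (x₁, y₁)) (by linarith) hs.le hM n₃ c.n₁
      ?_ ?_ ?_ ?_
    · refine (congrArg N ?_).le
      ext <;> simp <;> ring
    · rw [g1, ← map_neg_eq_map]
      refine (congrArg N ?_).le
      ext <;> simp; ring
    · convert g2 using 2
      ext <;> simp <;> ring
    · rw [← map_neg_eq_map]
      convert g3 using 2
      ext <;> simp

theorem HasTriple.of_comp {E F : Type*} [AddCommGroup E] [Module ℝ E] [AddCommGroup F]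
    [Module ℝ F] {N : Seminorm ℝ F} {L : E →ₗ[ℝ] F} (h : HasTriple (N.comp L) s) :
    HasTriple N s := by
  obtain ⟨a, b, c, h⟩ := h
  refine ⟨L a, L b, L c, ?_⟩
  simpa only [Seminorm.comp_apply, map_sub] using h

theorem hasTriple_of_definite (hN : ∀ z, N z = 0 → z = 0) (hs : 1707 / 1000 ≤ s)
    (hs' : 2 * (s - 1) ^ 2 < 1) : HasTriple N s := by
  have hsu : s ≤ 17072 / 10000 := by nlinarith
  obtain ⟨p, r, f⟩ := exists_isEvenFrame hN (s := s) (by linarith) (by linarith)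
  rcases le_total (s ^ 2 - 1) (N (s • p + r)) with hm | hm
  · exact hasTriple_of_frame N (by linarith) hs'.le hm f.left f.right le_rfl f.eq.ge f.add_le f.sub_le
  have hsm : s ≤ N (s • p + r) := by
    have := map_add_le_add N (s • p + r) (s • p - r)
    rw [show s • p + r + (s • p - r) = (2 * s) • p by module,
      N.map_smul_of_nonneg' (by linarith), f.left, f.eq] at this
    linarith
  let L : (ℝ × ℝ) →ₗ[ℝ] (ℝ × ℝ) :=
    (LinearMap.fst ℝ ℝ ℝ).smulRight p + (LinearMap.snd ℝ ℝ ℝ).smulRight r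
  have hL : ∀ x y, L (x, y) = x • p + y • r := fun x y => by simp [L]
  refine HasTriple.of_comp (L := L) (IsEvenBasis.hasTriple (m := N (s • p + r)) ?_ ?_ hs')
  · rintro ⟨x, y⟩ hz
    have h0 := hN _ hz
    rw [hL] at h0
    have hx : x * cross p r = cross (x • p + y • r) r := by simp [cross]; ring
    have hy : y * cross p r = cross p (x • p + y • r) := by simp [cross]; ring
    rw [h0, show cross 0 r = 0 by simp [cross]] at hx
    rw [h0, show cross p 0 = 0 by simp [cross]] at hy
    have hx' : x = 0 := (mul_eq_zero.1 hx).resolve_right f.indep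
    have hy' : y = 0 := (mul_eq_zero.1 hy).resolve_right f.indep
    rw [hx', hy']; rfl
  · refine ⟨?_, ?_, ?_, ?_, ?_, ?_, hs, hsu, hsm, hm⟩ <;> rw [Seminorm.comp_apply, hL]
    · simpa using f.left
    · simpa using f.right
    · rw [one_smul]
    · rw [neg_smul, one_smul, ← sub_eq_add_neg, f.eq]
    · rw [one_smul]; exact f.add_le
    · rw [neg_smul, one_smul, ← sub_eq_add_neg]; exact f.sub_le

end Main

/-- For every two-dimensional centrally symmetric convex domain `C`,
`γ*(C) ≤ 2(2 − √2)`. -/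
theorem gammaStar_le (C : Set (ℝ × ℝ)) (hcpt : IsCompact C) (hconv : Convex ℝ C)
    (hint : (interior C).Nonempty) (hsymm : C = -C) :
    gammaStar C ≤ 2 * (2 - Real.sqrt 2) := by
  obtain ⟨N, hN, hC, hi⟩ := exists_gauge hcpt hconv hint hsymm
  have h2 : Real.sqrt 2 ^ 2 = 2 := Real.sq_sqrt (by norm_num)
  have hr : 1414 / 1000 < Real.sqrt 2 := Real.lt_sqrt_of_sq_lt (by norm_num)
  have hlim : 2 * (2 - Real.sqrt 2) = 2 / (1 + Real.sqrt 2 / 2) := by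
    rw [eq_div_iff (by positivity)]
    nlinarith
  rw [hlim]
  have hbound : ∀ s ∈ Ioo (1707 / 1000 : ℝ) (1 + Real.sqrt 2 / 2), gammaStar C ≤ 2 / s := by
    intro s hs
    have h1 := hs.1
    have h3 : (s - 1) ^ 2 < (Real.sqrt 2 / 2) ^ 2 :=
      pow_lt_pow_left₀ (by linarith [hs.2]) (by linarith) two_ne_zero
    exact gammaStar_le_of_hasTriple hC hi (by linarith)
      (hasTriple_of_definite hN h1.le (by nlinarith))
  have hne : (1 + Real.sqrt 2 / 2) ≠ 0 := by positivity
  have hcont : ContinuousAt (fun s : ℝ => 2 / s) (1 + Real.sqrt 2 / 2) :=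
    continuousAt_const.div continuousAt_id hne
  refine ge_of_tendsto (hcont.tendsto.mono_left (nhdsWithin_le_nhds (s := Iio (1 + Real.sqrt 2 / 2)))) ?_
  filter_upwards [Ioo_mem_nhdsLT (show 1707 / 1000 < 1 + Real.sqrt 2 / 2 by linarith)] with s hs
  exact hbound s hs
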